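/- arXiv:2011.04255 — 2 statements merged into one kernel-verified Lean document; each statement's English description precedes it below -/
import Mathlib

section
/- If T is a maximal outerplanar graph of order n ≥ 5 and T is not isomorphic to H_1 or H_2, then γ_t(T) ≤ ⌊2n/5⌋. -/
/-!
Common definitions.

A *plane graph* is a finite graph whose vertices are points of the plane `ℝ × ℝ` and whose
edges are drawn as straight-line segments between their endpoints (by Fáry's theorem every
planar graph admits such a drawing).  A *near-triangulation* is a plane graph that is properly
embedded, biconnected, and all of whose bounded faces are triangles (the faces are the
connected components of the complement of the drawing).  The boundary cycle lists, cyclically,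
the vertices on the outer (unbounded) face.
-/

open scoped Classical

noncomputable section

/-- A finite graph drawn in the plane: the vertices are points of `ℝ × ℝ` and each edge is
drawn as the straight-line segment between its endpoints. -/
structure PlaneGraph where
  verts : Finset (ℝ × ℝ)
  Adj : ℝ × ℝ → ℝ × ℝ → Prop
  symm : ∀ p q, Adj p q → Adj q p
  loopless : ∀ p, ¬ Adj p p
  mem_of_adj : ∀ p q, Adj p q → p ∈ verts ∧ q ∈ verts

namespace PlaneGraph

variable (G : PlaneGraph)

/-- The union of the (closed) segments realizing the edges of the graph. -/
def drawing : Set (ℝ × ℝ) := {x | ∃ p q, G.Adj p q ∧ x ∈ segment ℝ p q}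

/-- The straight-line drawing is a proper plane embedding: two edges meet only in common
endpoints and no vertex lies on an edge of which it is not an endpoint. -/
def IsEmbedded : Prop :=
  (∀ p q r s, G.Adj p q → G.Adj r s → ∀ x, x ∈ segment ℝ p q → x ∈ segment ℝ r s →
      ({p, q} : Set (ℝ × ℝ)) = {r, s} ∨
        (x ∈ ({p, q} : Set (ℝ × ℝ)) ∧ x ∈ ({r, s} : Set (ℝ × ℝ)))) ∧
  (∀ p q v, G.Adj p q → v ∈ G.verts → v ∈ segment ℝ p q → v = p ∨ v = q)

/-- Reachability by walks in the graph. -/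
def Reachable (p q : ℝ × ℝ) : Prop := Relation.ReflTransGen G.Adj p q

/-- The graph is connected. -/
def Connected : Prop := G.verts.Nonempty ∧ ∀ p ∈ G.verts, ∀ q ∈ G.verts, G.Reachable p q

/-- Deletion of a set of vertices together with all incident edges. -/
def deleteVerts (S : Finset (ℝ × ℝ)) : PlaneGraph where
  verts := G.verts \ S
  Adj := fun p q => G.Adj p q ∧ p ∉ S ∧ q ∉ S
  symm := fun p q h => ⟨G.symm p q h.1, h.2.2, h.2.1⟩
  loopless := fun p h => G.loopless p h.1
  mem_of_adj := fun p q h => by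
    obtain ⟨h1, h2⟩ := G.mem_of_adj p q h.1
    exact ⟨Finset.mem_sdiff.mpr ⟨h1, h.2.1⟩, Finset.mem_sdiff.mpr ⟨h2, h.2.2⟩⟩

/-- Deletion of a single edge (keeping all vertices). -/
def deleteEdge (p q : ℝ × ℝ) : PlaneGraph where
  verts := G.verts
  Adj := fun a b => G.Adj a b ∧ ¬ ((a = p ∧ b = q) ∨ (a = q ∧ b = p))
  symm := fun a b h => ⟨G.symm a b h.1, by tauto⟩
  loopless := fun a h => G.loopless a h.1
  mem_of_adj := fun a b h => G.mem_of_adj a b h.1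

/-- The (abstract, simple) graph obtained by contracting the edge `(p, q)`:
the vertex `q` is merged into `p`, which becomes the new contracted vertex. -/
def contractEdge (p q : ℝ × ℝ) : PlaneGraph where
  verts := G.verts.erase q
  Adj := fun a b =>
    a ≠ b ∧ a ∈ G.verts.erase q ∧ b ∈ G.verts.erase q ∧
      (G.Adj a b ∨ (a = p ∧ G.Adj q b) ∨ (b = p ∧ G.Adj q a))
  symm := fun a b h => by
    obtain ⟨h1, h2, h3, h4⟩ := h
    refine ⟨h1.symm, h3, h2, ?_⟩
    rcases h4 with h4 | h4 | h4
    · exact Or.inl (G.symm _ _ h4)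
    · exact Or.inr (Or.inr h4)
    · exact Or.inr (Or.inl h4)
  loopless := fun a h => h.1 rfl
  mem_of_adj := fun a b h => ⟨h.2.1, h.2.2.1⟩

/-- Biconnectivity: at least three vertices, connected, and deleting any single vertex leaves
a connected graph. -/
def Biconnected : Prop :=
  3 ≤ G.verts.card ∧ G.Connected ∧ ∀ v ∈ G.verts, (G.deleteVerts {v}).Connected

/-- A face of the plane graph: a connected component of the complement of the drawing. -/
def IsFace (F : Set (ℝ × ℝ)) : Prop :=
  ∃ x, x ∉ G.drawing ∧ F = connectedComponentIn G.drawingᶜ x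

/-- The open triangle with the three given corners. -/
def openTriangle (a b c : ℝ × ℝ) : Set (ℝ × ℝ) :=
  interior (convexHull ℝ ({a, b, c} : Set (ℝ × ℝ)))

/-- Every bounded (inner) face of the drawing is a triangular face of the graph. -/
def InnerFacesTriangles : Prop :=
  ∀ F, G.IsFace F → Bornology.IsBounded F →
    ∃ a ∈ G.verts, ∃ b ∈ G.verts, ∃ c ∈ G.verts,
      G.Adj a b ∧ G.Adj b c ∧ G.Adj a c ∧ F = openTriangle a b c

/-- A near-triangulation: a properly embedded biconnected plane graph all of whose faces are
triangles, except possibly the outer (unbounded) face. -/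
def IsNearTriangulation : Prop :=
  G.IsEmbedded ∧ G.Biconnected ∧ G.InnerFacesTriangles

/-- The outer region: the union of the unbounded components of the complement of the
drawing (for a near-triangulation this is the outer face). -/
def outerRegion : Set (ℝ × ℝ) :=
  {x | x ∉ G.drawing ∧ ¬ Bornology.IsBounded (connectedComponentIn G.drawingᶜ x)}

/-- `u : ZMod h → ℝ × ℝ` is the boundary cycle of `G`: an injective cyclic sequence
`u 0, u 1, …, u (h-1)` of vertices, consecutive ones adjacent, whose edges bound the outer
face and which contains every vertex lying on the boundary of the outer face. -/
def IsBoundaryCycle {h : ℕ} (u : ZMod h → ℝ × ℝ) : Prop :=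
  3 ≤ h ∧ Function.Injective u ∧
  (∀ i, u i ∈ G.verts) ∧
  (∀ i, G.Adj (u i) (u (i + 1))) ∧
  (∀ i, segment ℝ (u i) (u (i + 1)) ⊆ frontier G.outerRegion) ∧
  (∀ v ∈ G.verts, (v : ℝ × ℝ) ∈ frontier G.outerRegion → v ∈ Set.range u)

/-- An interior vertex: a vertex not on the boundary cycle. -/
def IsInteriorVtx {h : ℕ} (u : ZMod h → ℝ × ℝ) (v : ℝ × ℝ) : Prop :=
  v ∈ G.verts ∧ v ∉ Set.range u

/-- The edge `(p, q)` is a diagonal: it joins two non-consecutive boundary vertices. -/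
def IsDiagonalEdge {h : ℕ} (u : ZMod h → ℝ × ℝ) (p q : ℝ × ℝ) : Prop :=
  G.Adj p q ∧ ∃ i j : ZMod h, p = u i ∧ q = u j ∧ j ≠ i + 1 ∧ i ≠ j + 1

/-- The graph has no diagonals: any edge between boundary vertices joins consecutive ones. -/
def HasNoDiagonals {h : ℕ} (u : ZMod h → ℝ × ℝ) : Prop :=
  ∀ i j : ZMod h, G.Adj (u i) (u j) → j = i + 1 ∨ i = j + 1

/-- The degree of a vertex. -/
def degree (v : ℝ × ℝ) : ℕ := (G.verts.filter (fun w => G.Adj v w)).card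

/-- The degree of a vertex in the subgraph induced on the set `S` of vertices. -/
def degreeOn (S : Set (ℝ × ℝ)) (v : ℝ × ℝ) : ℕ :=
  (G.verts.filter (fun w => G.Adj v w ∧ w ∈ S)).card

/-- A total dominating set: every vertex of the graph is adjacent to a member of `D`. -/
def IsTDS (D : Finset (ℝ × ℝ)) : Prop :=
  D ⊆ G.verts ∧ ∀ v ∈ G.verts, ∃ d ∈ D, G.Adj v d

/-- The total domination number `γₜ`. -/
def totalDominationNumber : ℕ :=
  sInf {k | ∃ D : Finset (ℝ × ℝ), G.IsTDS D ∧ D.card = k}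

/-- Isomorphism of plane graphs as abstract graphs. -/
def IsIsoTo (H : PlaneGraph) : Prop :=
  ∃ f : ℝ × ℝ → ℝ × ℝ,
    Set.BijOn f (↑G.verts) (↑H.verts) ∧
    ∀ p ∈ G.verts, ∀ q ∈ G.verts, (G.Adj p q ↔ H.Adj (f p) (f q))

/-- The edge `(p, q)` is contractible: the contracted graph `G/e` is (abstractly isomorphic
to) a near-triangulation. -/
def IsContractible (p q : ℝ × ℝ) : Prop :=
  G.Adj p q ∧ ∃ H : PlaneGraph, H.IsNearTriangulation ∧ (G.contractEdge p q).IsIsoTo H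

/-- A separating triangle: a triangle of the graph with some vertex strictly inside it and
some vertex outside it. -/
def IsSeparatingTriangle (a b c : ℝ × ℝ) : Prop :=
  a ∈ G.verts ∧ b ∈ G.verts ∧ c ∈ G.verts ∧
  G.Adj a b ∧ G.Adj b c ∧ G.Adj a c ∧
  (∃ v ∈ G.verts, v ∈ openTriangle a b c) ∧
  (∃ v ∈ G.verts, v ∉ convexHull ℝ ({a, b, c} : Set (ℝ × ℝ)))

/-- Edge list of the first exceptional 12-vertex maximal outerplanar graph `H₁`
(boundary 12-cycle, central triangle `{0,4,8}`, ear triangles `{1,2,3}`, `{5,6,7}`,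
`{9,10,11}`, and the three remaining quadrilateral diagonals, all with the same
orientation). -/
def exc1Edges : List (Fin 12 × Fin 12) :=
  [(0,1),(1,2),(2,3),(3,4),(4,5),(5,6),(6,7),(7,8),(8,9),(9,10),(10,11),(11,0),
   (0,4),(4,8),(0,8),(1,3),(5,7),(9,11),(0,3),(4,7),(8,11)]

/-- Edge list of the second exceptional 12-vertex maximal outerplanar graph `H₂`
(same as `H₁` except that one quadrilateral diagonal has the opposite orientation). -/
def exc2Edges : List (Fin 12 × Fin 12) :=
  [(0,1),(1,2),(2,3),(3,4),(4,5),(5,6),(6,7),(7,8),(8,9),(9,10),(10,11),(11,0),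
   (0,4),(4,8),(0,8),(1,3),(5,7),(9,11),(0,3),(4,7),(0,9)]

/-- The exceptional graph `H₁`. -/
def H1graph : SimpleGraph (Fin 12) := SimpleGraph.fromRel (fun a b => (a, b) ∈ exc1Edges)

/-- The exceptional graph `H₂`. -/
def H2graph : SimpleGraph (Fin 12) := SimpleGraph.fromRel (fun a b => (a, b) ∈ exc2Edges)

/-- Isomorphism between a plane graph and a simple graph on `Fin 12`. -/
def IsIsoToSG (H : SimpleGraph (Fin 12)) : Prop :=
  ∃ f : ℝ × ℝ → Fin 12,
    Set.BijOn f (↑G.verts) Set.univ ∧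
    ∀ p ∈ G.verts, ∀ q ∈ G.verts, (G.Adj p q ↔ H.Adj (f p) (f q))

/-- `G` is isomorphic to `H₁` or to `H₂`. -/
def IsExceptional : Prop := G.IsIsoToSG H1graph ∨ G.IsIsoToSG H2graph

/-- A maximal outerplanar graph (MOP): a near-triangulation all of whose vertices lie on the
boundary cycle. -/
def IsMOP : Prop :=
  G.IsNearTriangulation ∧
    ∃ (h : ℕ) (u : ZMod h → ℝ × ℝ), G.IsBoundaryCycle u ∧ ∀ v ∈ G.verts, v ∈ Set.range u

/-- The graph is Hamiltonian: it has a cycle through all of its vertices. -/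
def IsHamiltonian : Prop :=
  ∃ (m : ℕ) (c : ZMod m → ℝ × ℝ), 3 ≤ m ∧ Function.Injective c ∧
    (∀ i, G.Adj (c i) (c (i + 1))) ∧ ∀ v ∈ G.verts, v ∈ Set.range c

/-- An outerplane graph: a properly embedded plane graph all of whose vertices lie on the
boundary of the outer region. -/
def IsOuterplane : Prop :=
  G.IsEmbedded ∧ ∀ v ∈ G.verts, (v : ℝ × ℝ) ∈ closure G.outerRegion

/-- The union of the boundary-cycle segments. -/
def boundaryDrawing {h : ℕ} (u : ZMod h → ℝ × ℝ) : Set (ℝ × ℝ) :=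
  ⋃ i : ZMod h, segment ℝ (u i) (u (i + 1))

/-- The open interior of the boundary cycle, viewed as a simple closed polygon. -/
def polygonInterior {h : ℕ} (u : ZMod h → ℝ × ℝ) : Set (ℝ × ℝ) :=
  {x | x ∉ boundaryDrawing u ∧
    Bornology.IsBounded (connectedComponentIn (boundaryDrawing u)ᶜ x)}

/-- The union of the segments realizing the diagonals of `G[C]`. -/
def diagonalDrawing {h : ℕ} (u : ZMod h → ℝ × ℝ) : Set (ℝ × ℝ) :=
  {x | ∃ i j : ZMod h, G.Adj (u i) (u j) ∧ j ≠ i + 1 ∧ i ≠ j + 1 ∧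
    x ∈ segment ℝ (u i) (u j)}

/-- A region of the subdivision of the interior of the boundary cycle by the diagonals of
`G[C]`: a connected component of the interior of the cycle minus the diagonals. -/
def IsSubdivisionRegion {h : ℕ} (u : ZMod h → ℝ × ℝ) (R : Set (ℝ × ℝ)) : Prop :=
  ∃ x ∈ polygonInterior u \ G.diagonalDrawing u,
    R = connectedComponentIn (polygonInterior u \ G.diagonalDrawing u) x

/-- The diagonal `(u i, u j)` is a side of the region `R`. -/
def IsSideOf {h : ℕ} (u : ZMod h → ℝ × ℝ) (R : Set (ℝ × ℝ)) (i j : ZMod h) : Prop :=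
  G.Adj (u i) (u j) ∧ j ≠ i + 1 ∧ i ≠ j + 1 ∧
    segment ℝ (u i) (u j) \ {u i, u j} ⊆ frontier R

/-- `v` lies on the opposite side of the diagonal `(u i, u j)` from the region `R`:
inside the boundary polygon, `v` cannot be joined to `R` without crossing the diagonal. -/
def OppositeSideOf {h : ℕ} (u : ZMod h → ℝ × ℝ) (R : Set (ℝ × ℝ)) (i j : ZMod h)
    (v : ℝ × ℝ) : Prop :=
  ∀ x ∈ R, v ∉ connectedComponentIn (polygonInterior u \ segment ℝ (u i) (u j)) x

/-- A terminal polygon: a region of the subdivision containing some interior vertex such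
that at most one of its sides has interior vertices of `G` on its opposite side
(i.e. at most one of the outer parts `T_out(P,d)` contains interior vertices). -/
def IsTerminalPolygon {h : ℕ} (u : ZMod h → ℝ × ℝ) (R : Set (ℝ × ℝ)) : Prop :=
  G.IsSubdivisionRegion u R ∧
  (∃ v, G.IsInteriorVtx u v ∧ v ∈ R) ∧
  ∀ i j k l : ZMod h,
    G.IsSideOf u R i j → G.IsSideOf u R k l →
    (∃ w, G.IsInteriorVtx u w ∧ OppositeSideOf u R i j w) →
    (∃ w, G.IsInteriorVtx u w ∧ OppositeSideOf u R k l w) →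
    ({u i, u j} : Set (ℝ × ℝ)) = {u k, u l}

/-- An irreducible near-triangulation: it has interior vertices, and for every boundary edge
`(u i, u (i+1))` the third vertex of the inner triangular face containing this edge also lies
on the boundary cycle. -/
def Irreducible {h : ℕ} (u : ZMod h → ℝ × ℝ) : Prop :=
  (∃ v, G.IsInteriorVtx u v) ∧
  ∀ i : ZMod h, ∀ v ∈ G.verts,
    G.Adj (u i) v → G.Adj (u (i + 1)) v →
    G.IsFace (openTriangle (u i) (u (i + 1)) v) → v ∈ Set.range u

end PlaneGraph

/-- Plane binary trees.  A tree with `m` leaves encodes a triangulation of a polygon with `m + 1`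
vertices and a distinguished root edge: the other edges correspond to the leaves. -/
inductive PolyTree : Type
  | leaf : PolyTree
  | node : PolyTree → PolyTree → PolyTree
  deriving DecidableEq

namespace PolyTree

/-- The number of leaves. -/
def size : PolyTree → ℕ
  | leaf => 1
  | node l r => l.size + r.size

/-- `t.Realizes A i j` says that the edges of the triangulation encoded by `t`, drawn on the
consecutive vertices `i, i + 1, …, j`, all belong to the relation `A`. -/
def Realizes (A : ℕ → ℕ → Prop) : PolyTree → ℕ → ℕ → Prop
  | leaf, i, j => j = i + 1 ∧ A i j
  | node l r, i, j => A i j ∧ ∃ k, l.Realizes A i k ∧ r.Realizes A k j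

/-- The edges of the triangulation encoded by `t`, with vertices labelled from `i` on. -/
def edges : PolyTree → ℕ → List (ℕ × ℕ)
  | leaf, i => [(i, i + 1)]
  | node l r, i => (i, i + (l.size + r.size)) :: (l.edges i ++ r.edges (i + l.size))

theorem size_pos : ∀ t : PolyTree, 0 < t.size
  | leaf => Nat.one_pos
  | node l _ => Nat.add_pos_left l.size_pos _

theorem Realizes.adj {A : ℕ → ℕ → Prop} {t : PolyTree} {i j : ℕ} (h : t.Realizes A i j) :
    A i j := by
  cases t with
  | leaf => exact h.2
  | node l r => exact h.1

theorem Realizes.eq_add {A : ℕ → ℕ → Prop} {t : PolyTree} {i j : ℕ} (h : t.Realizes A i j) :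
    j = i + t.size := by
  induction t generalizing i j with
  | leaf => exact h.1
  | node l r ihl ihr =>
    obtain ⟨_, k, hl, hr⟩ := h
    rw [ihr hr, ihl hl, size, add_assoc]

theorem Realizes.adj_of_mem_edges {A : ℕ → ℕ → Prop} {t : PolyTree} {i j : ℕ}
    (h : t.Realizes A i j) {e : ℕ × ℕ} (he : e ∈ t.edges i) : A e.1 e.2 := by
  induction t generalizing i j with
  | leaf =>
    rw [edges, List.mem_singleton] at he
    obtain ⟨rfl, h⟩ := h
    rwa [he]
  | node l r ihl ihr =>
    have hj := h.eq_add
    obtain ⟨ha, k, hl, hr⟩ := h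
    rw [edges, List.mem_cons, List.mem_append] at he
    rcases he with rfl | he | he
    · rw [hj] at ha
      exact ha
    · exact ihl hl he
    · exact ihr (i := i + l.size) (hl.eq_add ▸ hr) he

/-- A relation in which every edge `i, j` spanning at least two steps has a common neighbour
strictly between `i` and `j` contains a triangulation of every interval spanned by an edge. -/
theorem exists_realizes {A : ℕ → ℕ → Prop} {n : ℕ}
    (hA : ∀ i j, i + 1 < j → j < n → A i j → ∃ k, i < k ∧ k < j ∧ A i k ∧ A k j)
    {i j : ℕ} (hij : i < j) (hj : j < n) (h : A i j) : ∃ t : PolyTree, t.Realizes A i j := by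
  obtain ⟨m, hm⟩ : ∃ m, m = j - i := ⟨_, rfl⟩
  induction m using Nat.strong_induction_on generalizing i j with
  | _ m ih =>
    by_cases hij' : i + 1 < j
    · obtain ⟨k, hik, hkj, h1, h2⟩ := hA i j hij' hj h
      obtain ⟨l, hl⟩ := ih (k - i) (by omega) hik (by omega) h1 rfl
      obtain ⟨r, hr⟩ := ih (j - k) (by omega) hkj hj h2 rfl
      exact ⟨node l r, h, k, hl, hr⟩
    · exact ⟨leaf, by omega, h⟩

end PolyTree

/-- Upper bounds for the cost of dominating the part of a triangulation spanned by an interval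
`i, …, j` of vertices, depending on which of the end vertices are chosen for free (none for the
fields `o…`, the left one for `l…`, the right one for `r…`, both for `lr`) and on which of the
end vertices have to be dominated as well (those in the capital part of the name of the field; an
end vertex is automatically dominated once the opposite one is chosen).  The cost of `c` vertices
is `5 * c - 2 * (j - i)`. -/
structure DomProfile where
  o : ℤ
  oR : ℤ
  oL : ℤ
  oLR : ℤ
  r : ℤ
  rR : ℤ
  l : ℤ
  lL : ℤ
  lr : ℤ

namespace DomProfile

/-- The bounds for two intervals `i, …, k` and `k, …, j` glued along `k`. -/
def merge (P Q : DomProfile) : DomProfile where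
  o := min (min (P.rR + Q.l) (P.r + Q.lL) + 5) (min (P.oR + Q.o) (P.o + Q.oL))
  oL := min (min (P.rR + Q.l) (P.r + Q.lL) + 5) (min (P.oLR + Q.o) (P.oL + Q.oL))
  oR := min (min (P.rR + Q.l) (P.r + Q.lL) + 5) (min (P.oR + Q.oR) (P.o + Q.oLR))
  oLR := min (min (P.rR + Q.l) (P.r + Q.lL) + 5) (min (P.oLR + Q.oR) (P.oL + Q.oLR))
  r := min (P.o + Q.r) (P.r + Q.lr + 5)
  rR := min (P.o + Q.rR) (P.r + Q.lr + 5)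
  l := min (P.l + Q.o) (P.lr + Q.l + 5)
  lL := min (P.lL + Q.o) (P.lr + Q.l + 5)
  lr := min (P.l + Q.r) (P.lr + Q.lr + 5)

/-- The improvement of the bounds obtained by paying for one further vertex: an end vertex, or a
common neighbour of the end vertices. -/
def relax (P : DomProfile) : DomProfile where
  o := min P.o (min (min P.l P.r + 5) (P.lr + 10))
  oL := min P.oL (min (min P.o (min P.lL P.r) + 5) (min P.l P.lr + 10))
  oR := min P.oR (min (min P.o (min P.l P.rR) + 5) (min P.r P.lr + 10))
  oLR := min P.oLR (min (min P.o (min P.lL P.rR) + 5) (min P.l (min P.r P.lr) + 10))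
  r := min P.r (P.lr + 5)
  rR := min P.rR (min P.r P.lr + 5)
  l := min P.l (P.lr + 5)
  lL := min P.lL (min P.l P.lr + 5)
  lr := P.lr

/-- The resulting bound for dominating the whole triangulation. -/
def total (P : DomProfile) : ℤ := min P.oLR (min (min P.rR P.lL + 5) (P.lr + 10))

/-- All bounds of `P` are at least as good as those of `Q`. -/
def Le (P Q : DomProfile) : Prop :=
  P.o ≤ Q.o ∧ P.oL ≤ Q.oL ∧ P.oR ≤ Q.oR ∧ P.oLR ≤ Q.oLR ∧ P.r ≤ Q.r ∧ P.rR ≤ Q.rR ∧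
    P.l ≤ Q.l ∧ P.lL ≤ Q.lL ∧ P.lr ≤ Q.lr

instance (P Q : DomProfile) : Decidable (P.Le Q) := by
  unfold Le; infer_instance

theorem Le.trans {P Q R : DomProfile} (h : P.Le Q) (h' : Q.Le R) : P.Le R := by
  unfold Le at *; omega

theorem Le.merge {P P' Q Q' : DomProfile} (h : P.Le P') (h' : Q.Le Q') :
    (P.merge Q).Le (P'.merge Q') := by
  simp only [Le, DomProfile.merge] at *; omega

theorem Le.relax {P Q : DomProfile} (h : P.Le Q) : P.relax.Le Q.relax := by
  simp only [Le, DomProfile.relax] at *; omega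

theorem Le.total {P Q : DomProfile} (h : P.Le Q) : P.total ≤ Q.total := by
  simp only [Le, DomProfile.total] at *; omega

end DomProfile

namespace PolyTree

/-- The domination bounds of a triangulation that is part of a larger one. -/
def profile : PolyTree → DomProfile
  | leaf => ⟨-2, 3, 3, 3, -2, 3, -2, 3, -2⟩
  | node l r => (l.profile.merge r.profile).relax

/-- All trees composed of a left subtree from the first and a right one from the second list. -/
def prod (L R : List PolyTree) : List PolyTree := L.flatMap fun a => R.map fun b => node a b

theorem mem_prod {L R : List PolyTree} {t : PolyTree} :
    t ∈ prod L R ↔ ∃ a ∈ L, ∃ b ∈ R, node a b = t := by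
  simp [prod]

/-- The tree of the triangle. -/
def two : PolyTree := node leaf leaf

/-- The two triangulations of a pentagon all of whose bounds are as bad as possible. -/
def pentagons : List PolyTree := [node leaf (node two leaf), node (node leaf two) leaf]

/-- Triangles with a pentagon from `pentagons` glued to both non-root edges. -/
def twins : List PolyTree := prod pentagons pentagons

/-- Triangulations of polygons with ten vertices that arise from `twins`. -/
def tenL : List PolyTree := prod [leaf] twins

/-- The mirror images of the trees in `tenL`. -/
def tenR : List PolyTree := prod twins [leaf]

/-- Triangulations of polygons with eleven vertices that arise from `twins`. -/
def elevens : List PolyTree := prod [leaf] tenR ++ prod tenL [leaf]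

/-- The rooted forms of the exceptional graphs, sorted by their domination bounds. -/
def excM : List PolyTree := prod [leaf] elevens ++ prod elevens [leaf]

/-- Further rooted forms of the exceptional graphs; see `excM`. -/
def excL : List PolyTree := prod [node two leaf] twins ++ prod [two] tenL

/-- The mirror images of the trees in `excL`. -/
def excR : List PolyTree := prod twins [node leaf two] ++ prod tenR [two]

/-- Classes of trees, given by a common domination bound together with the list of all members
of the class, or `none` if this list is not of interest. -/
def classes : List (Option (List PolyTree) × DomProfile) :=
  [(none, ⟨-4, -4, 1, 1, -4, -4, -4, 1, -4⟩),
   (none, ⟨-4, 1, -4, 1, -4, 1, -4, -4, -4⟩),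
   (none, ⟨-3, -3, 2, 2, -3, -3, -3, -3, -3⟩),
   (none, ⟨-3, 2, -3, 2, -3, -3, -3, -3, -3⟩),
   (none, ⟨-2, -2, -2, -2, -2, -2, -2, -2, -2⟩),
   (none, ⟨-1, -1, -1, -1, -6, -1, -1, -1, -6⟩),
   (none, ⟨-1, -1, -1, -1, -1, -1, -6, -1, -6⟩),
   (none, ⟨0, 0, 0, 0, -5, -5, 0, 0, -5⟩),
   (none, ⟨0, 0, 0, 0, 0, 0, -5, -5, -5⟩),
   (none, ⟨1, 1, 1, 1, -4, -4, -4, -4, -4⟩),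
   (none, ⟨2, 2, 2, 2, -3, -3, -3, -3, -8⟩),
   (some [leaf], ⟨-2, 3, 3, 3, -2, 3, -2, 3, -2⟩),
   (some [two], ⟨1, 1, 1, 6, -4, 1, -4, 1, -4⟩),
   (some [node leaf two], ⟨-1, 4, -1, 4, -6, -1, -1, -1, -6⟩),
   (some [node two leaf], ⟨-1, -1, 4, 4, -1, -1, -6, -1, -6⟩),
   (some pentagons, ⟨2, 2, 2, 2, -3, -3, -3, -3, -3⟩),
   (some twins, ⟨-1, -1, -1, -1, -1, -1, -1, -1, -6⟩),
   (some tenL, ⟨-3, -3, 2, 2, -3, -3, -3, 2, -3⟩),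
   (some tenR, ⟨-3, 2, -3, 2, -3, 2, -3, -3, -3⟩),
   (some elevens, ⟨-5, 0, 0, 0, -5, 0, -5, 0, -5⟩),
   (some excM, ⟨-2, -2, -2, 3, -7, -2, -7, -2, -7⟩),
   (some excL, ⟨-2, -2, 3, 3, -2, -2, -7, -2, -7⟩),
   (some excR, ⟨-2, 3, -2, 3, -7, -2, -2, -2, -7⟩)]

/-- `t` is a member of the list of a class. -/
def Listed (t : PolyTree) : Option (List PolyTree) → Prop
  | none => True
  | some l => t ∈ l

/-- Gluing a tree from the first class to one from the second yields a tree from the third. -/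
def gluesInto : Option (List PolyTree) → Option (List PolyTree) → Option (List PolyTree) → Bool
  | _, _, none => true
  | some L, some R, some E => (prod L R).all fun t => decide (t ∈ E)
  | _, _, _ => false

theorem Listed.node {l r : PolyTree} {L R E : Option (List PolyTree)} (hl : l.Listed L)
    (hr : r.Listed R) (h : gluesInto L R E = true) : (node l r).Listed E := by
  match L, R, E with
  | _, _, none => trivial
  | some L, some R, some E =>
    have h' := List.all_eq_true.mp h _ (mem_prod.mpr ⟨l, hl, r, hr, rfl⟩)
    simp only [decide_eq_true_eq] at h'
    exact h'
  | none, _, some _ => exact absurd h (by simp [gluesInto])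
  | some _, none, some _ => exact absurd h (by simp [gluesInto])

theorem classes_closed : (classes.all fun c => classes.all fun d => classes.any fun e =>
    decide ((c.2.merge d.2).relax.Le e.2) && gluesInto c.1 d.1 e.1) = true := by
  decide +kernel

theorem classes_total : (classes.all fun c => classes.all fun d =>
    decide ((c.2.merge d.2).total ≤ 2) || gluesInto c.1 d.1
      (some ([two, node leaf two, node two leaf] ++ (excM ++ (excL ++ excR))))) = true := by
  decide +kernel

theorem exists_class (t : PolyTree) : ∃ c ∈ classes, t.Listed c.1 ∧ t.profile.Le c.2 := by
  induction t with
  | leaf =>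
    exact ⟨(some [leaf], ⟨-2, 3, 3, 3, -2, 3, -2, 3, -2⟩), by simp [classes],
      List.mem_singleton.mpr rfl, by simp [profile, DomProfile.Le]⟩
  | node l r ihl ihr =>
    obtain ⟨c, hc, hlc, hl⟩ := ihl
    obtain ⟨d, hd, hrd, hr⟩ := ihr
    obtain ⟨e, he, h⟩ := List.any_eq_true.mp
      (List.all_eq_true.mp (List.all_eq_true.mp classes_closed c hc) d hd)
    obtain ⟨h1, h2⟩ := Bool.and_eq_true_iff.mp h
    exact ⟨e, he, hlc.node hrd h2, (hl.merge hr).relax.trans (of_decide_eq_true h1)⟩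

theorem total_le_or_mem (l r : PolyTree) (h : 4 ≤ (node l r).size) :
    (l.profile.merge r.profile).total ≤ 2 ∨ node l r ∈ excM ++ (excL ++ excR) := by
  obtain ⟨c, hc, hlc, hl⟩ := exists_class l
  obtain ⟨d, hd, hrd, hr⟩ := exists_class r
  rcases Bool.or_eq_true_iff.mp
    (List.all_eq_true.mp (List.all_eq_true.mp classes_total c hc) d hd) with h' | h'
  · exact .inl ((hl.merge hr).total.trans (of_decide_eq_true h'))
  · rcases List.mem_append.mp (hlc.node hrd h') with h' | h'
    · have : ∀ t ∈ [two, node leaf two, node two leaf], t.size < 4 := by decide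
      exact absurd h (this _ h').not_ge
    · exact .inr h'

end PolyTree

/-- The vertices `u k` with `i < k < j` or `k ∈ X` can be dominated by the vertices in `E`
together with further vertices of cost at most `c`, where `m` vertices cost
`5 * m - 2 * (j - i)`. -/
def CoverCost {V : Type*} (A : V → V → Prop) (u : ℕ → V) (i j : ℕ) (E : Set V) (X : Set ℕ)
    (c : ℤ) : Prop :=
  ∃ D : Finset V, 5 * (D.card : ℤ) ≤ c + 2 * ((j : ℤ) - i) ∧
    ∀ k, (i < k ∧ k < j ∨ k ∈ X) → ∃ d, (d ∈ D ∨ d ∈ E) ∧ A (u k) d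

namespace CoverCost

variable {V : Type*} {A : V → V → Prop} {u : ℕ → V} {i j k : ℕ} {E E₁ E₂ : Set V}
  {X X₁ X₂ : Set ℕ} {c c₁ c₂ : ℤ}

theorem min (h₁ : CoverCost A u i j E X c₁) (h₂ : CoverCost A u i j E X c₂) :
    CoverCost A u i j E X (min c₁ c₂) := by
  rcases min_choice c₁ c₂ with h | h <;> rwa [h]

theorem insert (h : CoverCost A u i j E₁ X₁ c) (x : V) (hE : ∀ e ∈ E₁, e = x ∨ e ∈ E)
    (hX : ∀ k ∈ X, k ∈ X₁ ∨ A (u k) x ∨ ∃ d ∈ E, A (u k) d) :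
    CoverCost A u i j E X (c + 5) := by
  obtain ⟨D, hD, h⟩ := h
  refine ⟨Insert.insert x D, ?_, ?_⟩
  · have := Finset.card_insert_le x D
    omega
  · intro k hk
    by_cases hk' : i < k ∧ k < j ∨ k ∈ X₁
    · obtain ⟨d, hd, hkd⟩ := h k hk'
      refine ⟨d, ?_, hkd⟩
      rcases hd with hd | hd
      · exact .inl (Finset.mem_insert_of_mem hd)
      · rcases hE d hd with rfl | hd
        · exact .inl (Finset.mem_insert_self _ _)
        · exact .inr hd
    · rcases hX k (by tauto) with h | h | ⟨d, hd, h⟩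
      · tauto
      · exact ⟨x, .inl (Finset.mem_insert_self _ _), h⟩
      · exact ⟨d, .inr hd, h⟩

theorem append (h₁ : CoverCost A u i k E₁ X₁ c₁) (h₂ : CoverCost A u k j E₂ X₂ c₂)
    (hE₁ : E₁ ⊆ E) (hE₂ : E₂ ⊆ E)
    (hX : ∀ x, x = k ∨ x ∈ X → x ∈ X₁ ∨ x ∈ X₂ ∨ ∃ d ∈ E, A (u x) d) :
    CoverCost A u i j E X (c₁ + c₂) := by
  obtain ⟨D₁, hD₁, h₁⟩ := h₁
  obtain ⟨D₂, hD₂, h₂⟩ := h₂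
  refine ⟨D₁ ∪ D₂, ?_, ?_⟩
  · have := Finset.card_union_le D₁ D₂
    omega
  · have hl : ∀ x, (i < x ∧ x < k ∨ x ∈ X₁) → ∃ d, (d ∈ D₁ ∪ D₂ ∨ d ∈ E) ∧ A (u x) d := by
      intro x hx
      obtain ⟨d, hd, h⟩ := h₁ x hx
      exact ⟨d, hd.imp (Finset.mem_union_left _) (@hE₁ d), h⟩
    have hr : ∀ x, (k < x ∧ x < j ∨ x ∈ X₂) → ∃ d, (d ∈ D₁ ∪ D₂ ∨ d ∈ E) ∧ A (u x) d := by
      intro x hx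
      obtain ⟨d, hd, h⟩ := h₂ x hx
      exact ⟨d, hd.imp (Finset.mem_union_right _) (@hE₂ d), h⟩
    intro x hx
    by_cases hx' : x = k ∨ x ∈ X
    · rcases hX x hx' with h | h | ⟨d, hd, h⟩
      · exact hl x (.inr h)
      · exact hr x (.inr h)
      · exact ⟨d, .inr hd, h⟩
    · rcases lt_trichotomy x k with h | h | h
      · exact hl x (.inl (by tauto))
      · tauto
      · exact hr x (.inl (by tauto))

theorem append_insert (h₁ : CoverCost A u i k E₁ X₁ c₁) (h₂ : CoverCost A u k j E₂ X₂ c₂)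
    (x : V) (hE₁ : ∀ e ∈ E₁, e = x ∨ e ∈ E) (hE₂ : ∀ e ∈ E₂, e = x ∨ e ∈ E)
    (hX : ∀ y, y = k ∨ y ∈ X → y ∈ X₁ ∨ y ∈ X₂ ∨ A (u y) x ∨ ∃ d ∈ E, A (u y) d) :
    CoverCost A u i j E X (c₁ + c₂ + 5) := by
  refine (append (E := Insert.insert x E) (X := {y | y = k ∨ y ∈ X}) h₁ h₂ hE₁ hE₂ ?_).insert x
    (fun e he => he) fun y hy => .inl (.inr hy)
  intro y hy
  rcases hX y (by simpa [← or_assoc] using hy) with h | h | h | ⟨d, hd, h⟩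
  · exact .inl h
  · exact .inr (.inl h)
  · exact .inr (.inr ⟨x, .inl rfl, h⟩)
  · exact .inr (.inr ⟨d, .inr hd, h⟩)

end CoverCost

/-- The part of a graph spanned by the vertices `u i, …, u j` obeys the bounds `P`. -/
structure DomProfile.IsBound {V : Type*} (P : DomProfile) (A : V → V → Prop) (u : ℕ → V)
    (i j : ℕ) : Prop where
  o : CoverCost A u i j ∅ ∅ P.o
  oR : CoverCost A u i j ∅ {j} P.oR
  oL : CoverCost A u i j ∅ {i} P.oL
  oLR : CoverCost A u i j ∅ {i, j} P.oLR
  r : CoverCost A u i j {u j} ∅ P.r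
  rR : CoverCost A u i j {u j} {j} P.rR
  l : CoverCost A u i j {u i} ∅ P.l
  lL : CoverCost A u i j {u i} {i} P.lL
  lr : CoverCost A u i j {u i, u j} ∅ P.lr

namespace DomProfile.IsBound

variable {V : Type*} {A : V → V → Prop} {u : ℕ → V} {i j k : ℕ} {P Q : DomProfile}

theorem merge (hA : ∀ a b, A a b → A b a) (hP : P.IsBound A u i k) (hQ : Q.IsBound A u k j)
    (hik : A (u i) (u k)) (hkj : A (u k) (u j)) : (P.merge Q).IsBound A u i j := by
  have hki := hA _ _ hik
  have hjk := hA _ _ hkj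
  constructor <;> simp only [DomProfile.merge, ← min_add_add_right]
  · refine .min (.min (.append_insert hP.rR hQ.l (u k) ?_ ?_ ?_)
      (.append_insert hP.r hQ.lL (u k) ?_ ?_ ?_))
      (.min (.append hP.oR hQ.o ?_ ?_ ?_) (.append hP.o hQ.oL ?_ ?_ ?_)) <;> simp_all
  · refine .min (.min (.append_insert hP.rR hQ.l (u k) ?_ ?_ ?_)
      (.append_insert hP.r hQ.lL (u k) ?_ ?_ ?_))
      (.min (.append hP.oR hQ.oR ?_ ?_ ?_) (.append hP.o hQ.oLR ?_ ?_ ?_)) <;> simp_all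
  · refine .min (.min (.append_insert hP.rR hQ.l (u k) ?_ ?_ ?_)
      (.append_insert hP.r hQ.lL (u k) ?_ ?_ ?_))
      (.min (.append hP.oLR hQ.o ?_ ?_ ?_) (.append hP.oL hQ.oL ?_ ?_ ?_)) <;> simp_all
  · refine .min (.min (.append_insert hP.rR hQ.l (u k) ?_ ?_ ?_)
      (.append_insert hP.r hQ.lL (u k) ?_ ?_ ?_))
      (.min (.append hP.oLR hQ.oR ?_ ?_ ?_) (.append hP.oL hQ.oLR ?_ ?_ ?_)) <;> simp_all
  · exact .min (.append hP.o hQ.r (by simp) (by simp) (by simp_all))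
      (.append_insert hP.r hQ.lr (u k) (by simp) (by simp) (by simp_all))
  · exact .min (.append hP.o hQ.rR (by simp) (by simp) (by simp_all))
      (.append_insert hP.r hQ.lr (u k) (by simp) (by simp) (by simp_all))
  · exact .min (.append hP.l hQ.o (by simp) (by simp) (by simp_all))
      (.append_insert hP.lr hQ.l (u k) (by simp) (by simp) (by simp_all))
  · exact .min (.append hP.lL hQ.o (by simp) (by simp) (by simp_all))
      (.append_insert hP.lr hQ.l (u k) (by simp) (by simp) (by simp_all))
  · exact .min (.append hP.l hQ.r (by simp) (by simp) (by simp_all))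
      (.append_insert hP.lr hQ.lr (u k) (by simp) (by simp) (by simp_all))

theorem relax (hA : ∀ a b, A a b → A b a) (hP : P.IsBound A u i j) (hij : A (u i) (u j))
    {x : V} (hi : A (u i) x) (hj : A (u j) x) : P.relax.IsBound A u i j := by
  have hji := hA _ _ hij
  have h10 : ∀ a : ℤ, a + 10 = a + 5 + 5 := fun a => by ring
  constructor <;> simp only [DomProfile.relax, ← min_add_add_right, h10]
  · exact .min hP.o (.min (.min (hP.l.insert (u i) (by simp) (by simp))
      (hP.r.insert (u j) (by simp) (by simp)))
      ((hP.lr.insert (E := {u j}) (X := ∅) (u i) (by simp) (by simp)).insert (u j)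
        (by simp) (by simp)))
  · exact .min hP.oR (.min (.min (hP.o.insert x (by simp) (by simp_all))
      (.min (hP.l.insert (u i) (by simp) (by simp_all))
        (hP.rR.insert (u j) (by simp) (by simp_all))))
      (.min ((hP.r.insert (E := {u j}) (X := {j}) x (by simp) (by simp_all)).insert (u j)
          (by simp) (by simp))
        ((hP.lr.insert (E := {u j}) (X := {j}) (u i) (by simp) (by simp_all)).insert (u j)
          (by simp) (by simp))))
  · exact .min hP.oL (.min (.min (hP.o.insert x (by simp) (by simp_all))
      (.min (hP.lL.insert (u i) (by simp) (by simp_all))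
        (hP.r.insert (u j) (by simp) (by simp_all))))
      (.min ((hP.l.insert (E := {u i}) (X := {i}) x (by simp) (by simp_all)).insert (u i)
          (by simp) (by simp))
        ((hP.lr.insert (E := {u j}) (X := {i}) (u i) (by simp) (by simp_all)).insert (u j)
          (by simp) (by simp))))
  · exact .min hP.oLR (.min (.min (hP.o.insert x (by simp) (by simp_all))
      (.min (hP.lL.insert (u i) (by simp) (by simp_all))
        (hP.rR.insert (u j) (by simp) (by simp_all))))
      (.min ((hP.l.insert (E := {u i}) (X := {i, j}) x (by simp) (by simp_all)).insert (u i)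
          (by simp) (by simp))
        (.min ((hP.r.insert (E := {u j}) (X := {i, j}) x (by simp) (by simp_all)).insert (u j)
          (by simp) (by simp))
        ((hP.lr.insert (E := {u j}) (X := {i, j}) (u i) (by simp) (by simp_all)).insert (u j)
          (by simp) (by simp)))))
  · exact .min hP.r (hP.lr.insert (u i) (by simp) (by simp))
  · exact .min hP.rR (.min (hP.r.insert x (by simp) (by simp_all))
      (hP.lr.insert (u i) (by simp) (by simp_all)))
  · exact .min hP.l (hP.lr.insert (u j) (by simp) (by simp))
  · exact .min hP.lL (.min (hP.l.insert x (by simp) (by simp_all))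
      (hP.lr.insert (u j) (by simp) (by simp_all)))
  · exact hP.lr

theorem total (hA : ∀ a b, A a b → A b a) (hP : P.IsBound A u i j) (hij : A (u i) (u j)) :
    CoverCost A u i j ∅ {i, j} P.total := by
  have hji := hA _ _ hij
  have h10 : ∀ a : ℤ, a + 10 = a + 5 + 5 := fun a => by ring
  simp only [DomProfile.total, ← min_add_add_right, h10]
  exact .min hP.oLR (.min (.min (hP.rR.insert (u j) (by simp) (by simp_all))
      (hP.lL.insert (u i) (by simp) (by simp_all)))
    ((hP.lr.insert (E := {u j}) (X := {i, j}) (u i) (by simp) (by simp_all)).insert (u j)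
      (by simp) (by simp)))

end DomProfile.IsBound

namespace PolyTree

variable {V : Type*} {A : V → V → Prop} {u : ℕ → V}

theorem isBound_profile (hA : ∀ a b, A a b → A b a) (t : PolyTree) {i j : ℕ}
    (ht : t.Realizes (fun a b => A (u a) (u b)) i j) {x : V} (hi : A (u i) x) (hj : A (u j) x) :
    t.profile.IsBound A u i j := by
  induction t generalizing i j x with
  | leaf =>
    obtain ⟨rfl, hij⟩ := ht
    have hji := hA _ _ hij
    have h0 : ∀ E, CoverCost A u i (i + 1) E ∅ (-2) := fun E =>
      ⟨∅, by push_cast; norm_num, fun k hk => absurd hk (by simp)⟩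
    have h3 : ∀ E X, (∀ k ∈ X, k = i ∨ k = i + 1) → CoverCost A u i (i + 1) E X 3 :=
      fun E X hX => (h0 E).insert x (fun e he => .inr he) fun k hk => .inr (.inl (by
        rcases hX k hk with rfl | rfl <;> assumption))
    constructor <;> first | exact h0 _ | exact h3 _ _ (by simp)
  | node l r ihl ihr =>
    obtain ⟨hij, k, hl, hr⟩ := ht
    have hki := hA _ _ hl.adj
    exact ((ihl hl hij hr.adj).merge hA (ihr hr hki (hA _ _ hij)) hl.adj hr.adj).relax hA hij hi hj

/-- A triangulation that does not have one of the exceptional forms has a small total dominating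
set. -/
theorem exists_dominating (hA : ∀ a b, A a b → A b a) {l r : PolyTree} {m : ℕ}
    (ht : (node l r).Realizes (fun a b => A (u a) (u b)) 0 m) (hm : 4 ≤ m) :
    (∃ D : Finset V, 5 * D.card ≤ 2 * (m + 1) ∧ ∀ k ≤ m, ∃ d ∈ D, A (u k) d) ∨
      node l r ∈ excM ++ (excL ++ excR) := by
  rcases total_le_or_mem l r (by have := ht.eq_add; omega) with h | h
  · left
    obtain ⟨hij, k, hl, hr⟩ := ht
    have hki := hA _ _ hl.adj
    obtain ⟨D, hD, hdom⟩ := (((isBound_profile hA l hl hij hr.adj).merge hA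
      (isBound_profile hA r hr hki (hA _ _ hij)) hl.adj hr.adj).total hA hij)
    refine ⟨D, by push_cast at hD; omega, fun k hk => ?_⟩
    obtain ⟨d, hd, h⟩ := hdom k (by simp; omega)
    exact ⟨d, hd.resolve_right (by simp), h⟩
  · exact .inr h

end PolyTree

namespace PolyTree

/-- The relation given by a list of pairs, symmetrized and evaluated to a Boolean. -/
def joined {α : Type*} [BEq α] (L : List (α × α)) (a b : α) : Bool :=
  L.contains (a, b) || L.contains (b, a)

theorem joined_comm {α : Type*} [BEq α] (L : List (α × α)) (a b : α) :
    joined L a b = joined L b a := Bool.or_comm _ _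

theorem exceptional_iso : ((excM ++ (excL ++ excR)).all fun t =>
    [PlaneGraph.exc1Edges, PlaneGraph.exc2Edges].any fun L =>
      (List.finRange 12).any fun a => [(1 : Fin 12), 11].any fun s =>
        (List.finRange 12).all fun i => (List.finRange 12).all fun j =>
          joined (t.edges 0) i.val j.val == joined L (a + s * i) (a + s * j)) = true := by
  decide +kernel

theorem exceptional_maximal : ((excM ++ (excL ++ excR)).all fun t =>
    (List.range 12).all fun a => (List.range 12).all fun b =>
      b.ble a || joined (t.edges 0) a b || (t.edges 0).any fun e =>
        (a.blt e.1 && e.1.blt b && b.blt e.2 && e.2.blt 12) ||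
          (e.1.blt a && a.blt e.2 && e.2.blt b)) = true := by
  decide +kernel

theorem exceptional_size : ((excM ++ (excL ++ excR)).all fun t => t.size == 11) = true := by
  decide +kernel

/-- A plane relation containing a triangulation of one of the exceptional forms is given, up to a
permutation of the vertices, by one of the two lists of edges. -/
theorem exists_perm_of_mem {A : ℕ → ℕ → Prop} (hA : ∀ i j, A i j → A j i) (hirr : ∀ i, ¬ A i i)
    (hcross : ∀ a b c d, a < c → c < b → b < d → d < 12 → A a b → A c d → False)
    {t : PolyTree} (ht : t ∈ excM ++ (excL ++ excR)) (hr : t.Realizes A 0 11) :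
    ∃ L ∈ [PlaneGraph.exc1Edges, PlaneGraph.exc2Edges], ∃ σ : Equiv.Perm (Fin 12),
      ∀ i j : Fin 12, A i j ↔ joined L (σ i) (σ j) = true := by
  have key : ∀ a b : ℕ, a < b → b < 12 → (A a b ↔ joined (t.edges 0) a b = true) := by
    intro a b hab hb
    constructor
    · intro h
      have hmax := List.all_eq_true.mp (List.all_eq_true.mp (List.all_eq_true.mp
        exceptional_maximal t ht) a (List.mem_range.mpr (hab.trans hb))) b (List.mem_range.mpr hb)
      simp only [Bool.or_eq_true, Nat.ble_eq] at hmax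
      rcases hmax with (hmax | hmax) | hmax
      · exact absurd hab hmax.not_gt
      · exact hmax
      · obtain ⟨e, he, hmax⟩ := List.any_eq_true.mp hmax
        have hae := hr.adj_of_mem_edges he
        simp only [Bool.or_eq_true, Bool.and_eq_true, Nat.blt_eq] at hmax
        rcases hmax with ⟨⟨⟨h1, h2⟩, h3⟩, h4⟩ | ⟨⟨h1, h2⟩, h3⟩
        · exact (hcross _ _ _ _ h1 h2 h3 h4 h hae).elim
        · exact (hcross _ _ _ _ h1 h2 h3 hb hae h).elim
    · intro h
      simp only [joined, Bool.or_eq_true, List.contains_iff_mem] at h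
      rcases h with h | h
      · exact hr.adj_of_mem_edges h
      · exact hA _ _ (hr.adj_of_mem_edges h)
  obtain ⟨L, hL, h⟩ := List.any_eq_true.mp (List.all_eq_true.mp exceptional_iso t ht)
  obtain ⟨a, -, h⟩ := List.any_eq_true.mp h
  obtain ⟨s, hs, h⟩ := List.any_eq_true.mp h
  have hs2 : s * s = 1 := by
    have : ∀ s ∈ [(1 : Fin 12), 11], s * s = 1 := by decide
    exact this s hs
  have h' : ∀ i j : Fin 12, joined (t.edges 0) i.val j.val = joined L (a + s * i) (a + s * j) :=
    fun i j => eq_of_beq (List.all_eq_true.mp (List.all_eq_true.mp h i (List.mem_finRange i)) j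
      (List.mem_finRange j))
  have hinj : Function.Injective fun i : Fin 12 => a + s * i := by
    intro i j hij
    have hij' : s * i = s * j := by simpa using hij
    calc i = s * s * i := by rw [hs2, one_mul]
      _ = s * s * j := by rw [mul_assoc, hij', mul_assoc]
      _ = j := by rw [hs2, one_mul]
  have hloop : ∀ i : Fin 12, joined L (a + s * i) (a + s * i) = false := by
    have : ∀ L ∈ [PlaneGraph.exc1Edges, PlaneGraph.exc2Edges],
      ∀ i : Fin 12, joined L i i = false := by decide +kernel
    exact fun i => this L hL _
  refine ⟨L, hL, Equiv.ofBijective _ (Finite.injective_iff_bijective.mp hinj), fun i j => ?_⟩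
  change _ ↔ joined L (a + s * i) (a + s * j) = true
  rcases lt_trichotomy i j with hij | rfl | hij
  · rw [key i j hij j.2, h']
  · rw [hloop]
    simpa using hirr i
  · rw [joined_comm, ← h', ← key j i hij i.2]
    exact ⟨hA _ _, hA _ _⟩

end PolyTree

namespace Polygon

open Complex Finset

/-- The angle, in `(-π, π]`, through which the ray from `x` to `p` has to be turned in order to
become the ray from `x` to `q`. -/
def turn (p q x : ℝ × ℝ) : ℝ :=
  (equivRealProdCLM.symm (q - x) / equivRealProdCLM.symm (p - x)).arg

/-- The total angle swept out by the polygonal path `v i, v (i + 1), …, v j`, seen from `x`. -/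
def arcTurn (v : ℕ → ℝ × ℝ) (i j : ℕ) (x : ℝ × ℝ) : ℝ :=
  ∑ k ∈ Ico i j, turn (v k) (v (k + 1)) x

/-- The total angle swept out by the closed polygon `v i, v (i + 1), …, v j, v i`, seen from `x`. -/
def winding (v : ℕ → ℝ × ℝ) (i j : ℕ) (x : ℝ × ℝ) : ℝ :=
  arcTurn v i j x + turn (v j) (v i) x

/-- The union of the sides of the closed polygon `v i, v (i + 1), …, v j, v i`. -/
def sides (v : ℕ → ℝ × ℝ) (i j : ℕ) : Set (ℝ × ℝ) :=
  {x | x ∈ segment ℝ (v j) (v i) ∨ ∃ k ∈ Ico i j, x ∈ segment ℝ (v k) (v (k + 1))}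

theorem sub_ne_zero_of_notMem_segment {p q x : ℝ × ℝ} (h : x ∉ segment ℝ p q) :
    equivRealProdCLM.symm (p - x) ≠ 0 ∧ equivRealProdCLM.symm (q - x) ≠ 0 := by
  constructor <;> intro h0 <;> apply h <;>
    rw [EmbeddingLike.map_eq_zero_iff, sub_eq_zero] at h0 <;> subst h0
  · exact left_mem_segment ℝ _ _
  · exact right_mem_segment ℝ _ _

theorem div_mem_slitPlane {p q x : ℝ × ℝ} (h : x ∉ segment ℝ p q) :
    equivRealProdCLM.symm (q - x) / equivRealProdCLM.symm (p - x) ∈ slitPlane := by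
  by_contra hz
  set z := equivRealProdCLM.symm (q - x) / equivRealProdCLM.symm (p - x) with hz'
  rw [mem_slitPlane_iff, not_or, not_lt, not_not] at hz
  have hp := (sub_ne_zero_of_notMem_segment h).1
  have hz1 : z = (z.re : ℂ) := Complex.ext rfl (by simp [hz.2])
  have hq : equivRealProdCLM.symm (q - x) = equivRealProdCLM.symm (z.re • (p - x)) := by
    rw [map_smul, real_smul, ← hz1, hz', div_mul_cancel₀ _ hp]
  have hq' : q - x = z.re • (p - x) := equivRealProdCLM.symm.injective hq
  have hpos : 0 < 1 - z.re := by linarith [hz.1]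
  apply h
  refine ⟨-z.re / (1 - z.re), 1 / (1 - z.re), div_nonneg (by linarith [hz.1]) hpos.le,
    by positivity, by field_simp; ring, ?_⟩
  have hq2 : q = x + z.re • (p - x) := by rw [← hq']; abel
  rw [hq2]
  ext <;> simp <;> field_simp <;> ring

theorem continuousAt_turn {p q x : ℝ × ℝ} (h : x ∉ segment ℝ p q) :
    ContinuousAt (turn p q) x := by
  refine (continuousAt_arg (div_mem_slitPlane h)).comp (f := fun x =>
    equivRealProdCLM.symm (q - x) / equivRealProdCLM.symm (p - x)) ?_
  exact ContinuousAt.div (by fun_prop) (by fun_prop) (sub_ne_zero_of_notMem_segment h).1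

theorem turn_swap {p q x : ℝ × ℝ} (h : x ∉ segment ℝ p q) : turn q p x = -turn p q x := by
  rw [turn, turn, ← inv_div, arg_inv, if_neg (mem_slitPlane_iff_arg.mp (div_mem_slitPlane h)).1]

theorem continuousAt_arcTurn {v : ℕ → ℝ × ℝ} {i j : ℕ} {x : ℝ × ℝ}
    (h : ∀ k ∈ Ico i j, x ∉ segment ℝ (v k) (v (k + 1))) : ContinuousAt (arcTurn v i j) x :=
  tendsto_finsetSum _ fun k hk => continuousAt_turn (h k hk)

theorem continuousAt_winding {v : ℕ → ℝ × ℝ} {i j : ℕ} {x : ℝ × ℝ} (h : x ∉ sides v i j) :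
    ContinuousAt (winding v i j) x := by
  simp only [sides, Set.mem_ofPred_eq, not_or, not_exists, not_and] at h
  exact (continuousAt_arcTurn h.2).add (continuousAt_turn h.1)

theorem winding_mem_zmultiples {v : ℕ → ℝ × ℝ} {i j : ℕ} (hij : i ≤ j) {x : ℝ × ℝ}
    (h : x ∉ sides v i j) : winding v i j x ∈ AddSubgroup.zmultiples (2 * Real.pi) := by
  simp only [sides, Set.mem_ofPred_eq, not_or, not_exists, not_and] at h
  have key : ∀ p q, x ∉ segment ℝ p q → (turn p q x : Real.Angle) =
      (equivRealProdCLM.symm (q - x)).arg - (equivRealProdCLM.symm (p - x)).arg := fun p q h =>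
    arg_div_coe_angle (sub_ne_zero_of_notMem_segment h).2 (sub_ne_zero_of_notMem_segment h).1
  have : (winding v i j x : Real.Angle) = 0 := by
    rw [winding, arcTurn, Real.Angle.coe_add, key _ _ h.1, ← Real.Angle.coe_coeHom, map_sum]
    simp only [Real.Angle.coe_coeHom]
    rw [sum_congr rfl fun k hk => key _ _ (h.2 k hk)]
    rw [sum_Ico_sub (fun k => ((equivRealProdCLM.symm (v k - x)).arg : Real.Angle)) hij]
    abel
  obtain ⟨m, hm⟩ := Real.Angle.coe_eq_zero_iff.mp this
  exact ⟨m, hm⟩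

theorem winding_eq_of_isPreconnected {v : ℕ → ℝ × ℝ} {i j : ℕ} (hij : i ≤ j)
    {S : Set (ℝ × ℝ)} (hS : IsPreconnected S) (h : ∀ x ∈ S, x ∉ sides v i j) {x y : ℝ × ℝ}
    (hx : x ∈ S) (hy : y ∈ S) : winding v i j x = winding v i j y :=
  hS.constant_of_mapsTo (T := AddSubgroup.zmultiples (2 * Real.pi))
    (isDiscrete_iff_discreteTopology.mpr
      (inferInstanceAs (DiscreteTopology (AddSubgroup.zmultiples (2 * Real.pi)))))
    (fun z hz => (continuousAt_winding (h z hz)).continuousWithinAt)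
    (fun z hz => winding_mem_zmultiples hij (h z hz)) hx hy

theorem arg_div_of_re_pos {z w : ℂ} (hz : 0 < z.re) (hw : 0 < w.re) :
    (w / z).arg = w.arg - z.arg := by
  have hz0 : z ≠ 0 := fun h => by simp [h] at hz
  have hw0 : w ≠ 0 := fun h => by simp [h] at hw
  have h1 := abs_lt.mp (abs_arg_lt_pi_div_two_iff.mpr (.inl hz))
  have h2 := abs_lt.mp (abs_arg_lt_pi_div_two_iff.mpr (.inl hw))
  have h3 : z⁻¹.arg = -z.arg := by
    rw [arg_inv, if_neg]
    intro h
    linarith [Real.pi_pos]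
  rw [div_eq_mul_inv, arg_mul hw0 (inv_ne_zero hz0), h3, sub_eq_add_neg]
  rw [h3]
  constructor <;> linarith

theorem winding_eq_zero_of_half_plane {v : ℕ → ℝ × ℝ} {i j : ℕ} (hij : i ≤ j) {x : ℝ × ℝ} (c : ℂ)
    (h : ∀ k, i ≤ k → k ≤ j → 0 < (c * equivRealProdCLM.symm (v k - x)).re) :
    winding v i j x = 0 := by
  have hc : c ≠ 0 := fun h0 => by simpa [h0] using h i le_rfl hij
  have key : ∀ k l, i ≤ k → k ≤ j → i ≤ l → l ≤ j → turn (v k) (v l) x =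
      (c * equivRealProdCLM.symm (v l - x)).arg - (c * equivRealProdCLM.symm (v k - x)).arg := by
    intro k l hk hk' hl hl'
    rw [turn, ← mul_div_mul_left _ _ hc, arg_div_of_re_pos (h k hk hk') (h l hl hl')]
  rw [winding, arcTurn, key j i hij le_rfl le_rfl hij, sum_congr rfl fun k hk =>
    key k (k + 1) (mem_Ico.mp hk).1 (mem_Ico.mp hk).2.le (Nat.le_succ_of_le (mem_Ico.mp hk).1)
      (mem_Ico.mp hk).2,
    sum_Ico_sub (fun k => (c * equivRealProdCLM.symm (v k - x)).arg) hij]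
  ring

theorem exists_winding_eq_zero (v : ℕ → ℝ × ℝ) {i j : ℕ} (hij : i ≤ j) :
    ∃ R : ℝ, ∀ x : ℝ × ℝ, R < ‖x‖ → winding v i j x = 0 := by
  refine ⟨∑ k ∈ Icc i j, ‖equivRealProdCLM.symm (v k)‖, fun x hx => ?_⟩
  set f := equivRealProdCLM.symm
  have hfx : ‖x‖ ≤ ‖f x‖ := by
    rw [Prod.norm_def]
    have h1 : (f x).re = x.1 := rfl
    have h2 : (f x).im = x.2 := rfl
    rw [← h1, ← h2]
    exact max_le (abs_re_le_norm _) (abs_im_le_norm _)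
  refine winding_eq_zero_of_half_plane hij (-(starRingEnd ℂ) (f x)) fun k hk hk' => ?_
  have hk1 : ‖f (v k)‖ ≤ ∑ k ∈ Icc i j, ‖f (v k)‖ :=
    single_le_sum (f := fun k => ‖f (v k)‖) (fun _ _ => norm_nonneg _) (mem_Icc.mpr ⟨hk, hk'⟩)
  have hlt : ‖f (v k)‖ < ‖f x‖ := by linarith
  have h1 : ((starRingEnd ℂ) (f x) * f (v k)).re ≤ ‖f x‖ * ‖f (v k)‖ := by
    refine (re_le_norm _).trans ?_
    rw [norm_mul, RCLike.norm_conj]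
  have h2 : ((starRingEnd ℂ) (f x) * f x).re = ‖f x‖ * ‖f x‖ := by
    rw [mul_comm, mul_conj, normSq_eq_norm_sq, ofReal_re, sq]
  have h3 : (-(starRingEnd ℂ) (f x) * f (v k - x)).re =
      ((starRingEnd ℂ) (f x) * f x).re - ((starRingEnd ℂ) (f x) * f (v k)).re := by
    rw [map_sub, ← sub_re]
    congr 1
    ring
  rw [h3, h2]
  nlinarith [norm_nonneg (f (v k))]

theorem winding_eq_zero_of_not_isBounded {v : ℕ → ℝ × ℝ} {i j : ℕ} (hij : i ≤ j)
    {S : Set (ℝ × ℝ)} (hS : IsPreconnected S) (h : ∀ x ∈ S, x ∉ sides v i j)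
    (hb : ¬ Bornology.IsBounded S) {x : ℝ × ℝ} (hx : x ∈ S) : winding v i j x = 0 := by
  obtain ⟨R, hR⟩ := exists_winding_eq_zero v hij
  obtain ⟨y, hy, hyR⟩ : ∃ y ∈ S, R < ‖y‖ := by
    by_contra! hcon
    exact hb (isBounded_iff_forall_norm_le.mpr ⟨R, hcon⟩)
  rw [winding_eq_of_isPreconnected hij hS h hx hy, hR y hyR]

/-- Points near the midpoint of the segment from `p` to `q`, on its perpendicular bisector. -/
def bisector (p q : ℝ × ℝ) (t : ℝ) : ℝ × ℝ :=
  ((p.1 + q.1) / 2 - t * (q.2 - p.2), (p.2 + q.2) / 2 + t * (q.1 - p.1))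

theorem continuous_bisector (p q : ℝ × ℝ) : Continuous (bisector p q) := by
  unfold bisector; fun_prop

theorem bisector_swap (p q : ℝ × ℝ) (t : ℝ) : bisector q p t = bisector p q (-t) := by
  unfold bisector
  ext <;> simp <;> ring

theorem bisector_zero_mem_segment (p q : ℝ × ℝ) : bisector p q 0 ∈ segment ℝ p q :=
  ⟨1 / 2, 1 / 2, by norm_num, by norm_num, by norm_num, by
    unfold bisector; ext <;> simp <;> ring⟩

theorem bisector_mem_segment_iff {p q : ℝ × ℝ} (hpq : p ≠ q) {t : ℝ} :
    bisector p q t ∈ segment ℝ p q ↔ t = 0 := by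
  refine ⟨?_, fun h => h ▸ bisector_zero_mem_segment p q⟩
  rintro ⟨a, b, -, -, hab, h⟩
  obtain rfl : a = 1 - b := by linarith
  have h1 := congrArg Prod.fst h
  have h2 := congrArg Prod.snd h
  simp only [bisector, Prod.fst_add, Prod.snd_add, Prod.smul_fst, Prod.smul_snd,
    smul_eq_mul] at h1 h2
  have hpos : 0 < (q.1 - p.1) ^ 2 + (q.2 - p.2) ^ 2 := by
    by_contra! hle
    apply hpq
    ext <;> nlinarith [sq_nonneg (q.1 - p.1), sq_nonneg (q.2 - p.2)]
  have : t * ((q.1 - p.1) ^ 2 + (q.2 - p.2) ^ 2) = 0 := by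
    linear_combination (q.2 - p.2) * h1 - (q.1 - p.1) * h2
  exact (mul_eq_zero.mp this).resolve_right hpos.ne'

theorem bisector_zero_ne {p q : ℝ × ℝ} (hpq : p ≠ q) :
    bisector p q 0 ≠ p ∧ bisector p q 0 ≠ q := by
  constructor <;> intro h <;> apply hpq <;>
  · have h1 := congrArg Prod.fst h
    have h2 := congrArg Prod.snd h
    simp only [bisector] at h1 h2
    ext <;> linarith

theorem tendsto_turn_bisector {p q : ℝ × ℝ} (hpq : p ≠ q) :
    Filter.Tendsto (fun t => turn p q (bisector p q t)) (nhdsWithin 0 (Set.Ioi 0))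
      (nhds Real.pi) := by
  set z := equivRealProdCLM.symm (q - p)
  have hz : z ≠ 0 := by
    simpa [z, sub_eq_zero] using hpq.symm
  have key : ∀ t : ℝ, turn p q (bisector p q t) =
      (((t ^ 2 - 1 / 4 : ℝ) : ℂ) + t * I).arg := by
    intro t
    have h1 : equivRealProdCLM.symm (q - bisector p q t) = z * (1 / 2 - t * I) := by
      apply Complex.ext <;> simp [z, bisector] <;> ring
    have h2 : equivRealProdCLM.symm (p - bisector p q t) = z * (-1 / 2 - t * I) := by
      apply Complex.ext <;> simp [z, bisector] <;> ring
    have h3 : (-1 / 2 - t * I : ℂ) ≠ 0 := fun h => by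
      have := congrArg re h
      norm_num at this
    have h4 : (0 : ℝ) < t ^ 2 + 1 / 4 := by positivity
    rw [turn, h1, h2, mul_div_mul_left _ _ hz, ← arg_real_mul _ h4]
    congr 1
    rw [← mul_div_assoc, div_eq_iff h3]
    push_cast
    linear_combination (t : ℂ) ^ 2 * I_sq
  simp only [key]
  have := tendsto_arg_nhdsWithin_im_nonneg_of_re_neg_of_im_zero (z := (-1 / 4 : ℂ))
    (by norm_num) (by norm_num)
  refine this.comp (tendsto_nhdsWithin_iff.mpr ⟨?_, ?_⟩)
  · refine tendsto_nhdsWithin_of_tendsto_nhds ?_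
    refine Continuous.tendsto' (by fun_prop) _ _ (by simp; norm_num)
  · filter_upwards [self_mem_nhdsWithin] with t ht
    simpa [← ofReal_pow] using (Set.mem_Ioi.mp ht).le

end Polygon

theorem eq_of_mem_closure_of_eqOn {f : ℝ × ℝ → ℝ} {p : ℝ × ℝ} {S : Set (ℝ × ℝ)} {c : ℝ}
    (hf : ContinuousAt f p) (hp : p ∈ closure S) (h : ∀ x ∈ S, f x = c) : f p = c := by
  have := hf.continuousWithinAt.mem_closure_image hp
  have hsub : closure (f '' S) ⊆ {c} :=
    closure_minimal (by rintro _ ⟨x, hx, rfl⟩; exact h x hx) isClosed_singleton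
  exact hsub this

theorem notMem_segment_midpoint {p q : ℝ × ℝ} (hpq : p ≠ q) :
    p ∉ segment ℝ q (Polygon.bisector p q 0) := by
  rintro ⟨a, b, ha, hb, hab, h⟩
  apply hpq
  have h1 := congrArg Prod.fst h
  have h2 := congrArg Prod.snd h
  simp only [Polygon.bisector, Prod.fst_add, Prod.snd_add, Prod.smul_fst, Prod.smul_snd,
    smul_eq_mul] at h1 h2
  obtain rfl : a = 1 - b := by linarith
  have hb2 : 0 < 1 - b / 2 := by linarith
  have h3 : (1 - b / 2) * (p.1 - q.1) = 0 := by linarith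
  have h4 : (1 - b / 2) * (p.2 - q.2) = 0 := by linarith
  ext
  · exact sub_eq_zero.mp ((mul_eq_zero.mp h3).resolve_left hb2.ne')
  · exact sub_eq_zero.mp ((mul_eq_zero.mp h4).resolve_left hb2.ne')

/-- A point of a nondegenerate closed triangle outside its interior lies on one of the sides. -/
theorem mem_segment_of_mem_convexHull {E : Type*} [AddCommGroup E] [Module ℝ E]
    [TopologicalSpace E] [IsTopologicalAddGroup E] [ContinuousConstSMul ℝ E] {a b c m x : E}
    (hm : m ∈ convexHull ℝ {a, b, c}) (hm' : m ∉ interior (convexHull ℝ {a, b, c}))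
    (hx : x ∈ interior (convexHull ℝ {a, b, c})) :
    m ∈ segment ℝ a b ∨ m ∈ segment ℝ b c ∨ m ∈ segment ℝ a c := by
  have hmem : ∀ y : E, y ∈ convexHull ℝ {a, b, c} ↔ ∃ α β γ : ℝ, 0 ≤ α ∧ 0 ≤ β ∧ 0 ≤ γ ∧
      α + β + γ = 1 ∧ α • a + β • b + γ • c = y := by
    intro y
    constructor
    · rw [← convexJoin_singleton_segment, mem_convexJoin]
      rintro ⟨_, rfl, z, ⟨r, s, hr, hs, hrs, rfl⟩, ⟨t, w, ht, hw, htw, rfl⟩⟩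
      refine ⟨t, w * r, w * s, ht, mul_nonneg hw hr, mul_nonneg hw hs, ?_, ?_⟩
      · rw [add_assoc, ← mul_add, hrs, mul_one, htw]
      · rw [smul_add, smul_smul, smul_smul, add_assoc]
    · rintro ⟨α, β, γ, hα, hβ, hγ, hsum, rfl⟩
      have hc := convex_convexHull ℝ ({a, b, c} : Set E)
      have h := hc.sum_mem (t := Finset.univ) (w := ![α, β, γ]) (z := ![a, b, c])
        (by simp [Fin.forall_fin_succ, hα, hβ, hγ]) (by simp [Fin.sum_univ_three, hsum])
        (by
          intro i _
          apply subset_convexHull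
          fin_cases i <;> simp)
      simpa [Fin.sum_univ_three] using h
  obtain ⟨α, β, γ, hα, hβ, hγ, hsum, rfl⟩ := (hmem m).mp hm
  rcases hα.eq_or_lt with rfl | hα
  · exact .inr (.inl ⟨β, γ, hβ, hγ, by linarith, by simp⟩)
  rcases hβ.eq_or_lt with rfl | hβ
  · exact .inr (.inr ⟨α, γ, hα.le, hγ, by linarith, by simp⟩)
  rcases hγ.eq_or_lt with rfl | hγ
  · exact .inl ⟨α, β, hα.le, hβ.le, by linarith, by simp⟩
  refine (hm' ?_).elim
  obtain ⟨α', β', γ', hα', hβ', hγ', hsum', hx'⟩ := (hmem x).mp (interior_subset hx)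
  obtain ⟨ε, hε, hεα, hεβ, hεγ⟩ : ∃ ε, 0 < ε ∧ ε ≤ α ∧ ε ≤ β ∧ ε ≤ γ :=
    ⟨min α (min β γ), by simp [hα, hβ, hγ], min_le_left _ _,
      (min_le_right _ _).trans (min_le_left _ _), (min_le_right _ _).trans (min_le_right _ _)⟩
  have hε1 : 0 < 1 - ε := by linarith
  have hle : ∀ t t' : ℝ, ε ≤ t → t' ≤ 1 → 0 ≤ t - ε * t' := fun t t' ht ht' => by nlinarith
  refine (convex_convexHull ℝ ({a, b, c} : Set E)).openSegment_interior_self_subset_interior hx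
    ((hmem ((1 - ε)⁻¹ • ((α - ε * α') • a + (β - ε * β') • b + (γ - ε * γ') • c))).mpr
      ⟨(1 - ε)⁻¹ * (α - ε * α'), (1 - ε)⁻¹ * (β - ε * β'), (1 - ε)⁻¹ * (γ - ε * γ'),
        mul_nonneg (by positivity) (hle _ _ hεα (by linarith)),
        mul_nonneg (by positivity) (hle _ _ hεβ (by linarith)),
        mul_nonneg (by positivity) (hle _ _ hεγ (by linarith)), ?_, ?_⟩)
    ⟨ε, 1 - ε, hε, hε1, by ring, ?_⟩
  · rw [← mul_add, ← mul_add, inv_mul_eq_one₀ hε1.ne']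
    linear_combination ε * hsum' - hsum
  · simp only [smul_add, smul_smul]
  · rw [smul_smul, mul_inv_cancel₀ hε1.ne', ← hx']
    module

namespace PlaneGraph

open Polygon Filter Topology

variable {T : PlaneGraph} {p q : ℝ × ℝ} {F : Set (ℝ × ℝ)}

theorem IsFace.isPreconnected (hF : T.IsFace F) : IsPreconnected F := by
  obtain ⟨x, -, rfl⟩ := hF
  exact isPreconnected_connectedComponentIn

theorem IsFace.notMem_drawing (hF : T.IsFace F) {x : ℝ × ℝ} (hx : x ∈ F) : x ∉ T.drawing := by
  obtain ⟨y, -, rfl⟩ := hF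
  exact connectedComponentIn_subset _ _ hx

/-- Near the midpoint of an edge there are no points of other edges. -/
theorem IsEmbedded.eventually_bisector (hT : T.IsEmbedded) (hpq : T.Adj p q) :
    ∀ᶠ t in 𝓝 (0 : ℝ), ∀ r s, T.Adj r s → bisector p q t ∈ segment ℝ r s →
      ({p, q} : Set (ℝ × ℝ)) = {r, s} := by
  have hne : p ≠ q := fun h => T.loopless q (h ▸ hpq)
  have key : ∀ e ∈ T.verts ×ˢ T.verts, ∀ᶠ t in 𝓝 (0 : ℝ), T.Adj e.1 e.2 →
      bisector p q t ∈ segment ℝ e.1 e.2 → ({p, q} : Set (ℝ × ℝ)) = {e.1, e.2} := by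
    rintro ⟨r, s⟩ -
    by_cases h : T.Adj r s ∧ ({p, q} : Set (ℝ × ℝ)) ≠ {r, s}
    · have h0 : bisector p q 0 ∉ segment ℝ r s := fun hmem => by
        rcases hT.1 p q r s hpq h.1 _ (bisector_zero_mem_segment p q) hmem with h' | ⟨h', -⟩
        · exact h.2 h'
        · rcases h' with h' | h'
          · exact (bisector_zero_ne hne).1 h'
          · exact (bisector_zero_ne hne).2 h'
      have hcl : IsClosed (segment ℝ r s) := by
        rw [← convexHull_pair]
        exact (Set.toFinite {r, s}).isClosed_convexHull ℝ
      filter_upwards [(continuous_bisector p q).continuousAt.eventually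
        (hcl.isOpen_compl.mem_nhds h0)] with t ht _ ht'
      exact absurd ht' ht
    · exact .of_forall fun t h1 _ => by_contra fun h2 => h ⟨h1, h2⟩
  filter_upwards [(Finset.eventually_all (T.verts ×ˢ T.verts)).mpr key] with t ht r s hrs
  exact ht (r, s) (Finset.mem_product.mpr (T.mem_of_adj r s hrs)) hrs

/-- The face on one side of an edge. -/
theorem IsEmbedded.exists_face (hT : T.IsEmbedded) (hpq : T.Adj p q) :
    ∃ F, T.IsFace F ∧ ∀ᶠ t in 𝓝[>] (0 : ℝ), bisector p q t ∈ F := by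
  have hne : p ≠ q := fun h => T.loopless q (h ▸ hpq)
  obtain ⟨ε, hε, h⟩ := Metric.eventually_nhds_iff.mp (hT.eventually_bisector hpq)
  have hsub : bisector p q '' Set.Ioo 0 ε ⊆ T.drawingᶜ := by
    rintro _ ⟨t, ht, rfl⟩ ⟨r, s, hrs, hmem⟩
    have heq := h (by simpa [abs_of_pos ht.1] using ht.2) r s hrs hmem
    have : segment ℝ r s = segment ℝ p q := by
      rw [← convexHull_pair, ← convexHull_pair, heq]
    rw [this, bisector_mem_segment_iff hne] at hmem
    exact ht.1.ne' hmem
  have hmid : bisector p q (ε / 2) ∈ bisector p q '' Set.Ioo 0 ε :=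
    ⟨ε / 2, ⟨by linarith, by linarith⟩, rfl⟩
  refine ⟨_, ⟨bisector p q (ε / 2), hsub hmid, rfl⟩, ?_⟩
  have hpre : IsPreconnected (bisector p q '' Set.Ioo 0 ε) :=
    isPreconnected_Ioo.image _ (continuous_bisector p q).continuousOn
  filter_upwards [Ioo_mem_nhdsGT hε] with t ht
  exact hpre.subset_connectedComponentIn hmid hsub ⟨t, ht, rfl⟩

theorem bisector_zero_mem_closure (h : ∀ᶠ t in 𝓝[>] (0 : ℝ), bisector p q t ∈ F) :
    bisector p q 0 ∈ closure F :=
  mem_closure_of_tendsto ((continuous_bisector p q).continuousAt.mono_left nhdsWithin_le_nhds) h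

/-- A bounded face is a triangle: an edge on its boundary has a common neighbour there. -/
theorem IsNearTriangulation.exists_apex (hT : T.IsNearTriangulation) (hpq : T.Adj p q)
    (hF : T.IsFace F) (hb : Bornology.IsBounded F) (hm : bisector p q 0 ∈ closure F) :
    ∃ c, T.Adj p c ∧ T.Adj q c ∧ c ∈ closure F := by
  have hne : p ≠ q := fun h => T.loopless q (h ▸ hpq)
  obtain ⟨a, -, b, -, c, -, hab, hbc, hac, hFt⟩ := hT.2.2 F hF hb
  have hdr : bisector p q 0 ∈ T.drawing := ⟨p, q, hpq, bisector_zero_mem_segment p q⟩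
  have hmF : bisector p q 0 ∉ F := fun h => hF.notMem_drawing h hdr
  have hconv := convex_convexHull ℝ ({a, b, c} : Set (ℝ × ℝ))
  have hclosed : IsClosed (convexHull ℝ ({a, b, c} : Set (ℝ × ℝ))) :=
    (Set.toFinite _).isClosed_convexHull ℝ
  obtain ⟨x, hx⟩ : (interior (convexHull ℝ ({a, b, c} : Set (ℝ × ℝ)))).Nonempty := by
    rw [← openTriangle, ← hFt]
    exact closure_nonempty_iff.mp ⟨_, hm⟩
  have hcl : closure F = convexHull ℝ {a, b, c} := by
    rw [hFt, openTriangle, hconv.closure_interior_eq_closure_of_nonempty_interior ⟨x, hx⟩,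
      hclosed.closure_eq]
  have hside : ∀ r s y, T.Adj r s → bisector p q 0 ∈ segment ℝ r s → T.Adj r y → T.Adj s y →
      y ∈ ({a, b, c} : Set (ℝ × ℝ)) → ∃ c, T.Adj p c ∧ T.Adj q c ∧ c ∈ closure F := by
    intro r s y hrs hmem hry hsy hy
    have hset := (hT.1.eventually_bisector hpq).self_of_nhds r s hrs hmem
    have hp : p ∈ ({r, s} : Set (ℝ × ℝ)) := hset ▸ Set.mem_insert p _
    have hq : q ∈ ({r, s} : Set (ℝ × ℝ)) := hset ▸ Set.mem_insert_of_mem p rfl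
    refine ⟨y, ?_, ?_, hcl ▸ subset_convexHull ℝ _ hy⟩
    · rcases hp with rfl | rfl <;> assumption
    · rcases hq with rfl | rfl <;> assumption
  rcases mem_segment_of_mem_convexHull (hcl ▸ hm) (fun h => hmF (by rwa [hFt])) hx
    with h | h | h
  · exact hside a b c hab h hac hbc (by simp)
  · exact hside b c a hbc h (T.symm _ _ hab) (T.symm _ _ hac) (by simp)
  · exact hside a c b hac h hab (T.symm _ _ hbc) (by simp)

end PlaneGraph

namespace Polygon

open Filter Topology

/-- The winding number of a polygon is nonzero on at least one side of a simple edge. -/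
theorem not_eventually_winding_eq_zero {v : ℕ → ℝ × ℝ} {i j : ℕ} (hne : v j ≠ v i)
    (hm : ∀ k ∈ Finset.Ico i j, bisector (v j) (v i) 0 ∉ segment ℝ (v k) (v (k + 1)))
    (h₁ : ∀ᶠ t in 𝓝[>] 0, winding v i j (bisector (v j) (v i) t) = 0)
    (h₂ : ∀ᶠ t in 𝓝[>] 0, winding v i j (bisector (v i) (v j) t) = 0) : False := by
  have harc : ∀ p q, bisector p q 0 = bisector (v j) (v i) 0 →
      Tendsto (fun t => arcTurn v i j (bisector p q t)) (𝓝[>] 0)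
        (𝓝 (arcTurn v i j (bisector (v j) (v i) 0))) := by
    intro p q hpq
    rw [← hpq] at hm ⊢
    exact ((continuousAt_arcTurn hm).comp
      (continuous_bisector _ _).continuousAt).mono_left nhdsWithin_le_nhds
  have hlim₁ := (harc _ _ rfl).add (tendsto_turn_bisector hne)
  have hlim₂ := (harc (v i) (v j) (by rw [bisector_swap, neg_zero])).sub
    (tendsto_turn_bisector hne.symm)
  have e₁ := tendsto_nhds_unique_of_eventuallyEq hlim₁ tendsto_const_nhds h₁
  have e₂ := tendsto_nhds_unique_of_eventuallyEq hlim₂ (tendsto_const_nhds (x := (0 : ℝ))) (by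
    filter_upwards [h₂, self_mem_nhdsWithin] with t ht ht0
    rw [← ht, winding, turn_swap (p := v i) (q := v j), sub_eq_add_neg]
    rw [bisector_mem_segment_iff hne.symm]
    exact (Set.mem_Ioi.mp ht0).ne')
  linarith [Real.pi_pos]

theorem arcTurn_add_arcTurn (v : ℕ → ℝ × ℝ) {i j k : ℕ} (hij : i ≤ j) (hjk : j ≤ k) (x : ℝ × ℝ) :
    arcTurn v i j x + arcTurn v j k x = arcTurn v i k x :=
  Finset.sum_Ico_consecutive _ hij hjk

theorem arcTurn_period {v : ℕ → ℝ × ℝ} {n : ℕ} (hv : ∀ k, v (k + n) = v k) {a b : ℕ} (hab : a ≤ b)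
    (x : ℝ × ℝ) : arcTurn v b (b + n) x = arcTurn v a (a + n) x := by
  have h1 := arcTurn_add_arcTurn v hab (Nat.le_add_right b n) x
  have h2 := arcTurn_add_arcTurn v (Nat.le_add_right a n) (Nat.add_le_add_right hab n) x
  have h3 : arcTurn v (a + n) (b + n) x = arcTurn v a b x := by
    rw [arcTurn, arcTurn, ← Finset.sum_Ico_add']
    refine Finset.sum_congr rfl fun k _ => ?_
    rw [hv, add_right_comm, hv]
  linarith

theorem winding_add_winding {v : ℕ → ℝ × ℝ} {n : ℕ} (hv : ∀ k, v (k + n) = v k) {a b : ℕ}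
    (hab : a ≤ b) (hb : b ≤ a + n) {x : ℝ × ℝ} (hx : x ∉ segment ℝ (v a) (v b)) :
    winding v a b x + winding v b (a + n) x = arcTurn v a (a + n) x := by
  rw [winding, winding, hv, turn_swap hx, ← arcTurn_add_arcTurn v hab hb]
  ring

end Polygon

namespace PlaneGraph

open Polygon Filter Topology

/-- `v` runs periodically through the vertices of `T`, following edges of `T`, and all vertices
are accessible from the outer region. -/
structure IsTour (T : PlaneGraph) (v : ℕ → ℝ × ℝ) (n : ℕ) : Prop where
  nearTriangulation : T.IsNearTriangulation
  period : ∀ k, v (k + n) = v k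
  ne : ∀ a b, a < b → b < a + n → v a ≠ v b
  adj : ∀ k, T.Adj (v k) (v (k + 1))
  mem_closure : ∀ k, v k ∈ closure T.outerRegion
  exists_eq : ∀ x ∈ T.verts, ∀ i, ∃ k, i ≤ k ∧ k < i + n ∧ v k = x

namespace IsTour

variable {T : PlaneGraph} {v : ℕ → ℝ × ℝ} {n : ℕ} (hv : T.IsTour v n) {i j k : ℕ}
  {F : Set (ℝ × ℝ)}

include hv

theorem mem_verts (k : ℕ) : v k ∈ T.verts := (T.mem_of_adj _ _ (hv.adj k)).1

/-- The sides of a polygon bounded by a chord are edges between its vertices. -/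
theorem exists_of_mem_sides (hij : i < j) (h : T.Adj (v i) (v j)) {x : ℝ × ℝ}
    (hx : x ∈ sides v i j) : ∃ a b, i ≤ a ∧ a ≤ j ∧ i ≤ b ∧ b ≤ j ∧ T.Adj (v a) (v b) ∧
      x ∈ segment ℝ (v a) (v b) := by
  rcases hx with hx | ⟨k, hk, hx⟩
  · exact ⟨j, i, hij.le, le_rfl, le_rfl, hij.le, T.symm _ _ h, hx⟩
  · rw [Finset.mem_Ico] at hk
    exact ⟨k, k + 1, hk.1, hk.2.le, by omega, hk.2, hv.adj k, hx⟩

theorem notMem_sides (hij : i < j) (h : T.Adj (v i) (v j)) {x : ℝ × ℝ} (hx : x ∉ T.drawing) :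
    x ∉ sides v i j := fun hx' => by
  obtain ⟨a, b, -, -, -, -, hab, hmem⟩ := hv.exists_of_mem_sides hij h hx'
  exact hx ⟨_, _, hab, hmem⟩

theorem vertex_notMem_sides (hij : i < j) (h : T.Adj (v i) (v j)) (hjk : j < k) (hk : k < i + n) :
    v k ∉ sides v i j := fun hx' => by
  obtain ⟨a, b, hia, haj, hib, hbj, hab, hmem⟩ := hv.exists_of_mem_sides hij h hx'
  rcases hv.nearTriangulation.1.2 _ _ _ hab (hv.mem_verts k) hmem with h | h
  · exact hv.ne a k (by omega) (by omega) h.symm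
  · exact hv.ne b k (by omega) (by omega) h.symm

theorem winding_eq_zero_of_mem_outerRegion (hij : i < j) (h : T.Adj (v i) (v j)) {x : ℝ × ℝ}
    (hx : x ∈ T.outerRegion) : winding v i j x = 0 :=
  winding_eq_zero_of_not_isBounded hij.le isPreconnected_connectedComponentIn
    (fun _ hy => hv.notMem_sides hij h (connectedComponentIn_subset _ _ hy)) hx.2
    (mem_connectedComponentIn hx.1)

theorem winding_vertex (hij : i < j) (h : T.Adj (v i) (v j)) (hjk : j < k) (hk : k < i + n) :
    winding v i j (v k) = 0 :=
  eq_of_mem_closure_of_eqOn (continuousAt_winding (hv.vertex_notMem_sides hij h hjk hk))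
    (hv.mem_closure k) fun _ hx => hv.winding_eq_zero_of_mem_outerRegion hij h hx

theorem winding_eq_of_mem_face (hij : i < j) (h : T.Adj (v i) (v j)) (hF : T.IsFace F)
    {x y : ℝ × ℝ} (hx : x ∈ F) (hy : y ∈ F) : winding v i j x = winding v i j y :=
  winding_eq_of_isPreconnected hij.le hF.isPreconnected
    (fun _ hz => hv.notMem_sides hij h (hF.notMem_drawing hz)) hx hy

/-- A face inside a polygon bounded by a chord is bounded. -/
theorem isBounded_face (hij : i < j) (h : T.Adj (v i) (v j)) (hF : T.IsFace F) {x : ℝ × ℝ}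
    (hx : x ∈ F) (hw : winding v i j x ≠ 0) : Bornology.IsBounded F := by
  by_contra hb
  exact hw (winding_eq_zero_of_not_isBounded hij.le hF.isPreconnected
    (fun _ hz => hv.notMem_sides hij h (hF.notMem_drawing hz)) hb hx)

/-- A common neighbour of the ends of a chord that lies on the boundary of a face inside the
polygon bounded by the chord is one of the vertices of this polygon. -/
theorem exists_index (hij : i < j) (h : T.Adj (v i) (v j)) (hF : T.IsFace F)
    {x : ℝ × ℝ} (hx : x ∈ F) (hw : winding v i j x ≠ 0) {c : ℝ × ℝ} (hic : T.Adj (v i) c)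
    (hjc : T.Adj (v j) c) (hc : c ∈ closure F) : ∃ k, i < k ∧ k < j ∧ v k = c := by
  obtain ⟨k, hik, hkn, rfl⟩ := hv.exists_eq c (T.mem_of_adj _ _ hic).2 i
  have hki : k ≠ i := fun hk => T.loopless _ (hk ▸ hic)
  have hkj : k ≠ j := fun hk => T.loopless _ (hk ▸ hjc)
  refine ⟨k, by omega, ?_, rfl⟩
  by_contra hjk
  have hcont := continuousAt_winding (hv.vertex_notMem_sides hij h (by omega) hkn)
  have := eq_of_mem_closure_of_eqOn hcont hc fun y hy => hv.winding_eq_of_mem_face hij h hF hy hx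
  exact hw (this ▸ hv.winding_vertex hij h (by omega) hkn)

/-- The midpoint of a chord does not lie on an edge joining consecutive vertices. -/
theorem bisector_notMem_segment (hij : i + 1 < j) (hj : j + 1 < i + n) (h : T.Adj (v i) (v j))
    (hik : i ≤ k) (hk : k < i + n) :
    bisector (v j) (v i) 0 ∉ segment ℝ (v k) (v (k + 1)) := fun hmem => by
  have hset := (hv.nearTriangulation.1.eventually_bisector (T.symm _ _ h)).self_of_nhds _ _
    (hv.adj k) hmem
  have hi : v i ∈ ({v k, v (k + 1)} : Set (ℝ × ℝ)) := hset ▸ Set.mem_insert_of_mem _ rfl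
  have hj' : v j ∈ ({v k, v (k + 1)} : Set (ℝ × ℝ)) := hset ▸ Set.mem_insert _ _
  have hki : k = i ∨ k + 1 = i + n := by
    rcases hi with hi | hi
    · by_contra hcon
      exact hv.ne i k (by omega) hk hi
    · by_contra hcon
      exact hv.ne i (k + 1) (by omega) (by omega) hi
  rcases hki with rfl | hkn
  · rcases hj' with hj' | hj'
    · exact hv.ne k j (by omega) (by omega) hj'.symm
    · exact hv.ne (k + 1) j (by omega) (by omega) hj'.symm
  · rcases hj' with hj' | hj'
    · exact hv.ne j k (by omega) (by omega) hj'
    · exact hv.ne j (k + 1) (by omega) (by omega) hj'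

/-- One of the faces on the sides of a chord lies inside the polygon bounded by the chord. -/
theorem exists_inner_face (hij : i < j) (hj : j < i + n) (h : T.Adj (v i) (v j))
    (hm : ∀ k ∈ Finset.Ico i j, bisector (v j) (v i) 0 ∉ segment ℝ (v k) (v (k + 1))) :
    ∃ F, T.IsFace F ∧ bisector (v j) (v i) 0 ∈ closure F ∧
      ∃ x ∈ F, winding v i j x ≠ 0 := by
  have hE := hv.nearTriangulation.1
  obtain ⟨F₁, hF₁, h₁⟩ := hE.exists_face (T.symm _ _ h)
  obtain ⟨F₂, hF₂, h₂⟩ := hE.exists_face h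
  by_contra! hcon
  refine not_eventually_winding_eq_zero (hv.ne i j hij hj).symm hm ?_ ?_
  · filter_upwards [h₁] with t ht
    exact hcon F₁ hF₁ (bisector_zero_mem_closure h₁) _ ht
  · filter_upwards [h₂] with t ht
    refine hcon F₂ hF₂ ?_ _ ht
    rw [bisector_swap, neg_zero]
    exact bisector_zero_mem_closure h₂

theorem exists_triangle (hij : i + 1 < j) (hj : j < i + n) (h : T.Adj (v i) (v j)) :
    ∃ k, i < k ∧ k < j ∧ T.Adj (v i) (v k) ∧ T.Adj (v k) (v j) := by
  have hm : ∀ k ∈ Finset.Ico i j, bisector (v j) (v i) 0 ∉ segment ℝ (v k) (v (k + 1)) := by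
    intro k hk hmem
    rw [Finset.mem_Ico] at hk
    have hset := (hv.nearTriangulation.1.eventually_bisector (T.symm _ _ h)).self_of_nhds _ _
      (hv.adj k) hmem
    have hi : v i ∈ ({v k, v (k + 1)} : Set (ℝ × ℝ)) := hset ▸ Set.mem_insert_of_mem _ rfl
    have hj' : v j ∈ ({v k, v (k + 1)} : Set (ℝ × ℝ)) := hset ▸ Set.mem_insert _ _
    have hki : k = i := by
      by_contra hcon
      rcases hi with hi | hi
      · exact hv.ne i k (by omega) (by omega) hi
      · exact hv.ne i (k + 1) (by omega) (by omega) hi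
    rcases hj' with hj' | hj'
    · exact hv.ne k j (by omega) (by omega) hj'.symm
    · exact hv.ne (k + 1) j (by omega) (by omega) hj'.symm
  have hij' : i < j := by omega
  obtain ⟨F, hF, hmF, x, hx, hw⟩ := hv.exists_inner_face hij' hj h hm
  obtain ⟨c, hjc, hic, hc⟩ := hv.nearTriangulation.exists_apex (T.symm _ _ h) hF
    (hv.isBounded_face hij' h hF hx hw) hmF
  obtain ⟨k, hik, hkj, rfl⟩ := hv.exists_index hij' h hF hx hw hic hjc hc
  exact ⟨k, hik, hkj, hic, T.symm _ _ hjc⟩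

/-- A polygon bounded by a chord does not wind around the midpoint of a crossing edge. -/
theorem winding_bisector {a b c d : ℕ} (hac : a < c) (hcb : c < b) (hbd : b < d) (hd : d < a + n)
    (hab : T.Adj (v a) (v b)) (hcd : T.Adj (v c) (v d)) :
    winding v a b (bisector (v c) (v d) 0) = 0 := by
  have hlt : a < b := by omega
  refine (winding_eq_of_isPreconnected hlt.le
    (convex_segment (v d) (bisector (v c) (v d) 0)).isPreconnected ?_
    (right_mem_segment ℝ _ _) (left_mem_segment ℝ _ _)).trans (hv.winding_vertex hlt hab hbd hd)
  intro x hx hx'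
  have hxcd : x ∈ segment ℝ (v c) (v d) :=
    (convex_segment (v c) (v d)).segment_subset (right_mem_segment ℝ _ _)
      (bisector_zero_mem_segment _ _) hx
  obtain ⟨k, l, hak, hkb, hal, hlb, hkl, hmem⟩ := hv.exists_of_mem_sides hlt hab hx'
  have hdk : v d ∉ ({v k, v l} : Set (ℝ × ℝ)) := by
    rintro (h | h)
    · exact hv.ne k d (by omega) (by omega) h.symm
    · exact hv.ne l d (by omega) (by omega) h.symm
  rcases hv.nearTriangulation.1.1 _ _ _ _ hcd hkl x hxcd hmem with h | ⟨h1, h2⟩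
  · exact hdk (h ▸ Set.mem_insert_of_mem _ rfl)
  · rcases h1 with rfl | rfl
    · exact notMem_segment_midpoint (hv.ne c d (by omega) (by omega)) hx
    · exact hdk h2

theorem not_crossing {a b c d : ℕ} (hac : a < c) (hcb : c < b) (hbd : b < d) (hd : d < a + n)
    (hab : T.Adj (v a) (v b)) (hcd : T.Adj (v c) (v d)) : False := by
  have hm := fun k (hk : k ∈ Finset.Ico c (c + n)) => hv.bisector_notMem_segment
    (i := c) (j := d) (by omega) (by omega) hcd (Finset.mem_Ico.mp hk).1 (Finset.mem_Ico.mp hk).2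
  have hswap : bisector (v d) (v c) 0 = bisector (v c) (v d) 0 := by rw [bisector_swap, neg_zero]
  have hE := hv.nearTriangulation.1
  have hcd' : c < d := by omega
  have hdc : d < c + n := by omega
  have hdc' : T.Adj (v d) (v (c + n)) := by rw [hv.period]; exact T.symm _ _ hcd
  have hba : T.Adj (v b) (v (a + n)) := by rw [hv.period]; exact T.symm _ _ hab
  have hz : arcTurn v c (c + n) (bisector (v d) (v c) 0) = 0 := by
    have h1 := hv.winding_bisector hac hcb hbd hd hab hcd
    have h2 := hv.winding_bisector hbd hd (Nat.add_lt_add_right hac n) (by omega) hba hdc'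
    rw [hv.period, hswap] at h2
    rw [arcTurn_period hv.period hac.le, hswap, ← winding_add_winding hv.period (a := a) (b := b)
      (by omega) (by omega), h1, h2, add_zero]
    intro hmem
    have hset := (hE.eventually_bisector hcd).self_of_nhds _ _ hab hmem
    have : v d ∈ ({v a, v b} : Set (ℝ × ℝ)) := hset ▸ Set.mem_insert_of_mem _ rfl
    rcases this with h | h
    · exact hv.ne a d (by omega) (by omega) h.symm
    · exact hv.ne b d (by omega) (by omega) h.symm
  obtain ⟨F, hF, hmF, x, hx, hw⟩ := hv.exists_inner_face hcd' hdc hcd fun k hk =>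
    hm k (Finset.mem_Ico.mpr ⟨(Finset.mem_Ico.mp hk).1, (Finset.mem_Ico.mp hk).2.trans hdc⟩)
  have hsum : ∀ y ∈ F, winding v c d y + winding v d (c + n) y = arcTurn v c (c + n) y :=
    fun y hy => winding_add_winding hv.period hcd'.le hdc.le fun hmem =>
      hF.notMem_drawing hy ⟨_, _, hcd, hmem⟩
  have hzero := eq_of_mem_closure_of_eqOn (continuousAt_arcTurn hm) hmF fun y hy => by
    rw [← hsum y hy, hv.winding_eq_of_mem_face hcd' hcd hF hy hx,
      hv.winding_eq_of_mem_face hdc hdc' hF hy hx, hsum x hx]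
  have hw' : winding v d (c + n) x ≠ 0 := by
    intro h0
    have := hsum x hx
    rw [← hzero, hz, h0, add_zero] at this
    exact hw this
  obtain ⟨e, hde, hce, he⟩ := hv.nearTriangulation.exists_apex (T.symm _ _ hcd) hF
    (hv.isBounded_face hcd' hcd hF hx hw) hmF
  obtain ⟨k, hck, hkd, rfl⟩ := hv.exists_index hcd' hcd hF hx hw hce hde he
  obtain ⟨l, hdl, hlc, hl⟩ := hv.exists_index hdc hdc' hF hx hw' hde
    (by rw [hv.period]; exact hce) he
  exact hv.ne k l (by omega) (by omega) hl.symm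

end IsTour

end PlaneGraph

namespace PlaneGraph

open PolyTree

theorem IsMOP.exists_isTour {T : PlaneGraph} (hT : T.IsMOP) :
    3 ≤ T.verts.card ∧ ∃ v : ℕ → ℝ × ℝ, T.IsTour v T.verts.card := by
  obtain ⟨hN, n, u, ⟨hn, hinj, hmem, hadj, hfr, -⟩, hall⟩ := hT
  have : NeZero n := ⟨by omega⟩
  have hcard : T.verts.card = n := by
    have : T.verts = Finset.univ.image u := by
      ext x
      simp only [Finset.mem_image, Finset.mem_univ, true_and]
      exact ⟨fun hx => hall x hx, by rintro ⟨i, rfl⟩; exact hmem i⟩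
    rw [this, Finset.card_image_of_injective _ hinj, Finset.card_univ, ZMod.card]
  rw [hcard]
  refine ⟨hn, fun k => u k, hN, fun k => by simp, ?_, fun k => by simpa using hadj k, ?_, ?_⟩
  · intro a b hab hb h
    have h' := (ZMod.natCast_eq_natCast_iff' _ _ _).mp (hinj h)
    have h'' := (Nat.modEq_iff_dvd' hab.le).mp h'
    have := Nat.le_of_dvd (by omega) h''
    omega
  · exact fun k => frontier_subset_closure (hfr k (left_mem_segment ℝ _ _))
  · intro x hx i
    obtain ⟨a, rfl⟩ := hall x hx
    refine ⟨i + (a - i : ZMod n).val, by omega, ?_, ?_⟩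
    · exact Nat.add_lt_add_left (ZMod.val_lt _) i
    · simp

theorem joined_exc1Edges {a b : Fin 12} : H1graph.Adj a b ↔ joined exc1Edges a b = true := by
  revert a b
  simp only [H1graph, SimpleGraph.fromRel_adj]
  decide +kernel

theorem joined_exc2Edges {a b : Fin 12} : H2graph.Adj a b ↔ joined exc2Edges a b = true := by
  revert a b
  simp only [H2graph, SimpleGraph.fromRel_adj]
  decide +kernel

theorem IsTour.isIsoToSG {T : PlaneGraph} {v : ℕ → ℝ × ℝ} (hv : T.IsTour v 12)
    {H : SimpleGraph (Fin 12)} {σ : Equiv.Perm (Fin 12)}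
    (h : ∀ i j : Fin 12, T.Adj (v i) (v j) ↔ H.Adj (σ i) (σ j)) : T.IsIsoToSG H := by
  have hinj : Function.Injective fun i : Fin 12 => v i := by
    intro i j hij
    rcases lt_trichotomy i j with hlt | rfl | hlt
    · exact absurd hij (hv.ne _ _ hlt (by omega))
    · rfl
    · exact absurd hij.symm (hv.ne _ _ hlt (by omega))
  have hleft : ∀ i : Fin 12, Function.invFun (fun i : Fin 12 => v i) (v i) = i :=
    Function.leftInverse_invFun hinj
  have hsurj : ∀ p ∈ T.verts, ∃ i : Fin 12, v i = p := by
    intro p hp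
    obtain ⟨k, -, hk, rfl⟩ := hv.exists_eq p hp 0
    exact ⟨⟨k, by omega⟩, rfl⟩
  refine ⟨fun p => σ (Function.invFun (fun i : Fin 12 => v i) p),
    ⟨fun _ _ => Set.mem_univ _, ?_, ?_⟩, ?_⟩
  · intro p hp q hq hpq
    obtain ⟨i, rfl⟩ := hsurj p hp
    obtain ⟨j, rfl⟩ := hsurj q hq
    simp only [hleft, EmbeddingLike.apply_eq_iff_eq] at hpq
    rw [hpq]
  · intro a _
    exact ⟨v (σ.symm a), hv.mem_verts _, by simp only [hleft, Equiv.apply_symm_apply]⟩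
  · intro p hp q hq
    obtain ⟨i, rfl⟩ := hsurj p hp
    obtain ⟨j, rfl⟩ := hsurj q hq
    simp only [hleft]
    exact h i j

theorem totalDominationNumber_le {T : PlaneGraph} {D : Finset (ℝ × ℝ)}
    (h : ∀ v ∈ T.verts, ∃ d ∈ D, T.Adj v d) : T.totalDominationNumber ≤ D.card := by
  refine le_trans (Nat.sInf_le ⟨D.filter (· ∈ T.verts), ⟨fun d hd => (Finset.mem_filter.mp hd).2,
    fun v hv => ?_⟩, rfl⟩) (Finset.card_filter_le _ _)
  obtain ⟨d, hd, hvd⟩ := h v hv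
  exact ⟨d, Finset.mem_filter.mpr ⟨hd, (T.mem_of_adj _ _ hvd).2⟩, hvd⟩

end PlaneGraph

/-- If `T` is a maximal outerplanar graph of order `n ≥ 5` and `T` is not
isomorphic to `H₁` or `H₂`, then `γₜ(T) ≤ ⌊2n/5⌋`. -/
theorem totalDomination_MOP (T : PlaneGraph) (n : ℕ)
    (hcard : T.verts.card = n) (hn : 5 ≤ n)
    (hT : T.IsMOP) (hexc : ¬ T.IsExceptional) :
    T.totalDominationNumber ≤ 2 * n / 5 := by
  obtain ⟨-, v, hv⟩ := hT.exists_isTour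
  rw [hcard] at hv
  have hroot : T.Adj (v 0) (v (n - 1)) := by
    have h := hv.adj (n - 1)
    rw [show n - 1 + 1 = 0 + n by omega, hv.period] at h
    exact T.symm _ _ h
  obtain ⟨t, ht⟩ := PolyTree.exists_realizes (A := fun a b => T.Adj (v a) (v b)) (n := n)
    (fun i j hij hj h => hv.exists_triangle hij (by omega) h) (by omega) (by omega) hroot
  have hsize := ht.eq_add
  cases t with
  | leaf =>
    rw [PolyTree.size] at hsize
    omega
  | node l r =>
    rcases PolyTree.exists_dominating T.symm ht (by omega) with ⟨D, hD, hdom⟩ | hmem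
    · refine (PlaneGraph.totalDominationNumber_le (D := D) fun x hx => ?_).trans (by omega)
      obtain ⟨k, -, hk, rfl⟩ := hv.exists_eq x hx 0
      exact hdom k (by omega)
    · have hsize' := eq_of_beq (List.all_eq_true.mp PolyTree.exceptional_size _ hmem)
      obtain rfl : n = 12 := by omega
      obtain ⟨L, hL, σ, hσ⟩ := PolyTree.exists_perm_of_mem (fun i j h => T.symm _ _ h)
        (fun i h => T.loopless _ h)
        (fun a b c d h1 h2 h3 h4 h5 h6 => hv.not_crossing h1 h2 h3 (by omega) h5 h6) hmem ht
      refine absurd ?_ hexc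
      rcases List.mem_cons.mp hL with rfl | hL
      · exact .inl (hv.isIsoToSG (σ := σ) fun i j =>
          (hσ i j).trans PlaneGraph.joined_exc1Edges.symm)
      · obtain rfl := List.mem_singleton.mp hL
        exact .inr (hv.isIsoToSG (σ := σ) fun i j =>
          (hσ i j).trans PlaneGraph.joined_exc2Edges.symm)
end
end

section
/- Every irreducible near-triangulation of order n ≥ 7 contains at least one terminal polygon. -/
/-!
Common definitions.

A *plane graph* is a finite graph whose vertices are points of the plane `ℝ × ℝ` and whose
edges are drawn as straight-line segments between their endpoints (by Fáry's theorem every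
planar graph admits such a drawing).  A *near-triangulation* is a plane graph that is properly
embedded, biconnected, and all of whose bounded faces are triangles (the faces are the
connected components of the complement of the drawing).  The boundary cycle lists, cyclically,
the vertices on the outer (unbounded) face.
-/

open scoped Classical

noncomputable section

section

open Set Metric Topology Filter

theorem isPreconnected_compl_of_starConvex {c : ℝ × ℝ} {C : Set (ℝ × ℝ)}
    (hC : StarConvex ℝ c C) (hb : Bornology.IsBounded C) : IsPreconnected Cᶜ := by
  obtain ⟨R, hR⟩ := hb.subset_closedBall c
  have hrank : 1 < Module.rank ℝ (ℝ × ℝ) := by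
    rw [← Module.finrank_eq_rank]; norm_num
  have ray : ∀ x ∉ C, ∀ M : ℝ, R < M → dist x c < M → ∃ S ⊆ Cᶜ, IsPreconnected S ∧ x ∈ S ∧
      sphere c M ⊆ S := by
    intro x hx M hM hxM
    have hS : sphere c M ⊆ Cᶜ := fun y hy hyC => by
      have h1 := hR hyC
      rw [mem_closedBall] at h1
      rw [mem_sphere] at hy
      linarith
    by_cases hxc : x = c
    · subst hxc
      have hCe : C = ∅ := by
        rw [Set.eq_empty_iff_forall_notMem]
        intro y hy
        exact hx (hC.mem ⟨y, hy⟩)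
      exact ⟨univ, by simp [hCe], isPreconnected_univ, mem_univ _, subset_univ _⟩
    have hd : 0 < dist x c := dist_pos.2 hxc
    refine ⟨(fun t : ℝ => c + t • (x - c)) '' Ici 1 ∪ sphere c M, ?_, ?_, ?_, subset_union_right⟩
    · refine union_subset ?_ hS
      rintro _ ⟨t, ht, rfl⟩ hmem
      have ht' : (1 : ℝ) ≤ t := ht
      have ht0 : 0 < t := by linarith
      apply hx
      have := hC hmem (a := 1 - t⁻¹) (b := t⁻¹)
        (by have := inv_le_one_of_one_le₀ ht'; linarith) (by positivity) (by ring)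
      convert this using 1
      simp only [smul_add, smul_smul, inv_mul_cancel₀ ht0.ne', sub_smul, one_smul]
      abel
    · refine IsPreconnected.union (c + (M / dist x c) • (x - c)) ?_ ?_ ?_
        (isPreconnected_sphere hrank c M)
      · exact ⟨_, by rw [mem_Ici, le_div_iff₀ hd]; linarith, rfl⟩
      · rw [mem_sphere, dist_eq_norm, add_sub_cancel_left, norm_smul, ← dist_eq_norm,
          Real.norm_of_nonneg (div_nonneg (hd.trans hxM).le hd.le)]
        exact div_mul_cancel₀ _ hd.ne'
      · exact isPreconnected_Ici.image _ (by fun_prop)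
    · exact Or.inl ⟨1, by simp, by simp⟩
  refine isPreconnected_of_forall_pair fun x hx y hy => ?_
  set M := max (max R 0) (max (dist x c) (dist y c)) + 1 with hM
  have h1 : R < M := by rw [hM]; exact lt_add_of_le_of_pos (by simp) one_pos
  have h0 : 0 ≤ M := by rw [hM]; exact add_nonneg (by simp) zero_le_one
  obtain ⟨S, hS, hSc, hxS, hsS⟩ := ray x hx M h1
    (by rw [hM]; exact lt_add_of_le_of_pos (by simp) one_pos)
  obtain ⟨S', hS', hSc', hxS', hsS'⟩ := ray y hy M h1
    (by rw [hM]; exact lt_add_of_le_of_pos (by simp) one_pos)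
  obtain ⟨w, hw⟩ := (isConnected_sphere hrank c h0).1
  exact ⟨S ∪ S', union_subset hS hS', Or.inl hxS, Or.inr hxS',
    hSc.union w (hsS hw) (hsS' hw) hSc'⟩

theorem isPreconnected_compl_segment (a b : ℝ × ℝ) : IsPreconnected (segment ℝ a b)ᶜ :=
  isPreconnected_compl_of_starConvex
    ((convex_segment a b).starConvex (left_mem_segment ℝ a b))
    (by rw [← convexHull_pair]; exact isBounded_convexHull.2 (Set.toFinite {a, b}).isBounded)

theorem isClosed_segment_plane (a b : ℝ × ℝ) : IsClosed (segment ℝ a b) := by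
  rw [← convexHull_pair]
  exact (Set.toFinite {a, b}).isCompact_convexHull (𝕜 := ℝ) |>.isClosed

theorem mem_connectedComponentIn_of_mem_closure {F : Set (ℝ × ℝ)} {y w : ℝ × ℝ} (hw : w ∈ F)
    (h : w ∈ closure (connectedComponentIn F y)) : w ∈ connectedComponentIn F y := by
  have hy : y ∈ F := by
    by_contra hy
    rw [connectedComponentIn_eq_empty hy] at h
    simp at h
  have hpre : IsPreconnected (insert w (connectedComponentIn F y)) :=
    isPreconnected_connectedComponentIn.subset_closure (subset_insert _ _)
      (insert_subset h subset_closure)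
  exact hpre.subset_connectedComponentIn (Or.inr (mem_connectedComponentIn hy))
    (insert_subset hw (connectedComponentIn_subset _ _)) (Or.inl rfl)

theorem subset_connectedComponentIn_of_inter {F S : Set (ℝ × ℝ)} {y : ℝ × ℝ}
    (hS : IsPreconnected S) (hSF : S ⊆ F) (h : (S ∩ connectedComponentIn F y).Nonempty) :
    S ⊆ connectedComponentIn F y := by
  obtain ⟨x, hx, hxy⟩ := h
  rw [connectedComponentIn_eq hxy]
  exact hS.subset_connectedComponentIn hx hSF

theorem exists_ball_disjoint {ι : Type*} [Finite ι] (s : ι → Set (ℝ × ℝ))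
    (hs : ∀ i, IsClosed (s i)) (z : ℝ × ℝ) :
    ∃ r > 0, ∀ i, z ∉ s i → Disjoint (ball z r) (s i) := by
  have h : ∀ᶠ x in 𝓝 z, ∀ i, z ∉ s i → x ∉ s i := by
    rw [eventually_all]
    intro i
    by_cases hz : z ∈ s i
    · simp [hz]
    · filter_upwards [(hs i).isOpen_compl.mem_nhds hz] with x hx _ using hx
  obtain ⟨r, hr, hb⟩ := Metric.eventually_nhds_iff_ball.1 h
  exact ⟨r, hr, fun i hi => Set.disjoint_left.2 fun x hx => hb x hx i hi⟩

/-- The cross product of two vectors of the plane. -/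
def planeCross (a b : ℝ × ℝ) : ℝ := a.1 * b.2 - a.2 * b.1

theorem convex_setOf_pos {f : ℝ × ℝ → ℝ}
    (hf : ∀ x y p q, p + q = 1 → f (p • x + q • y) = p * f x + q * f y) :
    Convex ℝ {x | 0 < f x} := by
  intro x hx y hy p q hp hq hpq
  simp only [mem_ofPred_eq] at *
  rw [hf _ _ _ _ hpq]
  rcases hp.eq_or_lt with rfl | hp
  · have : q = 1 := by linarith
    simp [this, hy]
  · exact add_pos_of_pos_of_nonneg (mul_pos hp hx) (mul_nonneg hq hy.le)

theorem planeCross_sub_left_affine (z b x y : ℝ × ℝ) (p q : ℝ) (h : p + q = 1) :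
    planeCross (p • x + q • y - z) b = p * planeCross (x - z) b + q * planeCross (y - z) b := by
  obtain rfl : q = 1 - p := by linarith
  simp only [planeCross, Prod.fst_sub, Prod.snd_sub, Prod.fst_add, Prod.snd_add, Prod.smul_fst,
    Prod.smul_snd, smul_eq_mul]
  ring

theorem planeCross_swap (a b : ℝ × ℝ) : planeCross a b = -planeCross b a := by
  unfold planeCross; ring

theorem convex_planeCross_left_pos (z b : ℝ × ℝ) : Convex ℝ {x | 0 < planeCross (x - z) b} :=
  convex_setOf_pos fun x y p q => planeCross_sub_left_affine z b x y p q

theorem convex_planeCross_left_neg (z b : ℝ × ℝ) : Convex ℝ {x | planeCross (x - z) b < 0} := by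
  have := convex_setOf_pos (f := fun x => -planeCross (x - z) b) fun x y p q h => by
    rw [planeCross_sub_left_affine z b x y p q h]; ring
  simpa using this

theorem mem_segment_of_ray {z a : ℝ × ℝ} {r t : ℝ} (ha : r ≤ dist a z) (ht : 0 ≤ t)
    (h : z + t • (a - z) ∈ ball z r) : z + t • (a - z) ∈ segment ℝ z a := by
  rw [segment_eq_image']
  refine ⟨t, ⟨ht, ?_⟩, rfl⟩
  rw [mem_ball, dist_eq_norm, add_sub_cancel_left, norm_smul, Real.norm_of_nonneg ht,
    ← dist_eq_norm] at h
  by_contra! h1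
  nlinarith [dist_nonneg (x := a) (y := z)]

theorem mem_closure_of_direction {z x w : ℝ × ℝ} {r : ℝ} {S : Set (ℝ × ℝ)} (hx : x ∈ ball z r)
    (h : ∀ ε : ℝ, 0 < ε → x + ε • w ∈ ball z r → x + ε • w ∈ S) : x ∈ closure S := by
  have ht : Tendsto (fun ε : ℝ => x + ε • w) (𝓝[>] 0) (𝓝 x) := by
    have : Continuous fun ε : ℝ => x + ε • w := by fun_prop
    simpa using (this.tendsto 0).mono_left nhdsWithin_le_nhds
  refine mem_closure_of_tendsto ht ?_
  filter_upwards [ht (isOpen_ball.mem_nhds hx), self_mem_nhdsWithin] with ε hε hpos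
  exact h ε hpos hε

theorem exists_sectors_of_pos {z a b : ℝ × ℝ} {r : ℝ} (hab : 0 < planeCross (a - z) (b - z))
    (ha : r ≤ dist a z) (hb : r ≤ dist b z) :
    ∃ S₁ S₂ : Set (ℝ × ℝ), IsPreconnected S₁ ∧ IsPreconnected S₂ ∧
      ball z r \ (segment ℝ z a ∪ segment ℝ z b) = S₁ ∪ S₂ ∧
      ∀ x ∈ ball z r ∩ (segment ℝ z a ∪ segment ℝ z b), x ∈ closure S₁ ∧ x ∈ closure S₂ := by
  rcases le_or_gt r 0 with hr | hr
  · exact ⟨∅, ∅, isPreconnected_empty, isPreconnected_empty, by simp [ball_eq_empty.2 hr],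
      by simp [ball_eq_empty.2 hr]⟩
  set α := a - z with hα
  set β := b - z with hβ
  have hball := convex_ball z r
  have hza : ∀ t : ℝ, planeCross (z + t • α - z) β = t * planeCross α β ∧
      planeCross (z + t • α - z) α = 0 := fun t => by
    simp only [planeCross, Prod.fst_sub, Prod.snd_sub, Prod.fst_add, Prod.snd_add, Prod.smul_fst,
      Prod.smul_snd, smul_eq_mul]
    constructor <;> ring
  have hzb : ∀ t : ℝ, planeCross (z + t • β - z) α = -(t * planeCross α β) ∧
      planeCross (z + t • β - z) β = 0 := fun t => by
    simp only [planeCross, Prod.fst_sub, Prod.snd_sub, Prod.fst_add, Prod.snd_add, Prod.smul_fst,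
      Prod.smul_snd, smul_eq_mul]
    constructor <;> ring
  have hlin : ∀ x w c, ∀ ε : ℝ, planeCross (x + ε • w - z) c =
      planeCross (x - z) c + ε * planeCross w c := fun x w c ε => by
    simp only [planeCross, Prod.fst_sub, Prod.snd_sub, Prod.fst_add, Prod.snd_add, Prod.smul_fst,
      Prod.smul_snd, smul_eq_mul]
    ring
  have hself : ∀ c, planeCross c c = 0 := fun c => by unfold planeCross; ring
  have hadd : ∀ c, planeCross (α + β) c = planeCross α c + planeCross β c := fun c => by
    simp only [planeCross, Prod.fst_add, Prod.snd_add]; ring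
  have hneg : ∀ w c, planeCross (-w) c = -planeCross w c := fun w c => by
    simp only [planeCross, Prod.fst_neg, Prod.snd_neg]; ring
  have hzz : ∀ c, planeCross (z - z) c = 0 := fun c => by simp [planeCross]
  have hba : planeCross β α = -planeCross α β := planeCross_swap _ _
  have hin : ∀ x ∈ segment ℝ z a ∪ segment ℝ z b,
      (∃ t : ℝ, 0 ≤ t ∧ x = z + t • α) ∨ ∃ t : ℝ, 0 ≤ t ∧ x = z + t • β := by
    rintro x (hx | hx) <;> rw [segment_eq_image'] at hx <;> obtain ⟨t, ht, rfl⟩ := hx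
    · exact Or.inl ⟨t, ht.1, rfl⟩
    · exact Or.inr ⟨t, ht.1, rfl⟩
  have hrep : ∀ x, x = z + (planeCross (x - z) β / planeCross α β) • α +
      (-planeCross (x - z) α / planeCross α β) • β := fun x => by
    have h0 := hab.ne'
    ext
    · simp only [Prod.fst_add, Prod.smul_fst, smul_eq_mul]
      field_simp
      simp only [planeCross, Prod.fst_sub, Prod.snd_sub]
      ring
    · simp only [Prod.snd_add, Prod.smul_snd, smul_eq_mul]
      field_simp
      simp only [planeCross, Prod.fst_sub, Prod.snd_sub]
      ring
  refine ⟨ball z r ∩ {x | 0 < planeCross (x - z) β} ∩ {x | planeCross (x - z) α < 0},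
    ball z r ∩ {x | planeCross (x - z) β < 0} ∪ ball z r ∩ {x | 0 < planeCross (x - z) α},
    ?_, ?_, ?_, ?_⟩
  · exact ((hball.inter (convex_planeCross_left_pos z β)).inter
      (convex_planeCross_left_neg z α)).isPreconnected
  · have hz : z ∈ closure (ball z r ∩ ({x | planeCross (x - z) β < 0} ∩
        {x | 0 < planeCross (x - z) α})) := by
      refine mem_closure_of_direction (w := -(α + β)) (mem_ball_self hr) fun ε hε hb => ⟨hb, ?_, ?_⟩
      · simp only [mem_ofPred_eq, hlin, hneg, hadd, hself, hzz]
        nlinarith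
      · simp only [mem_ofPred_eq, hlin, hneg, hadd, hself, hba, hzz]
        nlinarith
    obtain ⟨w, hw⟩ := closure_nonempty_iff.1 ⟨z, hz⟩
    exact (hball.inter (convex_planeCross_left_neg z β)).isPreconnected.union w
      ⟨hw.1, hw.2.1⟩ ⟨hw.1, hw.2.2⟩ (hball.inter (convex_planeCross_left_pos z α)).isPreconnected
  · ext x
    simp only [Set.mem_sdiff, mem_union, mem_inter_iff, mem_ofPred_eq]
    constructor
    · rintro ⟨hx, hn⟩
      by_contra! hc
      obtain ⟨⟨hc1, hc2⟩, hc3⟩ := And.intro hc.2 hc.1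
      have h1 := hc1 hx
      have h2 := hc2 hx
      rcases h1.eq_or_lt with h1 | h1
      · apply hn
        right
        have := hrep x
        rw [← h1] at this
        simp only [zero_div, zero_smul, add_zero] at this
        rw [this] at hx ⊢
        exact mem_segment_of_ray hb (div_nonneg (by linarith) hab.le) hx
      · rcases h2.eq_or_lt with h2 | h2
        · apply hn
          left
          have := hrep x
          rw [h2] at this
          simp only [neg_zero, zero_div, zero_smul, add_zero] at this
          rw [this] at hx ⊢
          exact mem_segment_of_ray ha (div_nonneg (by linarith) hab.le) hx
        · exact absurd (hc3 ⟨hx, h1⟩) (not_le.2 h2)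
    · intro h
      refine ⟨by tauto, fun hs => ?_⟩
      rcases hin x hs with ⟨t, ht, rfl⟩ | ⟨t, ht, rfl⟩
      · rw [(hza t).1, (hza t).2] at h
        have := mul_nonneg ht hab.le
        rcases h with h | h | h <;> linarith [h.2]
      · rw [(hzb t).1, (hzb t).2] at h
        have := mul_nonneg ht hab.le
        rcases h with h | h | h
        · linarith [h.1.2]
        · linarith [h.2]
        · linarith [h.2]
  · rintro x ⟨hx, hs⟩
    rcases hin x hs with ⟨t, ht, rfl⟩ | ⟨t, ht, rfl⟩
    · have := mul_nonneg ht hab.le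
      refine ⟨mem_closure_of_direction (w := α + β) hx fun ε hε hb => ⟨⟨hb, ?_⟩, ?_⟩,
        mem_closure_of_direction (w := -β) hx fun ε hε hb => Or.inr ⟨hb, ?_⟩⟩ <;>
      · simp only [mem_ofPred_eq, hlin, hneg, hadd, hself, hba, hzz]
        nlinarith [mul_pos hε hab]
    · have := mul_nonneg ht hab.le
      refine ⟨mem_closure_of_direction (w := α + β) hx fun ε hε hb => ⟨⟨hb, ?_⟩, ?_⟩,
        mem_closure_of_direction (w := -α) hx fun ε hε hb => Or.inl ⟨hb, ?_⟩⟩ <;>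
      · simp only [mem_ofPred_eq, hlin, hneg, hadd, hself, hba, hzz]
        nlinarith [mul_pos hε hab]

/-- A ball minus two initial segments of its radii falls into two connected sectors. -/
theorem exists_sectors {z a b : ℝ × ℝ} {r : ℝ} (hab : ¬ SameRay ℝ (a - z) (b - z))
    (ha : r ≤ dist a z) (hb : r ≤ dist b z) :
    ∃ S₁ S₂ : Set (ℝ × ℝ), IsPreconnected S₁ ∧ IsPreconnected S₂ ∧
      ball z r \ (segment ℝ z a ∪ segment ℝ z b) = S₁ ∪ S₂ ∧
      ∀ x ∈ ball z r ∩ (segment ℝ z a ∪ segment ℝ z b), x ∈ closure S₁ ∧ x ∈ closure S₂ := by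
  rcases lt_trichotomy (planeCross (a - z) (b - z)) 0 with h | h | h
  · rw [union_comm (segment ℝ z a)]
    exact exists_sectors_of_pos (by rw [planeCross_swap]; linarith) hb ha
  · set α := a - z with hα
    set β := b - z with hβ
    have hα0 : α ≠ 0 := fun h0 => hab (by rw [h0]; exact SameRay.zero_left _)
    have hN : 0 < α.1 ^ 2 + α.2 ^ 2 := by
      by_contra! hle
      apply hα0
      ext <;> simp only [Prod.fst_zero, Prod.snd_zero] <;> nlinarith [sq_nonneg α.1, sq_nonneg α.2]
    have hcol : ∀ y, planeCross y α = 0 →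
        y = ((y.1 * α.1 + y.2 * α.2) / (α.1 ^ 2 + α.2 ^ 2)) • α := fun y hy => by
      unfold planeCross at hy
      ext <;> simp only [Prod.smul_fst, Prod.smul_snd, smul_eq_mul] <;> field_simp
      · linear_combination α.2 * hy
      · linear_combination -α.1 * hy
    obtain ⟨k, hk⟩ : ∃ k : ℝ, β = k • α := ⟨_, hcol β (by rw [planeCross_swap, h, neg_zero])⟩
    have hk0 : k < 0 := by
      by_contra! hk0
      exact hab (hk ▸ SameRay.sameRay_nonneg_smul_right α hk0)
    have hline : ∀ x ∈ ball z r, (x ∈ segment ℝ z a ∪ segment ℝ z b ↔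
        planeCross (x - z) α = 0) := by
      intro x hx
      constructor
      · rintro (hs | hs) <;> rw [segment_eq_image'] at hs <;> obtain ⟨t, ht, rfl⟩ := hs
        · simp only [planeCross, add_sub_cancel_left, ← hα, Prod.smul_fst, Prod.smul_snd,
            smul_eq_mul]
          ring
        · simp only [planeCross, add_sub_cancel_left, ← hβ, hk, Prod.smul_fst, Prod.smul_snd,
            smul_eq_mul]
          ring
      · intro hc
        obtain ⟨t, ht⟩ : ∃ t : ℝ, x - z = t • α := ⟨_, hcol _ hc⟩
        rcases le_total 0 t with h0 | h0
        · left
          obtain rfl : x = z + t • α := by rw [← ht]; abel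
          exact mem_segment_of_ray ha h0 hx
        · right
          obtain rfl : x = z + (t / k) • β := by
            rw [hk, smul_smul, div_mul_cancel₀ _ hk0.ne, ← ht]; abel
          exact mem_segment_of_ray hb (div_nonneg_of_nonpos h0 hk0.le) hx
    refine ⟨ball z r ∩ {x | 0 < planeCross (x - z) α}, ball z r ∩ {x | planeCross (x - z) α < 0},
      ((convex_ball z r).inter (convex_planeCross_left_pos z α)).isPreconnected,
      ((convex_ball z r).inter (convex_planeCross_left_neg z α)).isPreconnected, ?_, ?_⟩
    · ext x
      simp only [Set.mem_sdiff, mem_inter_iff, mem_ofPred_eq,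
        mem_union x (ball z r ∩ _)]
      rw [← and_or_left]
      refine and_congr_right fun hx => ?_
      rw [hline x hx, ← ne_eq, ne_iff_lt_or_gt, or_comm]
    · rintro x ⟨hx, hs⟩
      have h0 := (hline x hx).1 hs
      have key : ∀ ε : ℝ, planeCross (x + ε • (α.2, -α.1) - z) α =
          ε * (α.1 ^ 2 + α.2 ^ 2) ∧ planeCross (x + ε • (-α.2, α.1) - z) α =
          -(ε * (α.1 ^ 2 + α.2 ^ 2)) := fun ε => by
        simp only [planeCross, Prod.fst_sub, Prod.snd_sub, Prod.fst_add, Prod.snd_add,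
          Prod.smul_fst, Prod.smul_snd, smul_eq_mul] at h0 ⊢
        constructor <;> linear_combination h0
      refine ⟨mem_closure_of_direction (w := (α.2, -α.1)) hx fun ε hε hb => ⟨hb, ?_⟩,
        mem_closure_of_direction (w := (-α.2, α.1)) hx fun ε hε hb => ⟨hb, ?_⟩⟩
      · rw [mem_ofPred_eq, (key ε).1]; positivity
      · rw [mem_ofPred_eq, (key ε).2, neg_lt_zero]; positivity
  · exact exists_sectors_of_pos h ha hb

/-- Near a point `z` at which the closed set `X` consists of two segments leaving `z` in different
directions, a component of the complement of `X` is adherent either to all points of `X` or to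
none. -/
theorem exists_ball_closure_connectedComponentIn {X : Set (ℝ × ℝ)} {z a b : ℝ × ℝ} {r : ℝ}
    (hr : 0 < r) (hab : ¬ SameRay ℝ (a - z) (b - z))
    (hX : X ∩ ball z r = (segment ℝ z a ∪ segment ℝ z b) ∩ ball z r) :
    ∃ δ > 0, ∃ S₁ S₂ : Set (ℝ × ℝ), ball z δ \ X = S₁ ∪ S₂ ∧
      IsPreconnected S₁ ∧ IsPreconnected S₂ ∧
      ∀ x ∈ ball z δ ∩ X, x ∈ closure S₁ ∧ x ∈ closure S₂ := by
  have haz : a ≠ z := by rintro rfl; exact hab (by simp)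
  have hbz : b ≠ z := by rintro rfl; exact hab (by simp)
  set δ := min r (min (dist a z) (dist b z))
  obtain ⟨S₁, S₂, h1, h2, h3, h4⟩ := exists_sectors (r := δ) hab
    ((min_le_right _ _).trans (min_le_left _ _)) ((min_le_right _ _).trans (min_le_right _ _))
  have hX' : ∀ x ∈ ball z δ, (x ∈ X ↔ x ∈ segment ℝ z a ∪ segment ℝ z b) := fun x hx => by
    have hx' : x ∈ ball z r := ball_subset_ball (min_le_left _ _) hx
    have := Set.ext_iff.1 hX x
    simpa only [mem_inter_iff, hx', and_true] using this
  refine ⟨δ, lt_min hr (lt_min (dist_pos.2 haz) (dist_pos.2 hbz)), S₁, S₂, ?_, h1, h2, ?_⟩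
  · rw [← h3]
    ext x
    exact and_congr_right fun hx => not_congr (hX' x hx)
  · rintro x ⟨hx, hxX⟩
    exact h4 x ⟨hx, (hX' x hx).1 hxX⟩

theorem closure_saturated_of_sectors {X K S₁ S₂ : Set (ℝ × ℝ)} {z : ℝ × ℝ} {δ : ℝ}
    (hKX : K ⊆ Xᶜ) (hK : ∀ S, IsPreconnected S → S ⊆ Xᶜ → (S ∩ K).Nonempty → S ⊆ K)
    (h : ball z δ \ X = S₁ ∪ S₂) (h₁ : IsPreconnected S₁) (h₂ : IsPreconnected S₂)
    (hS : ∀ x ∈ ball z δ ∩ X, x ∈ closure S₁ ∧ x ∈ closure S₂) {x y : ℝ × ℝ}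
    (hx : x ∈ ball z δ ∩ X) (hy : y ∈ ball z δ ∩ X) (hxK : x ∈ closure K) : y ∈ closure K := by
  obtain ⟨w, hwb, hwK⟩ := mem_closure_iff.1 hxK _ isOpen_ball hx.1
  have hw : w ∈ S₁ ∪ S₂ := h ▸ ⟨hwb, hKX hwK⟩
  have hsub : S₁ ∪ S₂ ⊆ Xᶜ := h ▸ fun v hv => hv.2
  rcases hw with hw | hw
  · exact closure_mono (hK S₁ h₁ (subset_union_left.trans hsub) ⟨w, hw, hwK⟩) (hS y hy).1
  · exact closure_mono (hK S₂ h₂ (subset_union_right.trans hsub) ⟨w, hw, hwK⟩) (hS y hy).2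

/-- If each point of a connected part `A` of the closed set `X` is an endpoint of exactly two
segments forming `X` locally, then a component of the complement of `X` adherent to one point of
`A` is adherent to all of them. -/
theorem closure_of_locally_two_segments {X A K : Set (ℝ × ℝ)} (hA : IsPreconnected A) (hAX : A ⊆ X)
    (hKX : K ⊆ Xᶜ) (hK : ∀ S, IsPreconnected S → S ⊆ Xᶜ → (S ∩ K).Nonempty → S ⊆ K)
    (hloc : ∀ z ∈ A, ∃ a b : ℝ × ℝ, ∃ r > 0, ¬ SameRay ℝ (a - z) (b - z) ∧
      X ∩ ball z r = (segment ℝ z a ∪ segment ℝ z b) ∩ ball z r)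
    {x y : ℝ × ℝ} (hx : x ∈ A) (hy : y ∈ A) (hxK : x ∈ closure K) : y ∈ closure K := by
  refine (hA.induction₂ (fun x y => x ∈ closure K ↔ y ∈ closure K) ?_ ?_ ?_ hx hy).1 hxK
  · intro z hz
    obtain ⟨a, b, r, hr, hab, hX⟩ := hloc z hz
    obtain ⟨δ, hδ, S₁, S₂, h, h₁, h₂, hS⟩ := exists_ball_closure_connectedComponentIn hr hab hX
    filter_upwards [mem_nhdsWithin_of_mem_nhds (ball_mem_nhds z hδ), self_mem_nhdsWithin]
      with y hy hyA
    have hz' : z ∈ ball z δ ∩ X := ⟨mem_ball_self hδ, hAX hz⟩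
    have hy' : y ∈ ball z δ ∩ X := ⟨hy, hAX hyA⟩
    exact ⟨closure_saturated_of_sectors hKX hK h h₁ h₂ hS hz' hy',
      closure_saturated_of_sectors hKX hK h h₁ h₂ hS hy' hz'⟩
  · intro x y z _ _ _ h1 h2
    exact h1.trans h2
  · intro x y _ _ h
    exact h.symm

theorem not_sameRay_of_mem_openSegment {a b z : ℝ × ℝ} (hab : a ≠ b) (hz : z ∈ openSegment ℝ a b) :
    ¬ SameRay ℝ (a - z) (b - z) := by
  obtain ⟨p, q, hp, hq, hpq, rfl⟩ := hz
  obtain rfl : p = 1 - q := by linarith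
  have h1 : a - ((1 - q) • a + q • b) = q • (a - b) := by
    ext <;> simp <;> ring
  have h2 : b - ((1 - q) • a + q • b) = -((1 - q) • (a - b)) := by
    ext <;> simp <;> ring
  rw [h1, h2]
  intro h
  have hv : a - b ≠ 0 := sub_ne_zero.2 hab
  obtain ⟨r₁, r₂, hr₁, hr₂, h3⟩ := h.exists_pos (smul_ne_zero hq.ne' hv)
    (neg_ne_zero.2 (smul_ne_zero hp.ne' hv))
  have h4 : (r₁ * q + r₂ * (1 - q)) • (a - b) = 0 := by
    rw [add_smul, mul_smul, mul_smul, h3, smul_neg, neg_add_cancel]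
  have h5 := (smul_eq_zero.1 h4).resolve_right hv
  have := mul_pos hr₁ hq
  have := mul_pos hr₂ hp
  linarith

/-- The signed angle under which the segment from `a` to `b` is seen from `x`. -/
def viewAngle (a b x : ℝ × ℝ) : ℝ :=
  Complex.arg (Complex.equivRealProdCLM.symm (b - x) / Complex.equivRealProdCLM.symm (a - x))

theorem equivRealProdCLM_symm_ne_zero {v : ℝ × ℝ} (h : v ≠ 0) :
    Complex.equivRealProdCLM.symm v ≠ 0 := by simpa using h

theorem continuousAt_viewAngle {a b x : ℝ × ℝ} (hx : x ∉ segment ℝ a b) :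
    ContinuousAt (viewAngle a b) x := by
  have ha : a - x ≠ 0 := sub_ne_zero.2 fun h => hx (h ▸ left_mem_segment ℝ a b)
  have ha' := equivRealProdCLM_symm_ne_zero ha
  unfold viewAngle
  refine ContinuousAt.comp (g := Complex.arg) (Complex.continuousAt_arg ?_) ?_
  · by_contra hs
    rw [Complex.mem_slitPlane_iff] at hs
    push Not at hs
    set w := Complex.equivRealProdCLM.symm (b - x) / Complex.equivRealProdCLM.symm (a - x) with hw
    have hwr : w = ((w.re : ℝ) : ℂ) := by apply Complex.ext <;> simp [hs.2]
    have h1 : Complex.equivRealProdCLM.symm (b - x) =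
        Complex.equivRealProdCLM.symm (w.re • (a - x)) := by
      rw [map_smul, Complex.real_smul, ← hwr, hw, div_mul_cancel₀ _ ha']
    have h2 := Complex.equivRealProdCLM.symm.injective h1
    set t := w.re
    apply hx
    refine ⟨-t / (1 - t), 1 / (1 - t), div_nonneg (by linarith) (by linarith),
      div_nonneg (by linarith) (by linarith), ?_, ?_⟩
    · have : 1 - t ≠ 0 := by linarith
      field_simp; ring
    · have ht : 1 - t ≠ 0 := by linarith
      have hb : b = x + t • (a - x) := by rw [← h2]; abel
      rw [hb]
      ext <;> simp <;> field_simp <;> ring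
  · refine ContinuousAt.div ?_ ?_ ha' <;> fun_prop

theorem coe_viewAngle {a b x : ℝ × ℝ} (ha : x ≠ a) (hb : x ≠ b) :
    (viewAngle a b x : Real.Angle) = Complex.arg (Complex.equivRealProdCLM.symm (b - x)) -
      Complex.arg (Complex.equivRealProdCLM.symm (a - x)) := by
  rw [viewAngle, Complex.arg_div_coe_angle (equivRealProdCLM_symm_ne_zero (sub_ne_zero.2 hb.symm))
    (equivRealProdCLM_symm_ne_zero (sub_ne_zero.2 ha.symm))]

theorem im_div_eq_planeCross_div {a b x : ℝ × ℝ} :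
    (Complex.equivRealProdCLM.symm (b - x) / Complex.equivRealProdCLM.symm (a - x)).im =
      planeCross (b - a) (x - a) / Complex.normSq (Complex.equivRealProdCLM.symm (a - x)) := by
  rw [Complex.div_im, ← sub_div]
  congr 1
  simp [planeCross]
  ring

theorem tendsto_viewAngle_of_mem_openSegment {a b z : ℝ × ℝ} (hab : a ≠ b)
    (hz : z ∈ openSegment ℝ a b) :
    Tendsto (viewAngle a b) (𝓝[{x | 0 < planeCross (b - a) (x - a)}] z) (𝓝 Real.pi) ∧
    Tendsto (viewAngle a b) (𝓝[{x | planeCross (b - a) (x - a) < 0}] z) (𝓝 (-Real.pi)) := by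
  have hza : a - z ≠ 0 := by
    rw [sub_ne_zero]
    rintro rfl
    exact hab (left_mem_openSegment_iff.1 hz)
  have ha' := equivRealProdCLM_symm_ne_zero hza
  set f : ℝ × ℝ → ℂ := fun x =>
    Complex.equivRealProdCLM.symm (b - x) / Complex.equivRealProdCLM.symm (a - x) with hf
  have hcont : ContinuousAt f z := by
    refine ContinuousAt.div ?_ ?_ ha' <;> fun_prop
  obtain ⟨t, ht, hft⟩ : ∃ t : ℝ, t < 0 ∧ f z = t := by
    obtain ⟨p, q, hp, hq, hpq, rfl⟩ := hz
    refine ⟨-(p / q), by have := div_pos hp hq; linarith, ?_⟩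
    rw [hf]
    simp only
    rw [div_eq_iff ha']
    obtain rfl : p = 1 - q := by linarith
    rw [← Complex.real_smul, ← map_smul]
    congr 1
    ext <;> simp <;> field_simp <;> ring
  have hre : (f z).re < 0 := by simp [hft, ht]
  have him : (f z).im = 0 := by simp [hft]
  have hne : ∀ᶠ x in 𝓝 z, a - x ≠ 0 := by
    have : ContinuousAt (fun x => a - x) z := by fun_prop
    exact this.eventually_ne hza
  have hnorm : ∀ x, a - x ≠ 0 → 0 < Complex.normSq (Complex.equivRealProdCLM.symm (a - x)) :=
    fun x hx => Complex.normSq_pos.2 (equivRealProdCLM_symm_ne_zero hx)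
  constructor
  · refine (Complex.tendsto_arg_nhdsWithin_im_nonneg_of_re_neg_of_im_zero hre him).comp
      (tendsto_nhdsWithin_iff.2 ⟨hcont.tendsto.mono_left nhdsWithin_le_nhds, ?_⟩)
    filter_upwards [mem_nhdsWithin_of_mem_nhds hne, self_mem_nhdsWithin] with x hx hpos
    refine le_of_le_of_eq ?_ im_div_eq_planeCross_div.symm
    exact (div_pos hpos (hnorm x hx)).le
  · refine (Complex.tendsto_arg_nhdsWithin_im_neg_of_re_neg_of_im_zero hre him).comp
      (tendsto_nhdsWithin_iff.2 ⟨hcont.tendsto.mono_left nhdsWithin_le_nhds, ?_⟩)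
    filter_upwards [mem_nhdsWithin_of_mem_nhds hne, self_mem_nhdsWithin] with x hx hpos
    refine lt_of_eq_of_lt im_div_eq_planeCross_div ?_
    exact div_neg_of_neg_of_pos hpos (hnorm x hx)

/-- The polygonal arc with the vertices `v r, v (r + 1), …, v s`. -/
def polyArc (v : ℕ → ℝ × ℝ) (r s : ℕ) : Set (ℝ × ℝ) :=
  ⋃ k ∈ Finset.Ico r s, segment ℝ (v k) (v (k + 1))

theorem mem_polyArc {v : ℕ → ℝ × ℝ} {r s : ℕ} {x : ℝ × ℝ} :
    x ∈ polyArc v r s ↔ ∃ k, r ≤ k ∧ k < s ∧ x ∈ segment ℝ (v k) (v (k + 1)) := by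
  simp [polyArc, and_assoc]

theorem isClosed_polyArc (v : ℕ → ℝ × ℝ) (r s : ℕ) : IsClosed (polyArc v r s) :=
  (Finset.Ico r s).finite_toSet.isClosed_biUnion fun _ _ => isClosed_segment_plane _ _

/-- The total angle swept, seen from `x`, by the closed polygon `v r, …, v s, v r`. -/
def sweptAngle (v : ℕ → ℝ × ℝ) (r s : ℕ) (x : ℝ × ℝ) : ℝ :=
  ∑ k ∈ Finset.Ico r s, viewAngle (v k) (v (k + 1)) x + viewAngle (v s) (v r) x

theorem continuousAt_sum_viewAngle {v : ℕ → ℝ × ℝ} {r s : ℕ} {x : ℝ × ℝ}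
    (hx : x ∉ polyArc v r s) :
    ContinuousAt (fun x => ∑ k ∈ Finset.Ico r s, viewAngle (v k) (v (k + 1)) x) x := by
  refine tendsto_finsetSum _ fun k hk => continuousAt_viewAngle fun h => hx ?_
  rw [Finset.mem_Ico] at hk
  exact mem_polyArc.2 ⟨k, hk.1, hk.2, h⟩

theorem exists_sweptAngle_eq {v : ℕ → ℝ × ℝ} {r s : ℕ} (hrs : r ≤ s) {x : ℝ × ℝ}
    (hx : x ∉ polyArc v r s ∪ segment ℝ (v s) (v r)) :
    ∃ n : ℤ, sweptAngle v r s x = 2 * Real.pi * n := by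
  have hne : ∀ k, r ≤ k → k ≤ s → x ≠ v k := by
    rintro k hk hks rfl
    rcases hks.eq_or_lt with rfl | hks
    · exact hx (Or.inr (left_mem_segment ℝ _ _))
    · exact hx (Or.inl (mem_polyArc.2 ⟨k, hk, hks, left_mem_segment ℝ _ _⟩))
  have h : (sweptAngle v r s x : Real.Angle) = (0 : ℝ) := by
    rw [sweptAngle, Real.Angle.coe_add, coe_viewAngle (hne s hrs le_rfl) (hne r le_rfl hrs)]
    have : ((∑ k ∈ Finset.Ico r s, viewAngle (v k) (v (k + 1)) x : ℝ) : Real.Angle) =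
        ∑ k ∈ Finset.Ico r s, (viewAngle (v k) (v (k + 1)) x : Real.Angle) :=
      map_sum Real.Angle.coeHom _ _
    have e : ∑ k ∈ Finset.Ico r s, (viewAngle (v k) (v (k + 1)) x : Real.Angle) =
        ∑ k ∈ Finset.Ico r s, ((Complex.arg (Complex.equivRealProdCLM.symm (v (k + 1) - x)) :
          Real.Angle) - Complex.arg (Complex.equivRealProdCLM.symm (v k - x))) := by
      refine Finset.sum_congr rfl fun k hk => ?_
      rw [Finset.mem_Ico] at hk
      exact coe_viewAngle (hne k hk.1 hk.2.le) (hne (k + 1) (by lia) (by lia))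
    rw [this, e, Finset.sum_Ico_sub (fun k =>
      (Complex.arg (Complex.equivRealProdCLM.symm (v k - x)) : Real.Angle)) hrs]
    simp
  obtain ⟨n, hn⟩ := Real.Angle.angle_eq_iff_two_pi_dvd_sub.1 h
  exact ⟨n, by rw [← hn, sub_zero]⟩

theorem sweptAngle_eq_of_isPreconnected {v : ℕ → ℝ × ℝ} {r s : ℕ} (hrs : r ≤ s)
    {S : Set (ℝ × ℝ)} (hS : IsPreconnected S)
    (hSd : S ⊆ (polyArc v r s ∪ segment ℝ (v s) (v r))ᶜ) {x y : ℝ × ℝ} (hx : x ∈ S) (hy : y ∈ S) :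
    sweptAngle v r s x = sweptAngle v r s y := by
  have hcont : ContinuousOn (sweptAngle v r s) S := fun w hw =>
    ((continuousAt_sum_viewAngle fun h => hSd hw (Or.inl h)).add
      (continuousAt_viewAngle fun h => hSd hw (Or.inr h))).continuousWithinAt
  have hord := (hS.image _ hcont).ordConnected
  have key : ∀ x ∈ S, ∀ y ∈ S, ¬ sweptAngle v r s x < sweptAngle v r s y := by
    intro x hx y hy hlt
    obtain ⟨n, hn⟩ := exists_sweptAngle_eq hrs (hSd hx)
    obtain ⟨n', hn'⟩ := exists_sweptAngle_eq hrs (hSd hy)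
    have hpi : 0 < 2 * Real.pi := Real.two_pi_pos
    rw [hn, hn'] at hlt
    have hlt' : n + 1 ≤ n' := by exact_mod_cast (mul_lt_mul_iff_right₀ hpi).1 hlt
    have hle : (n : ℝ) + 1 ≤ n' := by exact_mod_cast hlt'
    obtain ⟨w, hw, hwe⟩ := hord.out ⟨x, hx, rfl⟩ ⟨y, hy, rfl⟩
      (show 2 * Real.pi * (n + 1 / 2) ∈ _ by rw [hn, hn']; constructor <;> nlinarith)
    obtain ⟨k, hk⟩ := exists_sweptAngle_eq hrs (hSd hw)
    have h1 : (k : ℝ) = n + 1 / 2 := mul_left_cancel₀ hpi.ne' (hk.symm.trans hwe)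
    have h2 : (2 * k : ℤ) = 2 * n + 1 := by
      have : (2 * k : ℝ) = 2 * n + 1 := by rw [h1]; ring
      exact_mod_cast this
    lia
  exact le_antisymm (not_lt.1 (key y hy x hx)) (not_lt.1 (key x hx y hy))

/-- The two sides of an edge of a closed polygon lie, near a point of the edge, in different
components of the complement of the polygon. -/
theorem exists_ball_separated {v : ℕ → ℝ × ℝ} {r s : ℕ} (hrs : r ≤ s) (hne : v s ≠ v r)
    {z : ℝ × ℝ} (hz : z ∈ openSegment ℝ (v s) (v r)) (hzv : z ∉ polyArc v r s) :
    ∃ δ > 0, ∀ x ∈ ball z δ, ∀ y ∈ ball z δ,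
      0 < planeCross (v r - v s) (x - v s) → planeCross (v r - v s) (y - v s) < 0 →
      ∀ S, IsPreconnected S → S ⊆ (polyArc v r s ∪ segment ℝ (v s) (v r))ᶜ → x ∈ S → y ∉ S := by
  obtain ⟨h1, h2⟩ := tendsto_viewAngle_of_mem_openSegment hne hz
  have hF := continuousAt_sum_viewAngle hzv
  set F := fun x => ∑ k ∈ Finset.Ico r s, viewAngle (v k) (v (k + 1)) x
  have h1' := (hF.tendsto.mono_left nhdsWithin_le_nhds).add h1
  have h2' := (hF.tendsto.mono_left nhdsWithin_le_nhds).add h2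
  have hpi := Real.pi_pos
  have e1 := h1'.eventually (lt_mem_nhds (show F z < F z + Real.pi by linarith))
  have e2 := h2'.eventually (gt_mem_nhds (show F z + -Real.pi < F z by linarith))
  rw [eventually_nhdsWithin_iff] at e1 e2
  obtain ⟨δ, hδ, hb⟩ := Metric.eventually_nhds_iff_ball.1 (e1.and e2)
  refine ⟨δ, hδ, fun x hx y hy hpx hpy S hS hSd hxS hyS => ?_⟩
  have := sweptAngle_eq_of_isPreconnected hrs hS hSd hxS hyS
  have h3 := (hb x hx).1 hpx
  have h4 := (hb y hy).2 hpy
  simp only [sweptAngle] at this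
  linarith

theorem planeCross_eq_zero_of_mem_segment {p q x : ℝ × ℝ} (hx : x ∈ segment ℝ p q) :
    planeCross (q - p) (x - p) = 0 := by
  rw [segment_eq_image'] at hx
  obtain ⟨t, -, rfl⟩ := hx
  simp [planeCross]
  ring

theorem planeCross_ne_zero_of_notMem_segment {p q z x : ℝ × ℝ} {η : ℝ} (hpq : p ≠ q)
    (hz : z ∈ openSegment ℝ p q) (hx : x ∈ ball z η) (hp : η ≤ dist p z) (hq : η ≤ dist q z)
    (hxd : x ∉ segment ℝ p q) : planeCross (q - p) (x - p) ≠ 0 := by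
  have hzs : z ∈ segment ℝ p q := openSegment_subset_segment ℝ _ _ hz
  rw [openSegment_eq_image'] at hz
  obtain ⟨t, ⟨ht0, ht1⟩, hzt⟩ := hz
  intro h0
  obtain ⟨c, hc⟩ : ∃ c : ℝ, x = z + c • (q - p) := by
    simp only [planeCross, Prod.fst_sub, Prod.snd_sub] at h0
    have : q.1 - p.1 ≠ 0 ∨ q.2 - p.2 ≠ 0 := by
      by_contra! h
      exact hpq (Prod.ext (by linarith) (by linarith))
    have e1 : z.1 = p.1 + t * (q.1 - p.1) := by rw [← hzt]; simp
    have e2 : z.2 = p.2 + t * (q.2 - p.2) := by rw [← hzt]; simp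
    rcases this with h | h
    · refine ⟨(x.1 - z.1) / (q.1 - p.1), Prod.ext ?_ ?_⟩
      · simp [h]
      · simp only [Prod.snd_add, Prod.smul_snd, Prod.snd_sub, smul_eq_mul]
        field_simp
        rw [e1, e2]
        linarith
    · refine ⟨(x.2 - z.2) / (q.2 - p.2), Prod.ext ?_ ?_⟩
      · simp only [Prod.fst_add, Prod.smul_fst, Prod.fst_sub, smul_eq_mul]
        field_simp
        rw [e1, e2]
        linarith
      · simp [h]
  have hsub := fun a ha => (convex_segment (𝕜 := ℝ) p q).segment_subset hzs (y := a) ha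
  rcases le_or_gt 0 c with h | h
  · have : x = z + (c / (1 - t)) • (q - z) := by
      have h1 : q - z = (1 - t) • (q - p) := by rw [← hzt]; module
      rw [hc, h1, smul_smul, div_mul_cancel₀ _ (by linarith)]
    rw [this] at hx hxd
    exact hxd (hsub q (right_mem_segment ℝ _ _)
      (mem_segment_of_ray hq (div_nonneg h (by linarith)) hx))
  · have : x = z + (-c / t) • (p - z) := by
      have h1 : p - z = t • (p - q) := by rw [← hzt]; module
      rw [hc, h1, smul_smul, div_mul_cancel₀ _ ht0.ne']
      module
    rw [this] at hx hxd
    exact hxd (hsub p (left_mem_segment ℝ _ _)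
      (mem_segment_of_ray hp (div_nonneg (by linarith) ht0.le) hx))

theorem exists_mem_ball_planeCross {p q z : ℝ × ℝ} {η : ℝ} (hpq : p ≠ q)
    (hz : z ∈ openSegment ℝ p q) (hη : 0 < η) :
    (∃ a ∈ ball z η, 0 < planeCross (q - p) (a - p)) ∧
      ∃ b ∈ ball z η, planeCross (q - p) (b - p) < 0 := by
  have h0 := planeCross_eq_zero_of_mem_segment (openSegment_subset_segment ℝ _ _ hz)
  have hpos : 0 < (q.1 - p.1) ^ 2 + (q.2 - p.2) ^ 2 := by
    have : q.1 - p.1 ≠ 0 ∨ q.2 - p.2 ≠ 0 := by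
      by_contra! h
      exact hpq (Prod.ext (by linarith) (by linarith))
    rcases this with h | h <;> positivity
  set n : ℝ × ℝ := (-(q.2 - p.2), q.1 - p.1) with hn
  have key : ∀ ε : ℝ, planeCross (q - p) (z + ε • n - p) =
      ε * ((q.1 - p.1) ^ 2 + (q.2 - p.2) ^ 2) := by
    intro ε
    rw [← add_zero (ε * _), ← h0]
    simp [planeCross, hn]
    ring
  have hcont : Tendsto (fun ε : ℝ => z + ε • n) (𝓝 0) (𝓝 z) := by
    have : Continuous fun ε : ℝ => z + ε • n := by fun_prop
    simpa using this.tendsto 0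
  obtain ⟨ε, hε, hb⟩ := Metric.eventually_nhds_iff_ball.1
    (hcont.eventually (isOpen_ball.mem_nhds (mem_ball_self hη)))
  refine ⟨⟨z + (ε / 2) • n, hb _ ?_, ?_⟩, ⟨z + (-(ε / 2)) • n, hb _ ?_, ?_⟩⟩
  · rw [mem_ball_zero_iff, Real.norm_of_nonneg (by positivity)]; linarith
  · rw [key]; positivity
  · rw [mem_ball_zero_iff, norm_neg, Real.norm_of_nonneg (by positivity)]; linarith
  · rw [key]; nlinarith

/-- A connected set disjoint from a theta-shaped union of two arcs `A₁`, `A₂` and a chord, and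
adherent to all points of both arcs, is not adherent to any inner point of the chord. -/
theorem notMem_closure_of_theta {A₁ A₂ E : Set (ℝ × ℝ)} {p q z : ℝ × ℝ} {δ₁ δ₂ : ℝ}
    (hA₁ : IsClosed A₁) (hA₂ : IsClosed A₂) (hA : A₁ ∩ A₂ ⊆ segment ℝ p q)
    (hE : IsPreconnected E) (hEd : E ⊆ (A₁ ∪ A₂ ∪ segment ℝ p q)ᶜ)
    (hE₁ : A₁ ⊆ closure E) (hE₂ : A₂ ⊆ closure E) (hpq : p ≠ q) (hz : z ∈ openSegment ℝ p q)
    (hz₁ : z ∉ A₁) (hz₂ : z ∉ A₂) (hδ₁ : 0 < δ₁) (hδ₂ : 0 < δ₂)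
    (h₁ : ∀ x ∈ ball z δ₁, ∀ y ∈ ball z δ₁,
      0 < planeCross (q - p) (x - p) → planeCross (q - p) (y - p) < 0 →
      ∀ S, IsPreconnected S → S ⊆ (A₁ ∪ segment ℝ p q)ᶜ → x ∈ S → y ∉ S)
    (h₂ : ∀ x ∈ ball z δ₂, ∀ y ∈ ball z δ₂,
      0 < planeCross (q - p) (x - p) → planeCross (q - p) (y - p) < 0 →
      ∀ S, IsPreconnected S → S ⊆ (A₂ ∪ segment ℝ p q)ᶜ → x ∈ S → y ∉ S) :
    z ∉ closure E := by
  intro hzE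
  set d := segment ℝ p q with hd
  have hdc : IsClosed d := isClosed_segment_plane p q
  obtain ⟨ρ, hρ, hρA⟩ : ∃ ρ > 0, ball z ρ ⊆ (A₁ ∪ A₂)ᶜ :=
    Metric.isOpen_iff.1 (hA₁.union hA₂).isOpen_compl z (by simp [hz₁, hz₂])
  have hzp : z ≠ p := by rintro rfl; exact hpq (left_mem_openSegment_iff.1 hz)
  have hzq : z ≠ q := by rintro rfl; exact hpq (right_mem_openSegment_iff.1 hz)
  set η := min (min ρ (min δ₁ δ₂)) (min (dist p z) (dist q z)) with hη
  have hη0 : 0 < η := by simp [hη, hρ, hδ₁, hδ₂, dist_pos, hzp.symm, hzq.symm]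
  have hsep : ∃ x y : ℝ × ℝ, x ∈ E ∧ y ∈ (A₁ ∪ A₂ ∪ d)ᶜ ∧
      (∀ S, IsPreconnected S → S ⊆ (A₁ ∪ d)ᶜ → x ∈ S → y ∉ S) ∧
      (∀ S, IsPreconnected S → S ⊆ (A₂ ∪ d)ᶜ → x ∈ S → y ∉ S) := by
    obtain ⟨x, hxη, hx⟩ := mem_closure_iff.1 hzE _ isOpen_ball (mem_ball_self hη0)
    have hηρ : ball z η ⊆ ball z ρ := ball_subset_ball ((min_le_left _ _).trans (min_le_left _ _))
    have hη₁ : ball z η ⊆ ball z δ₁ :=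
      ball_subset_ball ((min_le_left _ _).trans ((min_le_right _ _).trans (min_le_left _ _)))
    have hη₂ : ball z η ⊆ ball z δ₂ :=
      ball_subset_ball ((min_le_left _ _).trans ((min_le_right _ _).trans (min_le_right _ _)))
    have hne : planeCross (q - p) (x - p) ≠ 0 :=
      planeCross_ne_zero_of_notMem_segment hpq hz hxη ((min_le_right _ _).trans (min_le_left _ _))
        ((min_le_right _ _).trans (min_le_right _ _)) fun h => hEd hx (Or.inr h)
    obtain ⟨⟨a, ha, hap⟩, ⟨b, hb, hbn⟩⟩ := exists_mem_ball_planeCross hpq hz hη0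
    have hmem : ∀ w ∈ ball z η, planeCross (q - p) (w - p) ≠ 0 → w ∈ (A₁ ∪ A₂ ∪ d)ᶜ := by
      rintro w hw h0 (h | h)
      · exact hρA (hηρ hw) h
      · exact h0 (planeCross_eq_zero_of_mem_segment h)
    rcases hne.lt_or_gt with h | h
    · exact ⟨x, a, hx, hmem a ha hap.ne',
        fun S hS hSd hxS haS => h₁ a (hη₁ ha) x (hη₁ hxη) hap h S hS hSd haS hxS,
        fun S hS hSd hxS haS => h₂ a (hη₂ ha) x (hη₂ hxη) hap h S hS hSd haS hxS⟩
    · exact ⟨x, b, hx, hmem b hb hbn.ne, h₁ x (hη₁ hxη) b (hη₁ hb) h hbn,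
        h₂ x (hη₂ hxη) b (hη₂ hb) h hbn⟩
  obtain ⟨x, y, hx, hy, hs₁, hs₂⟩ := hsep
  set θ := A₁ ∪ A₂ ∪ d with hθ
  have hBθ₁ : A₁ ∪ d ⊆ θ := union_subset_union_left d subset_union_left
  have hBθ₂ : A₂ ∪ d ⊆ θ := union_subset_union_left d subset_union_right
  have hθc : IsClosed θ := (hA₁.union hA₂).union hdc
  set K := connectedComponentIn θᶜ y with hK
  have hyK : y ∈ K := mem_connectedComponentIn hy
  have hKθ : K ⊆ θᶜ := connectedComponentIn_subset _ _
  have hKpre : IsPreconnected K := isPreconnected_connectedComponentIn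
  have join : ∀ {A B : Set (ℝ × ℝ)}, IsClosed B → A ⊆ closure E → B ⊆ θ → (∀ S, IsPreconnected S →
      S ⊆ Bᶜ → x ∈ S → y ∉ S) → ∀ w ∈ closure K, w ∈ A → w ∈ B := by
    intro A B hB hAE hBθ hs w hwK hwA
    by_contra hwB
    obtain ⟨ε, hε, hεB⟩ := Metric.isOpen_iff.1 hB.isOpen_compl w hwB
    obtain ⟨e, he⟩ := mem_closure_iff.1 (hAE hwA) _ isOpen_ball (mem_ball_self hε)
    obtain ⟨k, hk⟩ := mem_closure_iff.1 hwK _ isOpen_ball (mem_ball_self hε)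
    have hbp : IsPreconnected (ball w ε) := (convex_ball w ε).isPreconnected
    refine hs (E ∪ ball w ε ∪ K) ((hE.union e he.2 he.1 hbp).union k (Or.inr hk.1) hk.2 hKpre)
      (union_subset (union_subset ?_ hεB) ?_) (Or.inl (Or.inl hx)) (Or.inr hyK)
    · exact hEd.trans (compl_subset_compl.2 hBθ)
    · exact hKθ.trans (compl_subset_compl.2 hBθ)
  have hsub : dᶜ ⊆ K := by
    refine (isPreconnected_compl_segment p q).subset_of_closure_inter_subset
      hθc.isOpen_compl.connectedComponentIn
      ⟨y, fun h => hy (Or.inr h), hyK⟩ ?_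
    rintro w ⟨hw, hwd⟩
    by_cases hwθ : w ∈ θ
    · exfalso
      rcases hwθ with (hw1 | hw2) | hwd'
      · rcases join (hA₂.union hdc) hE₁ hBθ₂ hs₂ w hw hw1 with h | h
        · exact hwd (hA ⟨hw1, h⟩)
        · exact hwd h
      · rcases join (hA₁.union hdc) hE₂ hBθ₁ hs₁ w hw hw2 with h | h
        · exact hwd (hA ⟨h, hw2⟩)
        · exact hwd h
      · exact hwd hwd'
    · exact mem_connectedComponentIn_of_mem_closure hwθ hw
  exact hs₁ K hKpre (hKθ.trans (compl_subset_compl.2 hBθ₁))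
    (hsub fun h => hEd hx (Or.inr h)) hyK

/-- The unbounded part of the complement of a bounded set is connected. -/
theorem exists_isPreconnected_compl {X : Set (ℝ × ℝ)} (hX : Bornology.IsBounded X) :
    ∃ W : Set (ℝ × ℝ), IsPreconnected W ∧ W ⊆ Xᶜ ∧ ¬ Bornology.IsBounded W ∧
      Bornology.IsBounded Wᶜ := by
  obtain ⟨r, hr⟩ := (isBounded_iff_subset_closedBall (0 : ℝ × ℝ)).1 hX
  have hb : Bornology.IsBounded (closedBall (0 : ℝ × ℝ) (max r 0)) := isBounded_closedBall
  refine ⟨(closedBall 0 (max r 0))ᶜ, isPreconnected_compl_of_starConvex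
    ((convex_closedBall 0 _).starConvex (mem_closedBall_self (le_max_right _ _))) hb, ?_, ?_, ?_⟩
  · exact compl_subset_compl.2 (hr.trans (closedBall_subset_closedBall (le_max_left _ _)))
  · intro h
    exact NormedSpace.unbounded_univ ℝ (ℝ × ℝ) (by simpa using hb.union h)
  · rwa [compl_compl]

theorem connectedComponentIn_eq_of_subset {X W : Set (ℝ × ℝ)} (hW : IsPreconnected W)
    (hWX : W ⊆ Xᶜ) (hWb : ¬ Bornology.IsBounded W) (hWc : Bornology.IsBounded Wᶜ) {w : ℝ × ℝ}
    (hw : w ∈ W) :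
    {x | x ∉ X ∧ ¬ Bornology.IsBounded (connectedComponentIn Xᶜ x)} =
      connectedComponentIn Xᶜ w := by
  have hsub : W ⊆ connectedComponentIn Xᶜ w := hW.subset_connectedComponentIn hw hWX
  ext x
  constructor
  · rintro ⟨hx, hxb⟩
    obtain ⟨y, hy, hyW⟩ : (W ∩ connectedComponentIn Xᶜ x).Nonempty := by
      by_contra h
      rw [not_nonempty_iff_eq_empty, ← disjoint_iff_inter_eq_empty] at h
      exact hxb (hWc.subset (subset_compl_iff_disjoint_left.2 h))
    rw [connectedComponentIn_eq (hsub hy), ← connectedComponentIn_eq hyW]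
    exact mem_connectedComponentIn hx
  · intro hx
    refine ⟨connectedComponentIn_subset _ _ hx, fun hb => hWb ?_⟩
    rw [← connectedComponentIn_eq hx] at hb
    exact hb.subset hsub

namespace PlaneGraph

variable {T : PlaneGraph} {h : ℕ} {u : ZMod h → ℝ × ℝ}

/-- The ordered pairs of adjacent vertices. -/
abbrev Dart (T : PlaneGraph) := {e : (ℝ × ℝ) × (ℝ × ℝ) // T.Adj e.1 e.2}

instance : Finite T.Dart :=
  Set.Finite.subset (s := ((T.verts ×ˢ T.verts : Finset _) : Set ((ℝ × ℝ) × (ℝ × ℝ))))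
    (Finset.finite_toSet _) fun e (he : T.Adj e.1 e.2) =>
      Finset.mem_coe.2 (Finset.mem_product.2 (T.mem_of_adj _ _ he))

theorem drawing_eq_iUnion : T.drawing = ⋃ e : T.Dart, segment ℝ e.1.1 e.1.2 := by
  ext x
  simp [drawing]

theorem isClosed_drawing : IsClosed T.drawing := by
  rw [drawing_eq_iUnion]
  exact isClosed_iUnion_of_finite fun e => isClosed_segment_plane _ _

theorem isBounded_drawing : Bornology.IsBounded T.drawing := by
  rw [drawing_eq_iUnion]
  refine Bornology.isBounded_iUnion.2 fun e => ?_
  rw [← convexHull_pair]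
  exact isBounded_convexHull.2 (toFinite _).isBounded

theorem segment_subset_drawing {p q : ℝ × ℝ} (hpq : T.Adj p q) : segment ℝ p q ⊆ T.drawing :=
  fun _ hx => ⟨p, q, hpq, hx⟩

theorem mem_drawing_of_mem_verts (hT : T.IsNearTriangulation) {p : ℝ × ℝ} (hp : p ∈ T.verts) :
    p ∈ T.drawing := by
  obtain ⟨-, ⟨hcard, hconn, -⟩, -⟩ := hT
  obtain ⟨q, hq, hqp⟩ := Finset.exists_mem_ne (by lia : 1 < T.verts.card) p
  rcases Relation.ReflTransGen.cases_head (hconn.2 p hp q hq) with h | ⟨r, hr, -⟩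
  · exact absurd h.symm hqp
  · exact segment_subset_drawing hr (left_mem_segment ℝ _ _)

theorem exists_outerRegion_eq : ∃ W : Set (ℝ × ℝ), IsPreconnected W ∧ W ⊆ T.drawingᶜ ∧
    ¬ Bornology.IsBounded W ∧ Bornology.IsBounded Wᶜ ∧
    ∀ w ∈ W, T.outerRegion = connectedComponentIn T.drawingᶜ w := by
  obtain ⟨W, hW, hWX, hWb, hWc⟩ := exists_isPreconnected_compl T.isBounded_drawing
  exact ⟨W, hW, hWX, hWb, hWc, fun w hw => connectedComponentIn_eq_of_subset hW hWX hWb hWc hw⟩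

theorem exists_outerRegion_eq_connectedComponentIn :
    ∃ w ∉ T.drawing, T.outerRegion = connectedComponentIn T.drawingᶜ w := by
  obtain ⟨W, hW, hWX, hWb, hWc, hE⟩ := T.exists_outerRegion_eq
  obtain ⟨w, hw⟩ : W.Nonempty :=
    nonempty_iff_ne_empty.2 fun h => hWb (h ▸ Bornology.isBounded_empty)
  exact ⟨w, hWX hw, hE w hw⟩

theorem isOpen_outerRegion : IsOpen T.outerRegion := by
  obtain ⟨w, -, hE⟩ := T.exists_outerRegion_eq_connectedComponentIn
  rw [hE]
  exact T.isClosed_drawing.isOpen_compl.connectedComponentIn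

theorem isPreconnected_outerRegion : IsPreconnected T.outerRegion := by
  obtain ⟨w, -, hE⟩ := T.exists_outerRegion_eq_connectedComponentIn
  rw [hE]
  exact isPreconnected_connectedComponentIn

theorem outerRegion_subset : T.outerRegion ⊆ T.drawingᶜ := fun _ hx => hx.1

theorem subset_outerRegion_of_inter {S : Set (ℝ × ℝ)} (hS : IsPreconnected S) (hSX : S ⊆ T.drawingᶜ)
    (hSE : (S ∩ T.outerRegion).Nonempty) : S ⊆ T.outerRegion := by
  obtain ⟨w, -, hE⟩ := T.exists_outerRegion_eq_connectedComponentIn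
  rw [hE] at hSE ⊢
  exact subset_connectedComponentIn_of_inter hS hSX hSE

theorem mem_drawing_of_mem_frontier {y : ℝ × ℝ} (hy : y ∈ frontier T.outerRegion) :
    y ∈ T.drawing := by
  by_contra hyX
  rw [T.isOpen_outerRegion.frontier_eq] at hy
  obtain ⟨w, -, hE⟩ := T.exists_outerRegion_eq_connectedComponentIn
  rw [hE] at hy
  exact hy.2 (mem_connectedComponentIn_of_mem_closure hyX hy.1)

theorem mem_frontier_outerRegion {y : ℝ × ℝ} (hy : y ∈ closure T.outerRegion)
    (hyX : y ∈ T.drawing) : y ∈ frontier T.outerRegion := by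
  rw [T.isOpen_outerRegion.frontier_eq]
  exact ⟨hy, fun h => h.1 hyX⟩

theorem eq_pair_of_mem_segments (hT : T.IsEmbedded) {p q r s x : ℝ × ℝ} (hpq : T.Adj p q)
    (hrs : T.Adj r s) (hx : x ∈ openSegment ℝ p q) (hx' : x ∈ segment ℝ r s) :
    ({p, q} : Set (ℝ × ℝ)) = {r, s} := by
  have hne : p ≠ q := by rintro rfl; exact T.loopless _ hpq
  refine (hT.1 p q r s hpq hrs x (openSegment_subset_segment ℝ _ _ hx) hx').resolve_right ?_
  rintro ⟨rfl | rfl, -⟩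
  · exact hne (left_mem_openSegment_iff.1 hx)
  · exact hne (right_mem_openSegment_iff.1 hx)

theorem segment_eq_of_pair_eq {p q r s : ℝ × ℝ} (h : ({p, q} : Set (ℝ × ℝ)) = {r, s}) :
    segment ℝ p q = segment ℝ r s := by
  rw [← convexHull_pair, ← convexHull_pair, h]

/-- Near an inner point of an edge, a union of edges containing that edge consists of two segments
leaving the point in opposite directions. -/
theorem exists_locally_two_segments_of_mem_openSegment {ι : Type*} [Finite ι] (hT : T.IsEmbedded)
    {f g : ι → ℝ × ℝ} (hfg : ∀ i, T.Adj (f i) (g i)) (i : ι) {z : ℝ × ℝ}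
    (hz : z ∈ openSegment ℝ (f i) (g i)) :
    ∃ a b, ∃ r > 0, ¬ SameRay ℝ (a - z) (b - z) ∧
      (⋃ j, segment ℝ (f j) (g j)) ∩ ball z r = (segment ℝ z a ∪ segment ℝ z b) ∩ ball z r := by
  have hne : f i ≠ g i := fun h => T.loopless _ (h ▸ hfg i)
  obtain ⟨r, hr, hd⟩ := exists_ball_disjoint (fun j => segment ℝ (f j) (g j))
    (fun j => isClosed_segment_plane _ _) z
  refine ⟨f i, g i, r, hr, not_sameRay_of_mem_openSegment hne hz, ?_⟩
  have hzs := openSegment_subset_segment ℝ _ _ hz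
  have hun : segment ℝ z (f i) ∪ segment ℝ z (g i) = segment ℝ (f i) (g i) := by
    refine subset_antisymm (union_subset
      ((convex_segment _ _).segment_subset hzs (left_mem_segment ℝ _ _))
      ((convex_segment _ _).segment_subset hzs (right_mem_segment ℝ _ _))) ?_
    have hr : z ∈ range (AffineMap.lineMap (f i) (g i) : ℝ → ℝ × ℝ) := by
      rw [segment_eq_image_lineMap] at hzs
      exact image_subset_range _ _ hzs
    rw [← insert_endpoints_openSegment]
    refine insert_subset (Or.inl (right_mem_segment ℝ _ _))
      (insert_subset (Or.inr (right_mem_segment ℝ _ _)) ?_)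
    refine (openSegment_subset_union _ _ hr).trans (insert_subset
      (Or.inl (left_mem_segment ℝ _ _)) (union_subset_union ?_ (openSegment_subset_segment ℝ _ _)))
    rw [openSegment_symm]
    exact openSegment_subset_segment ℝ _ _
  rw [hun]
  ext x
  constructor
  · rintro ⟨hx, hxb⟩
    obtain ⟨j, hj⟩ := mem_iUnion.1 hx
    refine ⟨?_, hxb⟩
    by_cases hzj : z ∈ segment ℝ (f j) (g j)
    · rwa [segment_eq_of_pair_eq (eq_pair_of_mem_segments hT (hfg i) (hfg j) hz hzj)]
    · exact absurd hj (disjoint_left.1 (hd j hzj) hxb)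
  · exact fun hx => ⟨mem_iUnion.2 ⟨i, hx.1⟩, hx.2⟩

theorem mem_frontier_of_mem_openSegment (hT : T.IsEmbedded) {p q y z : ℝ × ℝ} (hpq : T.Adj p q)
    (hy : y ∈ openSegment ℝ p q) (hyE : y ∈ closure T.outerRegion) (hz : z ∈ segment ℝ p q) :
    z ∈ frontier T.outerRegion := by
  refine mem_frontier_outerRegion ?_ (segment_subset_drawing hpq hz)
  have hop : openSegment ℝ p q ⊆ closure T.outerRegion := fun w hw =>
    closure_of_locally_two_segments (X := T.drawing) (convex_openSegment p q).isPreconnected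
      ((openSegment_subset_segment ℝ _ _).trans (segment_subset_drawing hpq)) outerRegion_subset
      (fun S => subset_outerRegion_of_inter) (fun z hz => by
        rw [drawing_eq_iUnion]
        exact exists_locally_two_segments_of_mem_openSegment hT (f := fun e : T.Dart => e.1.1)
          (g := fun e => e.1.2) (fun e => e.2) ⟨(p, q), hpq⟩ hz) hy hw hyE
  have := closure_mono hop
  rw [closure_closure, closure_openSegment] at this
  exact this hz

end PlaneGraph

theorem ZMod.natCast_eq_of_le {h a b : ℕ} (hab : a ≤ b) (hb : b ≤ h)
    (e : (a : ZMod h) = b) : a = b ∨ a = 0 ∧ b = h := by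
  rw [ZMod.natCast_eq_natCast_iff, Nat.modEq_iff_dvd' hab] at e
  obtain ⟨k, hk⟩ := e
  rcases Nat.lt_or_ge k 1 with hk0 | hk1
  · obtain rfl : k = 0 := by lia
    left; lia
  · have : h * 1 ≤ h * k := Nat.mul_le_mul_left h hk1
    right; lia

theorem ZMod.add_one_ne_sub_one {h : ℕ} (h3 : 3 ≤ h) (i : ZMod h) : i + 1 ≠ i - 1 := by
  intro e
  have : ((2 : ℕ) : ZMod h) = (0 : ℕ) := by push_cast; linear_combination e
  rcases ZMod.natCast_eq_of_le (Nat.zero_le 2) (by lia : 2 ≤ h) this.symm with h1 | h1 <;> lia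

namespace PlaneGraph

variable {T : PlaneGraph} {h : ℕ} {u : ZMod h → ℝ × ℝ}

theorem isClosed_boundaryDrawing [NeZero h] : IsClosed (boundaryDrawing u) :=
  isClosed_iUnion_of_finite fun _ => isClosed_segment_plane _ _

theorem boundaryDrawing_subset_drawing (hu : T.IsBoundaryCycle u) :
    boundaryDrawing u ⊆ T.drawing :=
  iUnion_subset fun i => segment_subset_drawing (hu.2.2.2.1 i)

theorem boundaryDrawing_subset_closure (hu : T.IsBoundaryCycle u) :
    boundaryDrawing u ⊆ closure T.outerRegion :=
  iUnion_subset fun i => (hu.2.2.2.2.1 i).trans frontier_subset_closure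

theorem mem_boundaryDrawing (i : ZMod h) : u i ∈ boundaryDrawing u :=
  mem_iUnion.2 ⟨i, left_mem_segment ℝ _ _⟩

/-- The boundary cycle as a polygonal arc based at the vertex `u i`. -/
theorem boundaryDrawing_eq_polyArc [NeZero h] (i : ZMod h) :
    boundaryDrawing u = polyArc (fun k : ℕ => u (i + k)) 0 h := by
  ext x
  rw [mem_polyArc, boundaryDrawing, mem_iUnion]
  constructor
  · rintro ⟨j, hj⟩
    refine ⟨(j - i).val, Nat.zero_le _, ZMod.val_lt _, ?_⟩
    simpa [← add_assoc] using hj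
  · rintro ⟨k, -, -, hk⟩
    exact ⟨i + k, by simpa [add_assoc] using hk⟩

theorem polyArc_union (v : ℕ → ℝ × ℝ) {r m s : ℕ} (hrm : r ≤ m) (hms : m ≤ s) :
    polyArc v r s = polyArc v r m ∪ polyArc v m s := by
  ext x
  simp only [mem_polyArc, mem_union]
  constructor
  · rintro ⟨k, h1, h2, h3⟩
    rcases lt_or_ge k m with hk | hk
    · exact Or.inl ⟨k, h1, hk, h3⟩
    · exact Or.inr ⟨k, hk, h2, h3⟩
  · rintro (⟨k, h1, h2, h3⟩ | ⟨k, h1, h2, h3⟩)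
    · exact ⟨k, h1, by lia, h3⟩
    · exact ⟨k, by lia, h2, h3⟩

/-- Two complementary arcs of the boundary cycle meet only in their end points. -/
theorem eq_or_eq_of_mem_polyArcs (hT : T.IsEmbedded) (hu : T.IsBoundaryCycle u) (i : ZMod h) {m : ℕ}
    (hm : m ≤ h) {x : ℝ × ℝ} (h₁ : x ∈ polyArc (fun k : ℕ => u (i + k)) 0 m)
    (h₂ : x ∈ polyArc (fun k : ℕ => u (i + k)) m h) : x = u i ∨ x = u (i + m) := by
  obtain ⟨h3, hinj, hv, hadj, -, -⟩ := hu
  have hadj' : ∀ k : ℕ, T.Adj (u (i + k)) (u (i + (k + 1 : ℕ))) := fun k => by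
    have := hadj (i + k)
    rwa [add_assoc, ← Nat.cast_add_one] at this
  have hcast : ∀ a b : ℕ, a ≤ b → b ≤ h → u (i + a) = u (i + b) → a = b ∨ a = 0 ∧ b = h :=
    fun a b hab hb e => ZMod.natCast_eq_of_le hab hb (add_left_cancel (hinj e))
  rw [mem_polyArc] at h₁ h₂
  obtain ⟨k, -, hk, hxk⟩ := h₁
  obtain ⟨l, hl, hlh, hxl⟩ := h₂
  have key : ∀ a b : ℕ, a ≤ m → m ≤ b → b ≤ h → x = u (i + a) → x = u (i + b) →
      x = u i ∨ x = u (i + m) := by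
    intro a b ha hb hbh hxa hxb
    rcases hcast a b (ha.trans hb) hbh (hxa.symm.trans hxb) with rfl | ⟨rfl, rfl⟩
    · obtain rfl : a = m := le_antisymm ha hb
      exact Or.inr hxa
    · exact Or.inl (by simpa using hxa)
  rcases hT.1 _ _ _ _ (hadj' k) (hadj' l) x hxk hxl with e | ⟨hx1, hx2⟩
  · exfalso
    have e1 : u (i + k) ∈ ({u (i + l), u (i + (l + 1 : ℕ))} : Set (ℝ × ℝ)) := e ▸ mem_insert _ _
    have e2 : u (i + (k + 1 : ℕ)) ∈ ({u (i + l), u (i + (l + 1 : ℕ))} : Set (ℝ × ℝ)) :=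
      e ▸ mem_insert_of_mem _ rfl
    rcases e1 with e1 | e1 <;> rcases e2 with e2 | e2 <;>
      have := hcast _ _ (by lia) (by lia) e1 <;> have := hcast _ _ (by lia) (by lia) e2 <;> lia
  · rcases hx1 with hx1 | hx1 <;> rcases hx2 with hx2 | hx2 <;>
      exact key _ _ (by lia) (by lia) (by lia) hx1 hx2

/-- The frontier of the outer region is the boundary cycle. -/
theorem frontier_outerRegion_subset (hT : T.IsEmbedded) (hu : T.IsBoundaryCycle u) :
    frontier T.outerRegion ⊆ boundaryDrawing u := by
  intro y hy
  have hu' := hu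
  obtain ⟨h3, hinj, hv, hadj, -, hout⟩ := hu'
  have : NeZero h := ⟨by lia⟩
  by_contra hyP
  have hyv : y ∉ T.verts := by
    intro h
    obtain ⟨i, rfl⟩ := hout y h hy
    exact hyP (mem_boundaryDrawing i)
  obtain ⟨p, q, hpq, hyd⟩ := mem_drawing_of_mem_frontier hy
  have hne : p ≠ q := by rintro rfl; exact T.loopless _ hpq
  obtain ⟨hpv, hqv⟩ := T.mem_of_adj _ _ hpq
  have hyo : y ∈ openSegment ℝ p q := by
    refine mem_openSegment_of_ne_left_right ?_ ?_ hyd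
    · rintro rfl; exact hyv hpv
    · rintro rfl; exact hyv hqv
  have hyE := frontier_subset_closure hy
  obtain ⟨i, rfl⟩ := hout p hpv
    (mem_frontier_of_mem_openSegment hT hpq hyo hyE (left_mem_segment ℝ _ _))
  obtain ⟨j, rfl⟩ := hout q hqv
    (mem_frontier_of_mem_openSegment hT hpq hyo hyE (right_mem_segment ℝ _ _))
  set v : ℕ → ℝ × ℝ := fun k => u (i + k) with hvdef
  set m := (j - i).val with hm
  have hmh : m ≤ h := (ZMod.val_lt _).le
  have hv0 : v 0 = u i := by simp [hvdef]
  have hvm : v m = u j := by simp [hvdef, hm]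
  have hvh : v h = u i := by simp [hvdef]
  have hP : boundaryDrawing u = polyArc v 0 m ∪ polyArc v m h := by
    rw [boundaryDrawing_eq_polyArc i, polyArc_union v (Nat.zero_le m) hmh]
  have hy₁ : y ∉ polyArc v 0 m := fun h => hyP (hP ▸ Or.inl h)
  have hy₂ : y ∉ polyArc v m h := fun h => hyP (hP ▸ Or.inr h)
  obtain ⟨δ₁, hδ₁, hs₁⟩ := exists_ball_separated (v := v) (r := 0) (s := m) (z := y) (Nat.zero_le m)
    (by rw [hv0, hvm]; exact hne.symm) (by rwa [hv0, hvm, openSegment_symm]) hy₁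
  obtain ⟨δ₂, hδ₂, hs₂⟩ := exists_ball_separated (v := v) (r := m) (s := h) (z := y) hmh
    (by rw [hvh, hvm]; exact hne) (by rwa [hvh, hvm]) hy₂
  rw [hv0, hvm] at hs₁
  rw [hvh, hvm] at hs₂
  have hcross : ∀ x : ℝ × ℝ,
      planeCross (u j - u i) (x - u i) = - planeCross (u i - u j) (x - u j) := by
    intro x; simp [planeCross]; ring
  rw [segment_symm] at hs₁
  have hPE := boundaryDrawing_subset_closure hu
  refine notMem_closure_of_theta (isClosed_polyArc v 0 m) (isClosed_polyArc v m h) ?_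
    T.isPreconnected_outerRegion ?_ ?_ ?_ hne hyo hy₁ hy₂ hδ₁ hδ₂ ?_ hs₂ hyE
  · rintro x ⟨hx₁, hx₂⟩
    rcases eq_or_eq_of_mem_polyArcs hT hu i hmh hx₁ hx₂ with rfl | hx
    · exact left_mem_segment ℝ _ _
    · rw [hx, show u (i + m) = u j from hvm]
      exact right_mem_segment ℝ _ _
  · rw [← hP]
    refine outerRegion_subset.trans (compl_subset_compl.2 (union_subset
      (boundaryDrawing_subset_drawing hu) (segment_subset_drawing hpq)))
  · exact (hP ▸ subset_union_left).trans hPE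
  · exact (hP ▸ subset_union_right).trans hPE
  · intro a ha b hb hpa hpb S hS hSd haS hbS
    rw [hcross] at hpa hpb
    exact hs₁ b hb a ha (by linarith) (by linarith) S hS hSd hbS haS

end PlaneGraph

theorem mem_segment_or_mem_segment_of_sameRay {a b z : ℝ × ℝ} (h : SameRay ℝ (a - z) (b - z)) :
    a ∈ segment ℝ z b ∨ b ∈ segment ℝ z a := by
  rcases eq_or_ne a z with rfl | hne
  · exact Or.inl (left_mem_segment ℝ _ _)
  obtain ⟨r, hr, he⟩ := h.exists_nonneg_left (sub_ne_zero.2 hne)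
  simp only [segment_eq_image']
  rcases le_or_gt r 1 with h1 | h1
  · exact Or.inr ⟨r, ⟨hr, h1⟩, by simp [he]⟩
  · refine Or.inl ⟨r⁻¹, ⟨inv_nonneg.2 hr, inv_le_one_of_one_le₀ h1.le⟩, ?_⟩
    simp [← he, smul_smul, inv_mul_cancel₀ (by linarith : r ≠ 0)]

theorem connectedComponentIn_mem_of_mem_frontier {F : Set (ℝ × ℝ)} (hF : IsOpen F) {x w : ℝ × ℝ}
    (hw : w ∈ frontier (connectedComponentIn F x)) : w ∉ F := by
  intro h
  rw [hF.connectedComponentIn.frontier_eq] at hw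
  exact hw.2 (mem_connectedComponentIn_of_mem_closure h hw.1)

namespace PlaneGraph

variable {T : PlaneGraph} {h : ℕ} {u : ZMod h → ℝ × ℝ}

theorem boundaryDrawing_locally_two_segments (hT : T.IsEmbedded) (hu : T.IsBoundaryCycle u)
    {z : ℝ × ℝ} (hz : z ∈ boundaryDrawing u) :
    ∃ a b, ∃ r > 0, ¬ SameRay ℝ (a - z) (b - z) ∧
      boundaryDrawing u ∩ ball z r = (segment ℝ z a ∪ segment ℝ z b) ∩ ball z r := by
  obtain ⟨h3, hinj, hv, hadj, -, -⟩ := hu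
  have : NeZero h := ⟨by lia⟩
  have hadj' : ∀ k, T.Adj (u (k - 1)) (u k) := fun k => by simpa using hadj (k - 1)
  by_cases hzu : z ∈ range u
  · obtain ⟨k, rfl⟩ := hzu
    obtain ⟨r, hr, hd⟩ := exists_ball_disjoint (fun j => segment ℝ (u j) (u (j + 1)))
      (fun j => isClosed_segment_plane _ _) (u k)
    refine ⟨u (k + 1), u (k - 1), r, hr, fun hs => ?_, ?_⟩
    · have hne : u (k + 1) ≠ u (k - 1) := fun h => ZMod.add_one_ne_sub_one h3 k (hinj h)
      rcases mem_segment_or_mem_segment_of_sameRay hs with h | h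
      · rcases hT.2 _ _ _ (T.symm _ _ (hadj' k)) (hv _) h with h | h
        · have := hadj k
          rw [h] at this
          exact T.loopless _ this
        · exact hne h
      · rcases hT.2 _ _ _ (hadj k) (hv _) h with h | h
        · have := hadj' k
          rw [h] at this
          exact T.loopless _ this
        · exact hne h.symm
    · ext x
      constructor
      · rintro ⟨hx, hxb⟩
        refine ⟨?_, hxb⟩
        obtain ⟨j, hj⟩ := mem_iUnion.1 hx
        by_cases hk : u k ∈ segment ℝ (u j) (u (j + 1))
        · rcases hT.2 _ _ _ (hadj j) (hv k) hk with h | h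
          · obtain rfl := hinj h
            exact Or.inl hj
          · obtain rfl := hinj h
            rw [add_sub_cancel_right, segment_symm ℝ (u (j + 1)) (u j)]
            exact Or.inr hj
        · exact absurd hj (disjoint_left.1 (hd j hk) hxb)
      · rintro ⟨hx | hx, hxb⟩
        · exact ⟨mem_iUnion.2 ⟨k, hx⟩, hxb⟩
        · refine ⟨mem_iUnion.2 ⟨k - 1, ?_⟩, hxb⟩
          rwa [sub_add_cancel, segment_symm]
  · obtain ⟨k, hk⟩ := mem_iUnion.1 hz
    refine exists_locally_two_segments_of_mem_openSegment hT (f := u) (g := fun k => u (k + 1))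
      hadj k
      (mem_openSegment_of_ne_left_right ?_ ?_ hk)
    · rintro rfl; exact hzu ⟨_, rfl⟩
    · rintro rfl; exact hzu ⟨_, rfl⟩

theorem isPreconnected_boundaryDrawing [NeZero h] : IsPreconnected (boundaryDrawing u) := by
  have : boundaryDrawing u = ⋃ k : ℕ, segment ℝ (u k) (u (k + 1)) := by
    ext x
    simp only [boundaryDrawing, mem_iUnion]
    exact ⟨fun ⟨i, hi⟩ => ⟨i.val, by simpa using hi⟩, fun ⟨k, hk⟩ => ⟨k, hk⟩⟩
  rw [this]
  refine IsPreconnected.iUnion_of_chain (fun k => (convex_segment _ _).isPreconnected) fun k =>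
    ⟨u (k + 1), right_mem_segment ℝ _ _, ?_⟩
  rw [Nat.succ_eq_succ, Nat.succ_eq_add_one, Nat.cast_add_one]
  exact left_mem_segment ℝ _ _

theorem subset_outerRegion_of_inter_of_subset_compl (hT : T.IsEmbedded) (hu : T.IsBoundaryCycle u)
    {S : Set (ℝ × ℝ)} (hS : IsPreconnected S) (hSP : S ⊆ (boundaryDrawing u)ᶜ)
    (hSE : (S ∩ T.outerRegion).Nonempty) : S ⊆ T.outerRegion := by
  refine hS.subset_of_closure_inter_subset T.isOpen_outerRegion hSE ?_
  rintro x ⟨hx, hxS⟩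
  by_contra hxE
  refine hSP hxS (frontier_outerRegion_subset hT hu ?_)
  rw [T.isOpen_outerRegion.frontier_eq]
  exact ⟨hx, hxE⟩

theorem outerRegion_subset_compl_boundaryDrawing (hu : T.IsBoundaryCycle u) :
    T.outerRegion ⊆ (boundaryDrawing u)ᶜ :=
  outerRegion_subset.trans (compl_subset_compl.2 (boundaryDrawing_subset_drawing hu))

theorem polygonInterior_eq (hT : T.IsEmbedded) (hu : T.IsBoundaryCycle u) :
    polygonInterior u = (boundaryDrawing u)ᶜ \ T.outerRegion := by
  obtain ⟨W, hW, hWX, hWb, hWc, hE⟩ := T.exists_outerRegion_eq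
  have hWE : W ⊆ T.outerRegion := fun w hw => by
    rw [hE w hw]
    exact mem_connectedComponentIn (hWX hw)
  ext x
  refine and_congr_right fun hx => ⟨fun hb hxE => ?_, fun hxE => ?_⟩
  · have : T.outerRegion ⊆ connectedComponentIn (boundaryDrawing u)ᶜ x :=
      T.isPreconnected_outerRegion.subset_connectedComponentIn hxE
        (outerRegion_subset_compl_boundaryDrawing hu)
    exact hWb (hb.subset (hWE.trans this))
  · refine hWc.subset fun y hy hyW => hxE ?_
    exact subset_outerRegion_of_inter_of_subset_compl hT hu isPreconnected_connectedComponentIn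
      (connectedComponentIn_subset _ _) ⟨y, hy, hWE hyW⟩ (mem_connectedComponentIn hx)

theorem isOpen_polygonInterior (hT : T.IsEmbedded) (hu : T.IsBoundaryCycle u) :
    IsOpen (polygonInterior u) := by
  have : polygonInterior u = (closure T.outerRegion)ᶜ := by
    rw [polygonInterior_eq hT hu]
    ext x
    constructor
    · rintro ⟨hx, hxE⟩ hc
      exact hx (frontier_outerRegion_subset hT hu
        (by rw [T.isOpen_outerRegion.frontier_eq]; exact ⟨hc, hxE⟩))
    · exact fun hx => ⟨fun hP => hx (boundaryDrawing_subset_closure hu hP),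
        fun hE => hx (subset_closure hE)⟩
  rw [this]
  exact isClosed_closure.isOpen_compl

/-- The interior of the boundary cycle is connected. -/
theorem isPreconnected_polygonInterior (hT : T.IsEmbedded) (hu : T.IsBoundaryCycle u) :
    IsPreconnected (polygonInterior u) := by
  have : NeZero h := ⟨by have := hu.1; lia⟩
  have hPc : IsOpen (boundaryDrawing u)ᶜ := isClosed_boundaryDrawing.isOpen_compl
  have hz : u 0 ∈ boundaryDrawing u := mem_boundaryDrawing 0
  obtain ⟨a, b, r, hr, hab, hX⟩ := boundaryDrawing_locally_two_segments hT hu hz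
  obtain ⟨δ, hδ, S₁, S₂, hS, h₁, h₂, hcl⟩ := exists_ball_closure_connectedComponentIn hr hab hX
  obtain ⟨hz₁, hz₂⟩ := hcl _ ⟨mem_ball_self hδ, hz⟩
  have hadh : ∀ x ∈ polygonInterior u,
      u 0 ∈ closure (connectedComponentIn (boundaryDrawing u)ᶜ x) := by
    intro x hx
    obtain ⟨w, hw⟩ : (frontier (connectedComponentIn (boundaryDrawing u)ᶜ x)).Nonempty := by
      refine nonempty_frontier_iff.2 ⟨⟨x, mem_connectedComponentIn hx.1⟩, fun huniv => ?_⟩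
      exact NormedSpace.unbounded_univ ℝ (ℝ × ℝ) (huniv ▸ hx.2)
    exact closure_of_locally_two_segments isPreconnected_boundaryDrawing subset_rfl
      (connectedComponentIn_subset _ _)
      (fun S hS hSP hSK => subset_connectedComponentIn_of_inter hS hSP hSK)
      (fun z hz => boundaryDrawing_locally_two_segments hT hu hz)
      (not_not.1 (connectedComponentIn_mem_of_mem_frontier hPc hw)) hz (frontier_subset_closure hw)
  have hsub : S₁ ∪ S₂ ⊆ (boundaryDrawing u)ᶜ := hS ▸ fun v hv => hv.2
  have hmeet : ∀ K ⊆ (boundaryDrawing u)ᶜ, u 0 ∈ closure K →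
      (S₁ ∩ K).Nonempty ∨ (S₂ ∩ K).Nonempty := by
    intro K hK hzK
    obtain ⟨w, hwb, hwK⟩ := mem_closure_iff.1 hzK _ isOpen_ball (mem_ball_self hδ)
    rcases (hS ▸ ⟨hwb, hK hwK⟩ : w ∈ S₁ ∪ S₂) with hw | hw
    · exact Or.inl ⟨w, hw, hwK⟩
    · exact Or.inr ⟨w, hw, hwK⟩
  have hdisj : ∀ x ∈ polygonInterior u,
      connectedComponentIn (boundaryDrawing u)ᶜ x ⊆ polygonInterior u := by
    intro x hx y hy
    refine ⟨connectedComponentIn_subset _ _ hy, ?_⟩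
    rw [← connectedComponentIn_eq hy]
    exact hx.2
  have key : ∀ S S' : Set (ℝ × ℝ), IsPreconnected S → IsPreconnected S' →
      S ⊆ (boundaryDrawing u)ᶜ → S' ⊆ (boundaryDrawing u)ᶜ → S'.Nonempty →
      (∀ K ⊆ (boundaryDrawing u)ᶜ, u 0 ∈ closure K → (S ∩ K).Nonempty ∨ (S' ∩ K).Nonempty) →
      (S ∩ T.outerRegion).Nonempty → IsPreconnected (polygonInterior u) := by
    intro S S' hSc hSc' hSP hSP' ⟨y, hy⟩ hm hSE
    have hSE := subset_outerRegion_of_inter_of_subset_compl hT hu hSc hSP hSE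
    refine isPreconnected_of_forall y fun x hx => ⟨_, hdisj x hx, ?_,
      mem_connectedComponentIn hx.1, isPreconnected_connectedComponentIn⟩
    rcases hm _ (connectedComponentIn_subset _ _) (hadh x hx) with ⟨w, hwS, hwK⟩ | hK
    · have := hdisj x hx hwK
      rw [polygonInterior_eq hT hu] at this
      exact absurd (hSE hwS) this.2
    · exact subset_connectedComponentIn_of_inter hSc' hSP' hK hy
  rcases hmeet T.outerRegion (outerRegion_subset_compl_boundaryDrawing hu)
    (boundaryDrawing_subset_closure hu hz) with hE | hE
  · exact key S₁ S₂ h₁ h₂ (subset_union_left.trans hsub) (subset_union_right.trans hsub)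
      (closure_nonempty_iff.1 ⟨_, hz₂⟩) hmeet hE
  · exact key S₂ S₁ h₂ h₁ (subset_union_right.trans hsub) (subset_union_left.trans hsub)
      (closure_nonempty_iff.1 ⟨_, hz₁⟩) (fun K hK hzK => (hmeet K hK hzK).symm) hE

theorem mem_polygonInterior_of_mem_drawing (hT : T.IsEmbedded) (hu : T.IsBoundaryCycle u)
    {x : ℝ × ℝ} (hx : x ∈ T.drawing) (hxP : x ∉ boundaryDrawing u) : x ∈ polygonInterior u := by
  rw [polygonInterior_eq hT hu]
  exact ⟨hxP, fun h => h.1 hx⟩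

theorem IsInteriorVtx.notMem_segment (hT : T.IsEmbedded) {w : ℝ × ℝ} (hw : T.IsInteriorVtx u w)
    {i j : ZMod h} (hij : T.Adj (u i) (u j)) : w ∉ segment ℝ (u i) (u j) := by
  intro h
  rcases hT.2 _ _ _ hij hw.1 h with rfl | rfl <;> exact hw.2 ⟨_, rfl⟩

theorem IsInteriorVtx.mem_polygonInterior (hT : T.IsNearTriangulation) (hu : T.IsBoundaryCycle u)
    {w : ℝ × ℝ} (hw : T.IsInteriorVtx u w) : w ∈ polygonInterior u := by
  refine mem_polygonInterior_of_mem_drawing hT.1 hu (mem_drawing_of_mem_verts hT hw.1) fun h => ?_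
  obtain ⟨i, hi⟩ := mem_iUnion.1 h
  exact hw.notMem_segment hT.1 (hu.2.2.2.1 i) hi

/-- The indices `i`, `j` of the endpoints of a diagonal. -/
def IsDiagonal (T : PlaneGraph) (u : ZMod h → ℝ × ℝ) (i j : ZMod h) : Prop :=
  T.Adj (u i) (u j) ∧ j ≠ i + 1 ∧ i ≠ j + 1

theorem IsDiagonal.segment_subset {i j : ZMod h} (hd : T.IsDiagonal u i j) :
    segment ℝ (u i) (u j) ⊆ T.diagonalDrawing u :=
  fun _ hx => ⟨i, j, hd.1, hd.2.1, hd.2.2, hx⟩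

theorem IsDiagonal.openSegment_subset (hT : T.IsEmbedded) (hu : T.IsBoundaryCycle u)
    {i j : ZMod h} (hd : T.IsDiagonal u i j) :
    openSegment ℝ (u i) (u j) ⊆ polygonInterior u := by
  intro x hx
  refine mem_polygonInterior_of_mem_drawing hT hu
    (segment_subset_drawing hd.1 (openSegment_subset_segment ℝ _ _ hx)) fun hP => ?_
  obtain ⟨k, hk⟩ := mem_iUnion.1 hP
  have e := eq_pair_of_mem_segments hT hd.1 (hu.2.2.2.1 k) hx hk
  rcases pair_eq_pair_iff.1 e with ⟨h1, h2⟩ | ⟨h1, h2⟩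
  · exact hd.2.1 (by rw [hu.2.1 h1, hu.2.1 h2])
  · exact hd.2.2 (by rw [hu.2.1 h1, hu.2.1 h2])

/-- Inside the boundary cycle, a diagonal is its open segment. -/
theorem mem_openSegment_of_mem_polygonInterior {i j : ZMod h} {x : ℝ × ℝ}
    (hx : x ∈ polygonInterior u) (hxd : x ∈ segment ℝ (u i) (u j)) :
    x ∈ openSegment ℝ (u i) (u j) := by
  refine mem_openSegment_of_ne_left_right ?_ ?_ hxd
  · rintro rfl; exact hx.1 (mem_boundaryDrawing i)
  · rintro rfl; exact hx.1 (mem_boundaryDrawing j)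

theorem openSegment_subset_frontier_of_isSideOf {R : Set (ℝ × ℝ)} (hT : T.IsEmbedded)
    (hu : T.IsBoundaryCycle u) {i j : ZMod h} (hs : T.IsSideOf u R i j) :
    openSegment ℝ (u i) (u j) ⊆ frontier R := by
  refine fun x hx => hs.2.2.2 ⟨openSegment_subset_segment ℝ _ _ hx, fun h => ?_⟩
  have := (IsDiagonal.openSegment_subset hT hu ⟨hs.1, hs.2.1, hs.2.2.1⟩ hx).1
  rcases h with rfl | rfl <;> exact this (mem_boundaryDrawing _)

/-- The parts, cut off by single diagonals, that contain interior vertices. -/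
def cutParts (T : PlaneGraph) (u : ZMod h → ℝ × ℝ) : Set (Set (ℝ × ℝ)) :=
  {B | ∃ i j w, T.IsDiagonal u i j ∧ T.IsInteriorVtx u w ∧
    B = connectedComponentIn (polygonInterior u \ segment ℝ (u i) (u j)) w}

theorem finite_cutParts [NeZero h] : (T.cutParts u).Finite := by
  refine ((Set.finite_univ (α := ZMod h × ZMod h)).prod T.verts.finite_toSet |>.image
    fun e => connectedComponentIn
      (polygonInterior u \ segment ℝ (u e.1.1) (u e.1.2)) e.2).subset ?_
  rintro B ⟨i, j, w, -, hw, rfl⟩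
  exact ⟨((i, j), w), ⟨mem_univ _, hw.1⟩, rfl⟩

/-- A region inside a minimal part cut off by a diagonal has no other side with interior vertices on
the opposite side. -/
theorem pair_eq_of_oppositeSideOf (hT : T.IsNearTriangulation) (hu : T.IsBoundaryCycle u)
    {i j k l : ZMod h} {w w' : ℝ × ℝ} (hd : T.IsDiagonal u i j) (hw : T.IsInteriorVtx u w)
    (hmin : ∀ B ∈ T.cutParts u,
      B ⊆ connectedComponentIn (polygonInterior u \ segment ℝ (u i) (u j)) w →
      connectedComponentIn (polygonInterior u \ segment ℝ (u i) (u j)) w ⊆ B)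
    (hs : T.IsSideOf u (connectedComponentIn (polygonInterior u \ T.diagonalDrawing u) w) k l)
    (hw' : T.IsInteriorVtx u w')
    (hopp : w' ∉ connectedComponentIn (polygonInterior u \ segment ℝ (u k) (u l)) w) :
    ({u k, u l} : Set (ℝ × ℝ)) = {u i, u j} := by
  by_contra hne
  have hE := hT.1
  have hd' : T.IsDiagonal u k l := ⟨hs.1, hs.2.1, hs.2.2.1⟩
  set Ω := polygonInterior u with hΩ
  have hopen : ∀ a b, IsOpen (Ω \ segment ℝ a b) := fun a b =>
    (isOpen_polygonInterior hE hu).sdiff (isClosed_segment_plane a b)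
  set B := connectedComponentIn (Ω \ segment ℝ (u i) (u j)) w with hB
  set A' := connectedComponentIn (Ω \ segment ℝ (u k) (u l)) w with hA'
  set C' := connectedComponentIn (Ω \ segment ℝ (u k) (u l)) w' with hC'
  have hwΩ : w ∈ Ω := hw.mem_polygonInterior hT hu
  have hw'C : w' ∈ C' := mem_connectedComponentIn
    ⟨hw'.mem_polygonInterior hT hu, hw'.notMem_segment hE hd'.1⟩
  have hwA : w ∈ A' := mem_connectedComponentIn ⟨hwΩ, hw.notMem_segment hE hd'.1⟩
  have hwB : w ∈ B := mem_connectedComponentIn ⟨hwΩ, hw.notMem_segment hE hd.1⟩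
  have hdisj : Disjoint A' C' := by
    refine disjoint_left.2 fun x hxA hxC => hopp ?_
    rw [hA', connectedComponentIn_eq hxA, ← connectedComponentIn_eq hxC]
    exact hw'C
  have hd'B : openSegment ℝ (u k) (u l) ⊆ B := by
    intro x hx
    refine mem_connectedComponentIn_of_mem_closure ⟨hd'.openSegment_subset hE hu hx, fun h =>
      hne (eq_pair_of_mem_segments hE hd'.1 hd.1 hx h)⟩ ?_
    refine closure_mono ?_ (frontier_subset_closure
      (openSegment_subset_frontier_of_isSideOf hE hu hs hx))
    exact connectedComponentIn_mono _ (sdiff_subset_sdiff_right hd.segment_subset)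
  have hsubB : ∀ S ⊆ Ω, IsPreconnected S → Disjoint S (openSegment ℝ (u i) (u j)) →
      (S ∩ B).Nonempty → S ⊆ B := fun S hSΩ hS hSd hSB =>
    subset_connectedComponentIn_of_inter hS (fun x hx => ⟨hSΩ hx, fun h =>
      disjoint_left.1 hSd hx (mem_openSegment_of_mem_polygonInterior (hSΩ hx) h)⟩) hSB
  have hAΩ : A' ⊆ Ω := (connectedComponentIn_subset _ _).trans sdiff_subset
  have hCΩ : C' ⊆ Ω := (connectedComponentIn_subset _ _).trans sdiff_subset
  by_cases hC : Disjoint C' (openSegment ℝ (u i) (u j))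
  · obtain ⟨f, ⟨hfC, hfΩ⟩, hfn⟩ : ∃ f ∈ closure C' ∩ Ω, f ∉ C' := by
      by_contra! hcon
      exact disjoint_left.1 hdisj hwA
        ((isPreconnected_polygonInterior hE hu).subset_of_closure_inter_subset
          (hopen _ _).connectedComponentIn
          ⟨w', hCΩ hw'C, hw'C⟩ hcon hwΩ)
    have hfd : f ∈ segment ℝ (u k) (u l) := by
      by_contra hfd
      exact hfn (mem_connectedComponentIn_of_mem_closure ⟨hfΩ, hfd⟩ hfC)
    obtain ⟨y, hyB, hyC⟩ := mem_closure_iff.1 hfC B (hopen _ _).connectedComponentIn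
      (hd'B (mem_openSegment_of_mem_polygonInterior hfΩ hfd))
    have hCB : C' ⊆ B := hsubB C' hCΩ isPreconnected_connectedComponentIn hC ⟨y, hyC, hyB⟩
    exact disjoint_left.1 hdisj hwA (hmin C' ⟨k, l, w', hd', hw', rfl⟩ hCB hwB)
  · obtain ⟨y, hyC, hyd⟩ := not_disjoint_iff.1 hC
    have hdC : openSegment ℝ (u i) (u j) ⊆ C' :=
      subset_connectedComponentIn_of_inter (convex_openSegment _ _).isPreconnected
        (fun x hx => ⟨hd.openSegment_subset hE hu hx, fun h =>
          hne (eq_pair_of_mem_segments hE hd.1 hd'.1 hx h).symm⟩) ⟨y, hyd, hyC⟩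
    have hAB : A' ⊆ B := hsubB A' hAΩ isPreconnected_connectedComponentIn
      (hdisj.mono_right hdC) ⟨w, hwA, hwB⟩
    have hBA : B ⊆ A' := hmin A' ⟨k, l, w, hd', hw, rfl⟩ hAB
    obtain ⟨x, hx⟩ : (openSegment ℝ (u k) (u l)).Nonempty :=
      ⟨_, midpoint_mem_openSegment (𝕜 := ℝ) (u k) (u l)⟩
    exact (connectedComponentIn_subset _ _ (hBA (hd'B hx))).2 (openSegment_subset_segment ℝ _ _ hx)

end PlaneGraph

end

/-- Every irreducible near-triangulation of order `n ≥ 7` contains at least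
one terminal polygon. -/
theorem irreducible_has_terminalPolygon (T : PlaneGraph) (h : ℕ) (u : ZMod h → ℝ × ℝ)
    (hT : T.IsNearTriangulation) (hu : T.IsBoundaryCycle u)
    (hn : 7 ≤ T.verts.card) (hirr : T.Irreducible u) :
    ∃ R : Set (ℝ × ℝ), T.IsTerminalPolygon u R := by
  have : NeZero h := ⟨by have := hu.1; lia⟩
  have hreg : ∀ w, T.IsInteriorVtx u w →
      w ∈ PlaneGraph.polygonInterior u \ T.diagonalDrawing u := fun w hw =>
    ⟨hw.mem_polygonInterior hT hu, fun ⟨_, _, hij, _, _, hx⟩ => hw.notMem_segment hT.1 hij hx⟩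
  obtain ⟨w₀, hw₀⟩ := hirr.1
  by_cases hdiag : ∃ i j, T.IsDiagonal u i j
  · obtain ⟨i₀, j₀, hd₀⟩ := hdiag
    obtain ⟨B, ⟨i, j, w, hd, hw, rfl⟩, hmin⟩ :=
      (PlaneGraph.finite_cutParts (T := T) (u := u)).exists_minimal ⟨_, i₀, j₀, w₀, hd₀, hw₀, rfl⟩
    have hwR := mem_connectedComponentIn (hreg w hw)
    refine ⟨_, ⟨w, hreg w hw, rfl⟩, ⟨w, hw, hwR⟩, ?_⟩
    rintro i₁ j₁ i₂ j₂ hs₁ hs₂ ⟨w₁, hw₁, ho₁⟩ ⟨w₂, hw₂, ho₂⟩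
    exact (PlaneGraph.pair_eq_of_oppositeSideOf hT hu hd hw (fun B hB => hmin hB) hs₁ hw₁
      (ho₁ w hwR)).trans (PlaneGraph.pair_eq_of_oppositeSideOf hT hu hd hw (fun B hB => hmin hB) hs₂
      hw₂ (ho₂ w hwR)).symm
  · refine ⟨_, ⟨w₀, hreg w₀ hw₀, rfl⟩, ⟨w₀, hw₀, mem_connectedComponentIn (hreg w₀ hw₀)⟩, ?_⟩
    intro i j k l hs
    exact absurd ⟨i, j, hs.1, hs.2.1, hs.2.2.1⟩ hdiag
end
end
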